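/- arXiv:1907.01915 — 5 statements merged into one kernel-verified Lean document; each statement's English description precedes it below -/
import Mathlib

section
/- Let A be a finite-dimensional self-injective k-algebra and X a generator of A-mod (i.e., A ∈ add(X)). For any finite admissible subset Φ of ℕ, the Hom functor sends A to a projective-injective G^Φ_A(X)-module: the module G^Φ_A(X, A) = ⊕_{i,j∈Φ} Ext^{j−i}_A(X, A) is both projective and injective over G^Φ_A(X); moreover since A is self-injective, Ext^l_A(X, A) = 0 for all l > 0, so G^Φ_A(X, A) is the direct sum over Φ of copies of Hom_A(X, A). -/
open CategoryTheory

universe v u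

/-- A subset `Φ` of the natural numbers is *admissible* if `0 ∈ Φ` and for all
`p, q, r ∈ Φ` with `p + q + r ∈ Φ`, one has `p + q ∈ Φ` if and only if `q + r ∈ Φ`. -/
def AdmissibleSet (Φ : Set ℕ) : Prop :=
  0 ∈ Φ ∧ ∀ p q r : ℕ, p ∈ Φ → q ∈ Φ → r ∈ Φ → p + q + r ∈ Φ → (p + q ∈ Φ ↔ q + r ∈ Φ)

variable {C : Type u} [Category.{v} C] [Preadditive C]

/-- The additive group `G^Φ(X, Y) = ⊕_{i,j ∈ Φ} Hom(X[i], Y[j])`: `Φ × Φ`-matrices whose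
`(i,j)` entry is a morphism `X[i] ⟶ Y[j]` (an element of `Ext^{j-i}(X,Y)` in the derived
category), with the `(i,j)` entry vanishing unless `i ≤ j` and `j - i ∈ Φ`. -/
def bgPairCarrier (Φ : Finset ℕ) (Xs Ys : ℕ → C) :
    AddSubgroup (∀ _i : Φ, ∀ _j : Φ, ((Xs _i : C) ⟶ (Ys _j : C))) where
  carrier := {f | ∀ i j : Φ, ¬((i : ℕ) ≤ (j : ℕ) ∧ ((j : ℕ) - (i : ℕ)) ∈ Φ) → f i j = 0}
  zero_mem' := fun _ _ _ => rfl
  add_mem' := by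
    intro f g hf hg i j h
    show f i j + g i j = 0
    rw [hf i j h, hg i j h, add_zero]
  neg_mem' := by
    intro f hf i j h
    show -(f i j) = 0
    rw [hf i j h, neg_zero]

/-- Matrix multiplication (by composition in the category, truncated according to `Φ`)
`G^Φ(X,Y) × G^Φ(Y,Z) → G^Φ(X,Z)`.  For `Y = X = Z` this is the multiplication of the
`Φ`-Beilinson-Green algebra `G^Φ(X)`; for `Y = X` it is the left `G^Φ(X)`-action on
`G^Φ(X,Z)`. -/
def bgComp {Φ : Finset ℕ} {Xs Ys Zs : ℕ → C}
    (f : bgPairCarrier Φ Xs Ys) (g : bgPairCarrier Φ Ys Zs) : bgPairCarrier Φ Xs Zs :=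
  ⟨fun i j =>
      if (i : ℕ) ≤ (j : ℕ) ∧ ((j : ℕ) - (i : ℕ)) ∈ Φ then
        ∑ l : Φ, f.1 i l ≫ g.1 l j
      else 0,
    fun i j h => if_neg h⟩

theorem bgAux_injective {A : Type u} [Ring A] (hA : Module.Injective A A)
    {X : Type u} [AddCommGroup X] [Module A X] {n : ℕ}
    (fb : Fin n → (X →ₗ[A] A)) (gb : Fin n → X) (hfg : ∑ b, fb b (gb b) = 1)
    {ι : Type} {R : Type*} [Ring R] {V : Type*} [AddCommGroup V] [Module R V]
    (ev : V ≃+ (ι → (X →ₗ[A] A))) (E : ι → R → (X →ₗ[A] X))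
    (t : ι → (X →ₗ[A] A) → X → R)
    (h1 : ∀ r v j x, ev (r • v) j x = ev v j (E j r x))
    (h2 : ∀ j f x r, t j f x * r = t j f (E j r x))
    (h4 : ∀ j f x y, t j f (x + y) = t j f x + t j f y)
    (h5 : ∀ j f x z, E j (t j f x) z = f z • x) :
    Module.Injective R V := by
  apply Module.Baer.injective
  intro I φ
  have h3 : ∀ j f x v z, ev (t j f x • v) j z = f z * ev v j x := by
    intro j f x v z
    rw [h1, h5, map_smul, smul_eq_mul]
  have h0 : ∀ j f, t j f 0 = 0 := by
    intro j f
    have := h4 j f 0 0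
    simpa using this
  have hsum : ∀ j f (s : Fin n → X), t j f (∑ b, s b) = ∑ b, t j f (s b) := by
    intro j f s
    exact map_sum (AddMonoidHom.mk' (t j f) (h4 j f)) s Finset.univ
  have h6 : ∀ j f (a : A) x, t j f (a • x) = ∑ b, t j f (a • gb b) * t j (fb b) x := by
    intro j f a x
    simp_rw [h2, h5]
    rw [← hsum, ← Finset.sum_smul]
    simp_rw [map_smul]
    rw [← Finset.smul_sum, hfg, smul_eq_mul, mul_one]
  let N : ι → Submodule A X := fun j =>
    { carrier := {x | ∀ b, t j (fb b) x ∈ I}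
      zero_mem' := fun b => by rw [h0]; exact I.zero_mem
      add_mem' := fun {x y} hx hy b => by rw [h4]; exact I.add_mem (hx b) (hy b)
      smul_mem' := fun c x hx b => by
        rw [h6]
        exact I.sum_mem fun b' _ => I.mul_mem_left _ (hx b') }
  let ψ : ∀ j, N j →ₗ[A] A := fun j =>
    { toFun := fun x => ∑ a, ev (φ ⟨t j (fb a) x.1, x.2 a⟩) j (gb a)
      map_add' := fun x y => by
        rw [← Finset.sum_add_distrib]
        refine Finset.sum_congr rfl fun a _ => ?_
        have : (⟨t j (fb a) (x + y).1, (x + y).2 a⟩ : I)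
            = ⟨t j (fb a) x.1, x.2 a⟩ + ⟨t j (fb a) y.1, y.2 a⟩ := Subtype.ext (h4 _ _ _ _)
        rw [this, map_add, map_add]; rfl
      map_smul' := fun c x => by
        have : ∀ a, (⟨t j (fb a) (c • x).1, (c • x).2 a⟩ : I)
            = ∑ b, t j (fb a) (c • gb b) • (⟨t j (fb b) x.1, x.2 b⟩ : I) := fun a => by
          apply Subtype.ext
          simp only [AddSubmonoidClass.coe_finsetSum]
          exact h6 _ _ _ _
        simp_rw [this, map_sum, map_smul, Finset.sum_apply, LinearMap.sum_apply, h3]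
        rw [Finset.sum_comm]
        simp_rw [← Finset.sum_mul, hfg, one_mul, map_smul]
        rw [← Finset.smul_sum]; rfl }
  have hext : ∀ j, ∃ Ψ : X →ₗ[A] A, ∀ x : N j, Ψ x = ψ j x := fun j =>
    hA.out (N j).subtype (N j).injective_subtype (ψ j)
  choose Ψ hΨ using hext
  refine ⟨LinearMap.toSpanSingleton R V (ev.symm Ψ), fun r hr => ?_⟩
  apply ev.injective
  funext j
  ext x
  rw [LinearMap.toSpanSingleton_apply, h1, AddEquiv.apply_symm_apply]
  have hm : E j r x ∈ N j := fun b => by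
    rw [← h2]; exact I.mul_mem_left _ hr
  rw [hΨ j ⟨_, hm⟩]
  show ∑ a, ev (φ ⟨t j (fb a) (E j r x), hm a⟩) j (gb a) = _
  have : ∀ a, (⟨t j (fb a) (E j r x), hm a⟩ : I) = t j (fb a) x • (⟨r, hr⟩ : I) := fun a =>
    Subtype.ext (h2 _ _ _ _).symm
  simp_rw [this, map_smul, h3]
  rw [← Finset.sum_mul, hfg, one_mul]

theorem bgAux_projective {A : Type u} [Ring A]
    {X : Type u} [AddCommGroup X] [Module A X] {n : ℕ}
    (fb : Fin n → (X →ₗ[A] A)) (gb : Fin n → X) (hfg : ∑ b, fb b (gb b) = 1)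
    {ι : Type} [Fintype ι] {R : Type*} [Ring R] {V : Type*} [AddCommGroup V] [Module R V]
    (ev : V ≃+ (ι → (X →ₗ[A] A))) (E : ι → R → (X →ₗ[A] X))
    (t : ι → (X →ₗ[A] A) → X → R)
    (h1 : ∀ r v j x, ev (r • v) j x = ev v j (E j r x))
    (h4' : ∀ j f g x, t j (f + g) x = t j f x + t j g x)
    (h5 : ∀ j f x z, E j (t j f x) z = f z • x)
    (h7 : ∀ j f x r, r * t j f x = t j (f ∘ₗ E j r) x)
    (h8 : ∀ i j f x z, i ≠ j → E i (t j f x) z = 0) :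
    Module.Projective R V := by
  classical
  let w : Fin n → V := fun b => ev.symm (fun _ => fb b)
  let p : (Fin n → R) →ₗ[R] V := 
    { toFun := fun r => ∑ b, r b • w b
      map_add' := fun r s => by simp [add_smul, Finset.sum_add_distrib]
      map_smul' := fun c r => by simp [Finset.smul_sum, mul_smul] }
  let s : V →ₗ[R] (Fin n → R) :=
    { toFun := fun v b => ∑ j, t j (ev v j) (gb b)
      map_add' := fun v w => by
        funext b
        simp [h4', Finset.sum_add_distrib]
      map_smul' := fun r v => by
        funext b
        simp only [RingHom.id_apply, Pi.smul_apply, smul_eq_mul, Finset.mul_sum, h7]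
        refine Finset.sum_congr rfl fun j _ => ?_
        congr 1
        ext x
        exact h1 _ _ _ _ }
  refine Module.Projective.of_split s p ?_
  ext v
  apply ev.injective
  funext i
  ext z
  show ev (∑ b, (∑ j, t j (ev v j) (gb b)) • w b) i z = ev v i z
  simp_rw [Finset.sum_smul, map_sum, Finset.sum_apply, LinearMap.sum_apply, h1]
  have : ∀ b, ∑ j, ev (w b) i (E i (t j (ev v j) (gb b)) z) = ev v i z * fb b (gb b) := fun b => by
    rw [Finset.sum_eq_single i]
    · simp [w, h5]
    · intro j _ hj
      rw [h8 _ _ _ _ _ hj.symm, map_zero]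
    · simp
  simp_rw [this, ← Finset.mul_sum, hfg, mul_one]

section
variable {D : Type*} [Category D] [Preadditive D] {A : Type u} [Ring A]
  (F : ℕ → ModuleCat.{u} A ⥤ D)

theorem bgPair_ext {Φ : Finset ℕ} {Xs Ys : ℕ → D} {f g : bgPairCarrier Φ Xs Ys}
    (h : ∀ i j, f.1 i j = g.1 i j) : f = g :=
  Subtype.ext (funext fun i => funext fun j => h i j)

/-- Diagonal matrices. -/
noncomputable def bgDiag (Φ : Finset ℕ) (h0 : 0 ∈ Φ) (M N : ModuleCat.{u} A) (φ : Φ → (M ⟶ N)) :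
    bgPairCarrier Φ (fun i => (F i).obj M) (fun i => (F i).obj N) :=
  ⟨fun i l => if h : i = l then (F i).map (φ i) ≫ eqToHom (by rw [h]) else 0,
    fun i l h => dif_neg (fun h' => h (by subst h'; simpa using h0))⟩

theorem bgDiag_self (Φ : Finset ℕ) (h0 : 0 ∈ Φ) (M N : ModuleCat.{u} A) (φ : Φ → (M ⟶ N))
    (i : Φ) : (bgDiag F Φ h0 M N φ).1 i i = (F i).map (φ i) := by
  simp [bgDiag]

theorem bgDiag_ne (Φ : Finset ℕ) (h0 : 0 ∈ Φ) (M N : ModuleCat.{u} A) (φ : Φ → (M ⟶ N))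
    (i l : Φ) (h : i ≠ l) : (bgDiag F Φ h0 M N φ).1 i l = 0 := by
  simp [bgDiag, h]

theorem bgComp_diag_left {Φ : Finset ℕ} (h0 : 0 ∈ Φ) (M N : ModuleCat.{u} A) (φ : Φ → (M ⟶ N))
    {Zs : ℕ → D} (g : bgPairCarrier Φ (fun i => (F i).obj N) Zs) (i l : Φ) :
    (bgComp (Xs := fun i => (F i).obj M) (Ys := fun i => (F i).obj N) (Zs := Zs)
      (bgDiag F Φ h0 M N φ) g).1 i l = (F i).map (φ i) ≫ g.1 i l := by
  unfold bgComp
  dsimp only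
  split_ifs with h
  · rw [Finset.sum_eq_single i, bgDiag_self]
    · intro b _ hb
      rw [bgDiag_ne _ _ _ _ _ _ _ _ hb.symm, Limits.zero_comp]
    · simp
  · rw [g.2 i l h, Limits.comp_zero]

theorem bgComp_diag_right {Φ : Finset ℕ} (h0 : 0 ∈ Φ) (M N : ModuleCat.{u} A) (φ : Φ → (M ⟶ N))
    {Zs : ℕ → D} (g : bgPairCarrier Φ Zs (fun i => (F i).obj M)) (i l : Φ) :
    (bgComp (Xs := Zs) (Ys := fun i => (F i).obj M) (Zs := fun i => (F i).obj N)
      g (bgDiag F Φ h0 M N φ)).1 i l = g.1 i l ≫ (F l).map (φ l) := by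
  unfold bgComp
  dsimp only
  split_ifs with h
  · rw [Finset.sum_eq_single l, bgDiag_self]
    · intro b _ hb
      rw [bgDiag_ne _ _ _ _ _ _ _ _ hb, Limits.comp_zero]
    · simp
  · rw [g.2 i l h, Limits.zero_comp]

theorem bg_main [∀ i, (F i).Full] [∀ i, (F i).Faithful] [∀ i, (F i).Additive]
    (hA : Module.Injective A A)
    (X : Type u) [AddCommGroup X] [Module A X]
    {n : ℕ}
    (fb : Fin n → (X →ₗ[A] A)) (gb : Fin n → X) (hfg : ∑ b, fb b (gb b) = 1)
    (Φ : Finset ℕ) (hΦ : 0 ∈ Φ)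
    (hXA : ∀ i j : ℕ, i < j →
      ∀ φ : (F i).obj (ModuleCat.of A X) ⟶ (F j).obj (ModuleCat.of A A), φ = 0)
    (hAX : ∀ i j : ℕ, i < j →
      ∀ φ : (F i).obj (ModuleCat.of A A) ⟶ (F j).obj (ModuleCat.of A X), φ = 0)
    (R : Type*) [Ring R]
    (ρ : R ≃+ bgPairCarrier Φ (fun i => (F i).obj (ModuleCat.of A X))
      (fun i => (F i).obj (ModuleCat.of A X)))
    (hρ : ∀ r s : R, ρ (r * s) =
      bgComp (Xs := fun i => (F i).obj (ModuleCat.of A X))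
        (Ys := fun i => (F i).obj (ModuleCat.of A X))
        (Zs := fun i => (F i).obj (ModuleCat.of A X)) (ρ r) (ρ s))
    [instV : Module R (bgPairCarrier Φ (fun i => (F i).obj (ModuleCat.of A X))
      (fun i => (F i).obj (ModuleCat.of A A)))]
    (hV : ∀ (r : R) (v : bgPairCarrier Φ (fun i => (F i).obj (ModuleCat.of A X))
      (fun i => (F i).obj (ModuleCat.of A A))), r • v =
        bgComp (Xs := fun i => (F i).obj (ModuleCat.of A X))
          (Ys := fun i => (F i).obj (ModuleCat.of A X))
          (Zs := fun i => (F i).obj (ModuleCat.of A A)) (ρ r) v) :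
    (Module.Projective R (bgPairCarrier Φ (fun i => (F i).obj (ModuleCat.of A X))
        (fun i => (F i).obj (ModuleCat.of A A))) ∧
      Module.Injective R (bgPairCarrier Φ (fun i => (F i).obj (ModuleCat.of A X))
        (fun i => (F i).obj (ModuleCat.of A A)))) ∧
    (∀ v : bgPairCarrier Φ (fun i => (F i).obj (ModuleCat.of A X))
      (fun i => (F i).obj (ModuleCat.of A A)), ∀ i j : Φ, (i : ℕ) ≠ (j : ℕ) → v.1 i j = 0) := by
  classical
  have hoff : ∀ v : bgPairCarrier Φ (fun i => (F i).obj (ModuleCat.of A X))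
      (fun i => (F i).obj (ModuleCat.of A A)), ∀ i j : Φ, (i : ℕ) ≠ (j : ℕ) → v.1 i j = 0 := by
    intro v i j hij
    by_cases h : (i : ℕ) ≤ j
    · exact hXA _ _ (lt_of_le_of_ne h hij) _
    · exact v.2 i j (fun h' => h h'.1)
  refine ⟨?_, hoff⟩
  have hdiag : ∀ v : bgPairCarrier Φ (fun i => (F i).obj (ModuleCat.of A X))
      (fun i => (F i).obj (ModuleCat.of A A)),
      v = bgDiag F Φ hΦ _ _ (fun i => (F i).preimage (v.1 i i)) := by
    intro v
    refine Subtype.ext (funext fun i => funext fun j => ?_)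
    by_cases h : i = j
    · subst h
      rw [bgDiag_self, Functor.map_preimage]
    · rw [bgDiag_ne _ _ _ _ _ _ _ _ h]
      exact hoff _ _ _ (fun h' => h (Subtype.ext h'))
  let ev : (bgPairCarrier Φ (fun i => (F i).obj (ModuleCat.of A X))
      (fun i => (F i).obj (ModuleCat.of A A))) ≃+ (Φ → (X →ₗ[A] A)) :=
    { toFun := fun v i => ((F i).preimage (v.1 i i)).hom
      invFun := fun f => bgDiag F Φ hΦ _ _ (fun i => ModuleCat.ofHom (f i))
      left_inv := fun v => (hdiag v).symm
      right_inv := fun f => by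
        funext i
        simp [bgDiag_self]
      map_add' := fun v w => by
        funext i
        show ((F i).preimage (v.1 i i + w.1 i i)).hom
          = ((F i).preimage (v.1 i i)).hom + ((F i).preimage (w.1 i i)).hom
        rw [← ModuleCat.hom_add]
        congr 1
        apply (F i).map_injective
        simp [Functor.map_add] }
  let E : Φ → R → (X →ₗ[A] X) := fun i r => ((F i).preimage ((ρ r).1 i i)).hom
  let one : X → (ModuleCat.of A A ⟶ ModuleCat.of A X) := fun x =>
    ModuleCat.ofHom (LinearMap.toSpanSingleton A X x)
  let T : Φ → (X →ₗ[A] A) → X → Φ → (ModuleCat.of A X ⟶ ModuleCat.of A X) := fun j f x i =>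
    if i = j then ModuleCat.ofHom f ≫ one x else 0
  let t : Φ → (X →ₗ[A] A) → X → R := fun j f x => ρ.symm (bgDiag F Φ hΦ _ _ (T j f x))
  have ht : ∀ j f x, ρ (t j f x) = bgDiag F Φ hΦ _ _ (T j f x) := fun j f x =>
    ρ.apply_symm_apply _
  have h1 : ∀ r v j x, ev (r • v) j x = ev v j (E j r x) := by
    intro r v j x
    have : (r • v).1 j j = (ρ r).1 j j ≫ v.1 j j := by
      rw [hV]
      conv_lhs => rw [hdiag v]
      rw [bgComp_diag_right, Functor.map_preimage]
    show ((F j).preimage ((r • v).1 j j)).hom x = _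
    rw [this, Functor.preimage_comp]
    rfl
  have hE : ∀ i j f x, E i (t j f x) = (T j f x i).hom := by
    intro i j f x
    show ((F i).preimage ((ρ (t j f x)).1 i i)).hom = _
    rw [ht, bgDiag_self, Functor.preimage_map]
  have h5 : ∀ j f x z, E j (t j f x) z = f z • x := by
    intro j f x z
    rw [hE]
    simp [T, one]
  have h8 : ∀ i j f x z, i ≠ j → E i (t j f x) z = 0 := by
    intro i j f x z h
    rw [hE]
    simp [T, h]
  have hdd : ∀ (φ ψ : Φ → (ModuleCat.of A X ⟶ ModuleCat.of A X)),
      bgDiag F Φ hΦ _ _ (φ + ψ) = bgDiag F Φ hΦ _ _ φ + bgDiag F Φ hΦ _ _ ψ := by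
    intro φ ψ
    refine Subtype.ext (funext fun i => funext fun l => ?_)
    show _ = (bgDiag F Φ hΦ _ _ φ).1 i l + (bgDiag F Φ hΦ _ _ ψ).1 i l
    by_cases h : i = l
    · subst h
      rw [bgDiag_self, bgDiag_self, bgDiag_self, Pi.add_apply, Functor.map_add]
    · rw [bgDiag_ne _ _ _ _ _ _ _ _ h, bgDiag_ne _ _ _ _ _ _ _ _ h, bgDiag_ne _ _ _ _ _ _ _ _ h,
        add_zero]
  have h4 : ∀ j f x y, t j f (x + y) = t j f x + t j f y := by
    intro j f x y
    apply ρ.injective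
    rw [map_add, ht, ht, ht, ← hdd]
    congr 1
    funext i
    by_cases h : i = j
    · ext z
      simp [T, h, one]
    · simp [T, h]
  have h4' : ∀ j f g x, t j (f + g) x = t j f x + t j g x := by
    intro j f g x
    apply ρ.injective
    rw [map_add, ht, ht, ht, ← hdd]
    congr 1
    funext i
    by_cases h : i = j
    · ext z
      simp [T, h, one, add_smul]
    · simp [T, h]
  have hr0 : ∀ (r : R) (i l : Φ), ¬ (i : ℕ) < l → i ≠ l → (ρ r).1 i l = 0 := by
    intro r i l h hne
    exact (ρ r).2 i l fun h' => h (lt_of_le_of_ne h'.1 fun h'' => hne (Subtype.ext h''))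
  have h2 : ∀ j f x r, t j f x * r = t j f (E j r x) := by
    intro j f x r
    apply ρ.injective
    rw [hρ, ht, ht]
    refine Subtype.ext (funext fun i => funext fun l => ?_)
    rw [bgComp_diag_left]
    by_cases h : i = l
    · subst h
      rw [bgDiag_self]
      by_cases hj : i = j
      · subst hj
        rw [← (F i).map_preimage ((ρ r).1 i i), ← Functor.map_comp]
        congr 1
        ext z
        simp [T, one, E]
      · simp [T, hj]
    · rw [bgDiag_ne _ _ _ _ _ _ _ _ h]
      by_cases hl : (i : ℕ) < l
      · by_cases hj : i = j
        · simp only [T, hj, if_true, Functor.map_comp, Category.assoc]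
          subst hj
          rw [hAX _ _ hl ((F i).map (one x) ≫ (ρ r).1 i l), Limits.comp_zero]
        · simp [T, hj]
      · rw [hr0 _ _ _ hl h, Limits.comp_zero]
  have h7 : ∀ j f x r, r * t j f x = t j (f ∘ₗ E j r) x := by
    intro j f x r
    apply ρ.injective
    rw [hρ, ht, ht]
    refine Subtype.ext (funext fun i => funext fun l => ?_)
    rw [bgComp_diag_right]
    by_cases h : i = l
    · subst h
      rw [bgDiag_self]
      by_cases hj : i = j
      · subst hj
        rw [← (F i).map_preimage ((ρ r).1 i i), ← Functor.map_comp]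
        congr 1
        ext z
        simp [T, one, E]
      · simp [T, hj]
    · rw [bgDiag_ne _ _ _ _ _ _ _ _ h]
      by_cases hl : (i : ℕ) < l
      · by_cases hj : l = j
        · subst hj
          simp only [T, if_true, Functor.map_comp]
          rw [← Category.assoc, hXA _ _ hl ((ρ r).1 i l ≫ (F l).map (ModuleCat.ofHom f)),
            Limits.zero_comp]
        · simp [T, hj]
      · rw [hr0 _ _ _ hl h, Limits.zero_comp]
  exact ⟨bgAux_projective fb gb hfg ev E t h1 h4' h5 h7 h8,
    bgAux_injective hA fb gb hfg ev E t h1 h2 h4 h5⟩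

end

section
open Abelian

theorem bg_ext_inj (A : Type u) [Ring A] [HasDerivedCategory (ModuleCat.{u} A)]
    (M N : ModuleCat.{u} A) (h : ∀ (m : ℕ) (e : Ext M N (m + 1)), e = 0)
    (l : ℤ) (hl : 0 < l)
    (φ : (DerivedCategory.singleFunctor (ModuleCat.{u} A) 0).obj M ⟶
      ((DerivedCategory.singleFunctor (ModuleCat.{u} A) 0).obj N)⟦l⟧) : φ = 0 := by
  obtain ⟨m, rfl⟩ : ∃ m : ℕ, l = ((m + 1 : ℕ) : ℤ) := ⟨l.toNat - 1, by omega⟩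
  have hs : Subsingleton (Ext M N (m + 1)) := ⟨fun a b => (h m a).trans (h m b).symm⟩
  exact (Ext.homEquiv (X := M) (Y := N) (n := m + 1)).symm.injective (Subsingleton.elim _ _)

theorem bg_shift_zero {D : Type*} [Category D] [Preadditive D] [HasShift D ℤ]
    [∀ n : ℤ, (shiftFunctor D n).Additive]
    (M N : D) (h : ∀ l : ℤ, 0 < l → ∀ φ : M ⟶ N⟦l⟧, φ = 0)
    (i j : ℤ) (hij : i < j) (φ : M⟦i⟧ ⟶ N⟦j⟧) : φ = 0 := by
  let e := (shiftFunctorAdd' D (j - i) i j (by omega)).app N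
  have h2 : φ ≫ e.hom = 0 := by
    obtain ⟨ψ, hψ⟩ := (shiftFunctor D i).map_surjective (φ ≫ e.hom)
    rw [← hψ, h (j - i) (by omega) ψ, Functor.map_zero]
  rw [← cancel_mono e.hom, h2, Limits.zero_comp]

end

/-- Let `A` be a finite-dimensional self-injective `k`-algebra and `X` a generator of
`A`-mod (i.e. `A` is a direct summand of some `Xⁿ`).  Let `Φ` be a finite admissible
subset of `ℕ` and let `R` be (a ring isomorphic to) the `Φ`-Beilinson-Green algebra
`G^Φ_A(X)` (with its matrix multiplication by composition in the derived category), and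
let `G^Φ_A(X, A) = ⊕_{i,j ∈ Φ} Ext^{j-i}_A(X, A)` carry its natural left
`G^Φ_A(X)`-module structure.  Then `G^Φ_A(X, A)` is both projective and injective over
`G^Φ_A(X)`; moreover, since `A` is self-injective, `Ext^l_A(X, A) = 0` for all `l > 0`,
so that `G^Φ_A(X, A)` is the direct sum over `Φ` of copies of `Hom_A(X, A)` (only the
diagonal entries of its elements can be nonzero). -/
theorem beilinsonGreen_hom_to_A_projective_injective
    (k : Type u) [Field k] (A : Type u) [Ring A] [Algebra k A] [FiniteDimensional k A]
    -- `A` is self-injective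
    (hA : Module.Injective A A)
    (X : Type u) [AddCommGroup X] [Module A X]
    -- `X` is a generator of `A`-mod: `A ∈ add(X)`
    (hXgen : ∃ (n : ℕ) (f : (Fin n → X) →ₗ[A] A) (g : A →ₗ[A] (Fin n → X)),
      f ∘ₗ g = LinearMap.id)
    (Φ : Finset ℕ) (hΦ : AdmissibleSet (↑Φ : Set ℕ)) :
    letI : HasDerivedCategory (ModuleCat.{u} A) := HasDerivedCategory.standard _
    let Xobj : DerivedCategory (ModuleCat.{u} A) :=
      (DerivedCategory.singleFunctor (ModuleCat.{u} A) 0).obj (ModuleCat.of A X)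
    let Aobj : DerivedCategory (ModuleCat.{u} A) :=
      (DerivedCategory.singleFunctor (ModuleCat.{u} A) 0).obj (ModuleCat.of A A)
    let Xs : ℕ → DerivedCategory (ModuleCat.{u} A) := fun i => Xobj⟦(i : ℤ)⟧
    let As : ℕ → DerivedCategory (ModuleCat.{u} A) := fun i => Aobj⟦(i : ℤ)⟧
    ∀ (R : Type (u + 1)) [Ring R] (ρ : R ≃+ bgPairCarrier Φ Xs Xs),
      (∀ r s : R, ρ (r * s) = bgComp (ρ r) (ρ s)) →
      ∀ [instV : Module R (bgPairCarrier Φ Xs As)],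
        (∀ (r : R) (v : bgPairCarrier Φ Xs As), r • v = bgComp (ρ r) v) →
        (Module.Projective R (bgPairCarrier Φ Xs As) ∧
         Module.Injective R (bgPairCarrier Φ Xs As)) ∧
        -- `Ext^l_A(X, A) = 0` for all `l > 0`
        (∀ l : ℤ, 0 < l → ∀ φ ψ : Xobj ⟶ (Aobj⟦l⟧), φ = ψ) ∧
        -- hence only the diagonal entries of elements of `G^Φ_A(X, A)` are nonzero:
        -- `G^Φ_A(X, A)` is the direct sum over `Φ` of copies of `Hom_A(X, A)`
        (∀ v : bgPairCarrier Φ Xs As, ∀ i j : Φ, (i : ℕ) ≠ (j : ℕ) → v.1 i j = 0) := by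
  letI : HasDerivedCategory (ModuleCat.{u} A) := HasDerivedCategory.standard _
  intro Xobj Aobj Xs As R _ ρ hρ instV hV
  have hinj : CategoryTheory.Injective (ModuleCat.of A A) :=
    Module.injective_object_of_injective_module A A
  have hproj : CategoryTheory.Projective (ModuleCat.of A A) :=
    (IsProjective.iff_projective A).mp inferInstance
  have hXA : ∀ l : ℤ, 0 < l → ∀ φ : Xobj ⟶ (Aobj⟦l⟧), φ = 0 :=
    bg_ext_inj A _ _ (fun m e => Abelian.Ext.eq_zero_of_injective e)
  have hAX : ∀ l : ℤ, 0 < l → ∀ φ : Aobj ⟶ (Xobj⟦l⟧), φ = 0 :=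
    bg_ext_inj A _ _ (fun m e => Abelian.Ext.eq_zero_of_projective e)
  obtain ⟨n, f, g, hfg⟩ := hXgen
  have hsum : ∑ b, (f ∘ₗ LinearMap.single A (fun _ : Fin n => X) b) (g 1 b) = 1 := by
    have h1 := LinearMap.congr_fun hfg 1
    simp only [LinearMap.comp_apply, LinearMap.id_apply] at h1 ⊢
    rw [← map_sum]
    refine Eq.trans (congrArg f ?_) h1
    exact Finset.univ_sum_single (g 1)
  have key := bg_main
    (fun i : ℕ => DerivedCategory.singleFunctor (ModuleCat.{u} A) 0 ⋙
      shiftFunctor (DerivedCategory (ModuleCat.{u} A)) (i : ℤ)) hA X _ _ hsum Φ hΦ.1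
    (fun i j hij φ => bg_shift_zero Xobj Aobj hXA i j (by exact_mod_cast hij) φ)
    (fun i j hij φ => bg_shift_zero Aobj Xobj hAX i j (by exact_mod_cast hij) φ)
    R ρ hρ (instV := instV) hV
  exact ⟨key.1, fun l hl φ ψ => (hXA l hl φ).trans (hXA l hl ψ).symm, key.2⟩
end

section
/- Let A be a finite-dimensional self-injective k-algebra, X a generator for A-mod, and Φ a finite admissible subset of ℕ with Φ ≠ {0} and such that Ext^i_A(X,X) ≠ 0 for some 0 ≠ i ∈ Φ (equivalently G^Φ_A(X) is not the diagonal product of copies of End_A(X)). Then the dominant dimension of G^Φ_A(X) is 0. -/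
open CategoryTheory

universe v u

variable {C : Type u} [Category.{v} C] [Preadditive C]

section Helpers
open Function TensorProduct

/-- Artinian rings: infima of families of left ideals are attained on finite subfamilies. -/
theorem exists_finset_inf_le {A : Type u} [Ring A] [IsArtinianRing A] (𝒮 : Set (Ideal A)) :
    ∃ F : Finset (Ideal A), (∀ L ∈ F, L ∈ 𝒮) ∧ ∀ L ∈ 𝒮, F.inf id ≤ L := by
  classical
  obtain ⟨m, ⟨F, hF, rfl⟩, hm⟩ := IsArtinian.set_has_minimal
    {I : Submodule A A | ∃ F : Finset (Ideal A), (∀ L ∈ F, L ∈ 𝒮) ∧ F.inf id = I} ⟨⊤, ∅, by simp, by simp⟩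
  refine ⟨F, hF, fun L hL => ?_⟩
  have h := hm ((insert L F).inf id) ⟨insert L F, by
    intro L' hL'
    rcases Finset.mem_insert.1 hL' with rfl | h
    · exact hL
    · exact hF _ h, rfl⟩
  rw [Finset.inf_insert] at h
  by_contra hc
  apply h
  exact lt_of_le_of_ne inf_le_right (fun e => hc (by
    rw [← e]; exact inf_le_left))

/-- A simple quotient of `A` by a left ideal containing a finite intersection of maximal left
ideals is isomorphic to the quotient by one of these. -/
theorem exists_simple_equiv {A : Type u} [Ring A] (F : Finset (Ideal A))
    (hF : ∀ L ∈ F, L.IsMaximal) (L : Ideal A) [hL : L.IsMaximal] (h : F.inf id ≤ L) :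
    ∃ L' ∈ F, Nonempty ((A ⧸ L) ≃ₗ[A] (A ⧸ L')) := by
  classical
  have : IsSimpleModule A (A ⧸ L) := isSimpleModule_iff_isCoatom.2 hL.out
  have (i : F) : IsSimpleModule A (A ⧸ i.1) := isSimpleModule_iff_isCoatom.2 (hF _ i.2).out
  let d : A →ₗ[A] (∀ i : F, A ⧸ i.1) := LinearMap.pi fun i => Submodule.mkQ i.1
  have hker : LinearMap.ker d ≤ L := by
    refine le_trans ?_ h
    intro a ha
    rw [LinearMap.mem_ker] at ha
    have : ∀ i ∈ F, a ∈ i := fun i hi => by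
      have := congrFun ha ⟨i, hi⟩
      simpa [d] using this
    rw [Submodule.mem_finsetInf]
    exact this
  let d' : (A ⧸ LinearMap.ker d) →ₗ[A] (∀ i : F, A ⧸ i.1) := Submodule.liftQ _ d le_rfl
  have hd' : Injective d' := LinearMap.ker_eq_bot.1 (Submodule.ker_liftQ_eq_bot _ _ _ le_rfl)
  have : IsSemisimpleModule A (A ⧸ LinearMap.ker d) :=
    IsSemisimpleModule.of_injective d' hd'
  let q : (A ⧸ LinearMap.ker d) →ₗ[A] (A ⧸ L) := Submodule.mapQ _ _ LinearMap.id hker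
  have hq : q ≠ 0 := by
    intro h0
    have h1 : q (Submodule.Quotient.mk 1) = 0 := by rw [h0]; rfl
    have : Submodule.Quotient.mk (p := L) (1 : A) = 0 := h1
    rw [Submodule.Quotient.mk_eq_zero] at this
    exact hL.ne_top ((Ideal.eq_top_iff_one L).2 this)
  obtain ⟨m, ⟨e⟩⟩ := LinearMap.linearEquiv_of_ne_zero hq
  let j : (A ⧸ L) →ₗ[A] (∀ i : F, A ⧸ i.1) :=
    d' ∘ₗ m.subtype ∘ₗ e.toLinearMap
  have hj : Injective j := by
    intro a b hab
    exact e.injective (Subtype.ext (hd' hab))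
  have : Nontrivial (A ⧸ L) := IsSimpleModule.nontrivial A _
  obtain ⟨x, hx⟩ := exists_ne (0 : A ⧸ L)
  have hjx : j x ≠ 0 := fun h => hx (hj (by rw [h, map_zero]))
  obtain ⟨i, hi⟩ := Function.ne_iff.1 hjx
  have hne : (LinearMap.proj i ∘ₗ j : (A ⧸ L) →ₗ[A] (A ⧸ i.1)) ≠ 0 := fun h0 =>
    hi (LinearMap.congr_fun h0 x)
  exact ⟨i.1, i.2, ⟨LinearEquiv.ofBijective _ (LinearMap.bijective_of_ne_zero hne)⟩⟩

/-- Simple modules are determined by their annihilators over Artinian rings. -/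
theorem simple_equiv_of_annihilator_le {A : Type u} [Ring A] [IsArtinianRing A]
    (L₁ L₂ : Ideal A) [h₁ : L₁.IsMaximal] [h₂ : L₂.IsMaximal]
    (h : Module.annihilator A (A ⧸ L₁) ≤ Module.annihilator A (A ⧸ L₂)) :
    Nonempty ((A ⧸ L₂) ≃ₗ[A] (A ⧸ L₁)) := by
  have s1 : IsSimpleModule A (A ⧸ L₁) := isSimpleModule_iff_isCoatom.2 h₁.out
  obtain ⟨F, hF, hF'⟩ := exists_finset_inf_le
    {L : Ideal A | ∃ s : A ⧸ L₁, s ≠ 0 ∧ LinearMap.ker (LinearMap.toSpanSingleton A _ s) = L}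
  have hle : F.inf id ≤ L₂ := by
    refine le_trans ?_ (h.trans ?_)
    · intro a ha
      rw [Module.mem_annihilator]
      intro s
      by_cases hs : s = 0
      · simp [hs]
      · have := hF' _ ⟨s, hs, rfl⟩ ha
        simpa using this
    · intro a ha
      rw [Module.mem_annihilator] at ha
      have := ha (Submodule.Quotient.mk 1)
      rw [← Submodule.Quotient.mk_smul, Submodule.Quotient.mk_eq_zero] at this
      simpa using this
  obtain ⟨L', hL', ⟨e⟩⟩ := exists_simple_equiv F (by
    intro L hL
    obtain ⟨s, hs, rfl⟩ := hF L hL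
    exact IsSimpleModule.ker_toSpanSingleton_isMaximal A hs) L₂ hle
  obtain ⟨s, hs, rfl⟩ := hF L' hL'
  exact ⟨e.trans (LinearMap.quotKerEquivOfSurjective _
    (IsSimpleModule.toSpanSingleton_surjective A hs))⟩

/-- Primitive ideals. -/
def primIdeals (A : Type u) [Ring A] : Set (Ideal A) :=
  {n | ∃ L : Ideal A, L.IsMaximal ∧ Module.annihilator A (A ⧸ L) = n}

theorem primIdeals_finite (A : Type u) [Ring A] [IsArtinianRing A] : (primIdeals A).Finite := by
  classical
  obtain ⟨F, hF, hF'⟩ := exists_finset_inf_le {L : Ideal A | L.IsMaximal}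
  refine (F.finite_toSet.image (fun L => Module.annihilator A (A ⧸ L))).subset ?_
  rintro _ ⟨L, hL, rfl⟩
  have := hL
  obtain ⟨L', hL', ⟨e⟩⟩ := exists_simple_equiv F hF L (hF' L hL)
  exact ⟨L', hL', e.symm.annihilator_eq⟩

theorem primIdeals_maximal {A : Type u} [Ring A] [IsArtinianRing A] {n : Ideal A}
    (hn : n ∈ primIdeals A) (q : Ideal A) (hq : ∀ a ∈ q, ∀ b, a * b ∈ q) (hq1 : q ≠ ⊤)
    (hnq : n ≤ q) : q = n := by
  obtain ⟨L, hL, rfl⟩ := hn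
  obtain ⟨L', hL', hqL⟩ := Ideal.exists_le_maximal q hq1
  have hann : q ≤ Module.annihilator A (A ⧸ L') := by
    intro a ha
    rw [Module.mem_annihilator]
    intro s
    obtain ⟨b, rfl⟩ := Submodule.Quotient.mk_surjective _ s
    rw [← Submodule.Quotient.mk_smul, Submodule.Quotient.mk_eq_zero]
    exact hqL (hq a ha b)
  obtain ⟨e⟩ := simple_equiv_of_annihilator_le L L' (hnq.trans hann)
  apply le_antisymm _ hnq
  rw [← e.annihilator_eq]
  exact hann

theorem ext_through {A : Type u} [Ring A] (hA : Module.Injective A A) {M : Type u}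
    [AddCommGroup M] [Module A M] (β : A →ₗ[A] M) (γ : A →ₗ[A] A)
    (h : LinearMap.ker β ≤ LinearMap.ker γ) : ∃ g : M →ₗ[A] A, g ∘ₗ β = γ := by
  have := hA
  obtain ⟨g, hg⟩ := Module.Injective.extension_property A A (A ⧸ LinearMap.ker β) M
    (Submodule.liftQ _ β le_rfl) (LinearMap.ker_eq_bot.1 (Submodule.ker_liftQ_eq_bot _ _ _ le_rfl))
    (Submodule.liftQ _ γ h)
  refine ⟨g, ?_⟩
  ext
  exact LinearMap.congr_fun hg (Submodule.Quotient.mk 1)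

/-- Double annihilator property over a self-injective algebra. -/
theorem double_annihilator (k : Type u) [Field k] {A : Type u} [Ring A] [Algebra k A]
    [FiniteDimensional k A] (hA : Module.Injective A A) (n : Ideal A)
    (hn : ∀ a ∈ n, ∀ b, a * b ∈ n) (c : A)
    (hc : ∀ a, (∀ b ∈ n, a * b = 0) → a * c = 0) : c ∈ n := by
  classical
  let n' : Submodule k A := n.restrictScalars k
  let b := Module.finBasis k n'
  let β : A →ₗ[A] (Fin (Module.finrank k n') → A) :=
    LinearMap.pi fun i => LinearMap.toSpanSingleton A A (b i : A)
  obtain ⟨g, hg⟩ := ext_through hA β (LinearMap.toSpanSingleton A A c) (by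
    intro a ha
    rw [LinearMap.mem_ker] at ha ⊢
    rw [LinearMap.toSpanSingleton_apply, smul_eq_mul]
    apply hc
    intro x hx
    have h1 : ∀ i, a * (b i : A) = 0 := fun i => by
      simpa [β] using congrFun ha i
    have h2 := congrArg (Subtype.val) (b.sum_repr ⟨x, hx⟩)
    rw [AddSubmonoidClass.coe_finsetSum] at h2
    change _ = x at h2
    rw [← h2, Finset.mul_sum]
    refine Finset.sum_eq_zero fun i _ => ?_
    change a * ((b.repr ⟨x, hx⟩ i) • (b i : A)) = 0
    rw [mul_smul_comm, h1, smul_zero])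
  have h1 : g (β 1) = c := by
    have := LinearMap.congr_fun hg 1
    simpa using this
  rw [← h1, ← LinearMap.sum_single_apply (fun _ => A) (β 1), map_sum]
  refine Ideal.sum_mem _ fun i _ => ?_
  have h2 : (Pi.single i (β 1 i) : Fin _ → A) = (b i : A) • (Pi.single i (1 : A) : Fin _ → A) := by
    rw [← Pi.single_smul]
    simp [β]
  rw [h2, map_smul]
  exact hn _ (b i).2 _

/-- Every simple module over a finite-dimensional self-injective algebra embeds into it. -/
theorem simple_embeds (k : Type u) [Field k] {A : Type u} [Ring A] [Algebra k A]
    [FiniteDimensional k A] (hA : Module.Injective A A) (L : Ideal A) (hL : L.IsMaximal) :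
    ∃ c : A, c ≠ 0 ∧ ∀ a ∈ L, a * c = 0 := by
  classical
  have : IsArtinianRing A := IsArtinianRing.of_finite k A
  have key : ∀ n : primIdeals A, ∃ s : A, s ≠ 0 ∧ (∀ b ∈ n.1, s * b = 0) ∧
      Ideal.IsMaximal (LinearMap.ker (LinearMap.toSpanSingleton A A s)) := by
    rintro ⟨n, hn⟩
    have hn2 : ∀ a ∈ n, ∀ b, a * b ∈ n := by
      obtain ⟨L, hL, rfl⟩ := hn
      intro a ha b
      rw [Module.mem_annihilator] at ha ⊢
      intro m
      rw [mul_smul, ha]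
    have hn1 : n ≠ ⊤ := by
      obtain ⟨L, hL, rfl⟩ := hn
      intro h
      have h1 : (1 : A) ∈ Module.annihilator A (A ⧸ L) := h ▸ trivial
      rw [Module.mem_annihilator] at h1
      have := h1 (Submodule.Quotient.mk 1)
      rw [one_smul, Submodule.Quotient.mk_eq_zero] at this
      exact hL.ne_top ((Ideal.eq_top_iff_one L).2 this)
    let l : Submodule A A :=
      { carrier := {a | ∀ b ∈ n, a * b = 0}
        zero_mem' := fun b _ => zero_mul b
        add_mem' := fun {x y} hx hy b hb => by rw [add_mul, hx b hb, hy b hb, add_zero]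
        smul_mem' := fun c x hx b hb => by rw [smul_eq_mul, mul_assoc, hx b hb, mul_zero] }
    have hl : l ≠ ⊥ := by
      intro h
      apply hn1
      rw [Ideal.eq_top_iff_one]
      refine double_annihilator k hA n hn2 1 fun a ha => ?_
      have : a ∈ l := ha
      rw [h] at this
      rw [(Submodule.mem_bot A).1 this, zero_mul]
    obtain ⟨S, hS, hSl⟩ := (IsAtomic.eq_bot_or_exists_atom_le l).resolve_left hl
    obtain ⟨s, hsS, hs0⟩ := S.ne_bot_iff.1 hS.1
    have hsimple : IsSimpleModule A S := isSimpleModule_iff_isAtom.2 hS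
    refine ⟨s, hs0, hSl hsS, ?_⟩
    have := IsSimpleModule.ker_toSpanSingleton_isMaximal A (m := (⟨s, hsS⟩ : S))
      (fun h => hs0 (congrArg Subtype.val h))
    convert this using 1
    ext a
    simp [Subtype.ext_iff]
  choose s hs0 hsn hmax using key
  let K : primIdeals A → Ideal A := fun n => LinearMap.ker (LinearMap.toSpanSingleton A A (s n))
  have hK : ∀ n, (K n).IsMaximal := hmax
  let σ : primIdeals A → primIdeals A := fun n =>
    ⟨Module.annihilator A (A ⧸ K n), K n, hK n, rfl⟩
  have hfin : Finite (primIdeals A) := primIdeals_finite A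
  have emb : ∀ (n : primIdeals A) (L' : Ideal A), L'.IsMaximal →
      Nonempty ((A ⧸ L') ≃ₗ[A] (A ⧸ K n)) → ∃ t : A, t ≠ 0 ∧ (∀ a ∈ L', a * (t * s n) = 0) ∧
        t * s n ≠ 0 := by
    rintro n L' hL' ⟨e⟩
    obtain ⟨t, ht⟩ := Submodule.Quotient.mk_surjective _ (e (Submodule.Quotient.mk 1))
    have h1 : t * s n ≠ 0 := by
      intro h
      have h2 : t ∈ K n := by
        change t ∈ LinearMap.ker _
        rw [LinearMap.mem_ker]
        simpa using h
      rw [(Submodule.Quotient.mk_eq_zero _).2 h2] at ht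
      have h3 : (Submodule.Quotient.mk 1 : A ⧸ L') = 0 := by
        apply e.injective
        rw [← ht, map_zero]
      rw [Submodule.Quotient.mk_eq_zero] at h3
      exact hL'.ne_top ((Ideal.eq_top_iff_one L').2 h3)
    refine ⟨t, fun h => h1 (by rw [h, zero_mul]), fun a ha => ?_, h1⟩
    have h4 : (Submodule.Quotient.mk (a * t) : A ⧸ K n) = 0 := by
      rw [← smul_eq_mul, Submodule.Quotient.mk_smul, ht, ← map_smul,
        ← Submodule.Quotient.mk_smul, smul_eq_mul, mul_one, (Submodule.Quotient.mk_eq_zero _).2 ha,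
        map_zero]
    rw [Submodule.Quotient.mk_eq_zero] at h4
    change a * t ∈ LinearMap.ker _ at h4
    rw [LinearMap.mem_ker] at h4
    rw [← mul_assoc]
    simpa using h4
  have hσ : Function.Injective σ := by
    intro n n' h
    have hann : Module.annihilator A (A ⧸ K n) = Module.annihilator A (A ⧸ K n') :=
      congrArg Subtype.val h
    have := hK n
    have := hK n'
    let q : Ideal A :=
      { carrier := {b | ∀ x, s n' * x * b = 0}
        zero_mem' := fun x => mul_zero _
        add_mem' := fun {a b} ha hb x => by rw [mul_add, ha x, hb x, add_zero]
        smul_mem' := fun c b hb x => by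
          rw [smul_eq_mul, ← mul_assoc, mul_assoc _ x c]; exact hb (x * c) }
    have hq : ∀ a ∈ q, ∀ b, a * b ∈ q := fun a ha b x => by
      rw [← mul_assoc, ha x, zero_mul]
    have hq1 : q ≠ ⊤ := by
      intro h
      have h1 : (1 : A) ∈ q := h ▸ trivial
      have := h1 1
      rw [mul_one, mul_one] at this
      exact hs0 n' this
    have hl : ∀ n : primIdeals A, ∀ b ∈ n.1, ∀ x, x * b ∈ n.1 := fun n b hb x => n.1.mul_mem_left x hb
    have h1 : n'.1 ≤ q := fun b hb x => by
      rw [mul_assoc]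
      exact hsn n' _ (hl n' b hb x)
    have h2 : n.1 ≤ q := by
      obtain ⟨e⟩ := simple_equiv_of_annihilator_le (K n) (K n') hann.le
      obtain ⟨t, -, ht, ht0⟩ := emb n (K n') (hK n') ⟨e⟩
      obtain ⟨t', ht'⟩ : ∃ t', t' * (t * s n) = s n := by
        have hsm : IsSimpleModule A (A ⧸ K n) := isSimpleModule_iff_isCoatom.2 (hK n).out
        have hne : (Submodule.Quotient.mk t : A ⧸ K n) ≠ 0 := by
          intro h
          rw [Submodule.Quotient.mk_eq_zero] at h
          change t ∈ LinearMap.ker _ at h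
          rw [LinearMap.mem_ker] at h
          exact ht0 (by simpa using h)
        obtain ⟨t', ht'⟩ := IsSimpleModule.toSpanSingleton_surjective A hne (Submodule.Quotient.mk 1)
        refine ⟨t', ?_⟩
        rw [LinearMap.toSpanSingleton_apply, ← Submodule.Quotient.mk_smul,
          Submodule.Quotient.eq] at ht'
        change _ ∈ LinearMap.ker _ at ht'
        rw [LinearMap.mem_ker] at ht'
        have h5 : (t' * t - 1) * s n = 0 := by simpa using ht'
        rw [sub_mul, one_mul, sub_eq_zero] at h5
        rw [← mul_assoc, h5]
      obtain ⟨g, hg⟩ := ext_through hA (LinearMap.toSpanSingleton A A (t * s n))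
        (LinearMap.toSpanSingleton A A (s n')) (by
          intro a ha
          rw [LinearMap.mem_ker] at ha
          by_contra hcon
          have hle : K n' ≤ LinearMap.ker (LinearMap.toSpanSingleton A A (t * s n)) := by
            intro b hb
            rw [LinearMap.mem_ker]
            simpa using ht b hb
          have heq := (hK n').eq_of_le (by
            intro h
            have h1 : (1 : A) ∈ LinearMap.ker (LinearMap.toSpanSingleton A A (t * s n)) := h ▸ trivial
            rw [LinearMap.mem_ker] at h1
            exact ht0 (by simpa using h1)) hle
          apply hcon
          change a ∈ K n'
          rw [heq]
          exact ha)
      have hg1 : g (t * s n) = s n' := by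
        have := LinearMap.congr_fun hg 1
        simpa using this
      have hg2 : s n' = t * s n * g 1 := by
        rw [← hg1]
        conv_lhs => rw [← mul_one (t * s n), ← smul_eq_mul, map_smul]
        rfl
      intro b hb x
      rw [hg2, mul_assoc, mul_assoc, mul_assoc, hsn n _ (hl n _ (hl n b hb x) (g 1)), mul_zero]
    exact Subtype.ext ((primIdeals_maximal n.2 q hq hq1 h2).symm.trans
      (primIdeals_maximal n'.2 q hq hq1 h1))
  obtain ⟨n, hn⟩ := (Finite.injective_iff_surjective.1 hσ) ⟨_, L, hL, rfl⟩
  have hann : Module.annihilator A (A ⧸ K n) = Module.annihilator A (A ⧸ L) :=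
    congrArg Subtype.val hn
  have := hK n
  have h := simple_equiv_of_annihilator_le (K n) L hann.le
  obtain ⟨t, -, h1, h2⟩ := emb n L hL h
  exact ⟨_, h2, h1⟩

/-- Powers of a finite-dimensional algebra are projective. -/
theorem projective_pi (k : Type u) [Field k] {A : Type u} [Ring A] [Algebra k A]
    [FiniteDimensional k A] (Λ : Type u) : Module.Projective A (Λ → A) := by
  classical
  let b := Module.finBasis k A
  let T : TensorProduct k A (Λ → k) →ₗ[A] (Λ → A) :=
    TensorProduct.AlgebraTensorModule.lift
      { toFun := fun a =>
          { toFun := fun w l => w l • a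
            map_add' := fun w w' => by ext l; simp [add_smul]
            map_smul' := fun c w => by ext l; simp [mul_smul] }
        map_add' := fun a a' => by ext w l; simp
        map_smul' := fun c a => by ext w l; simp }
  have hT : ∀ a w, T (a ⊗ₜ[k] w) = fun l => w l • a := fun a w => rfl
  let S : (Λ → A) →ₗ[k] TensorProduct k A (Λ → k) :=
    { toFun := fun F => ∑ i, b i ⊗ₜ[k] (fun l => b.repr (F l) i)
      map_add' := fun F G => by
        rw [← Finset.sum_add_distrib]
        refine Finset.sum_congr rfl fun i _ => ?_
        rw [← TensorProduct.tmul_add]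
        congr 1
        ext l
        simp
      map_smul' := fun c F => by
        rw [Finset.smul_sum]
        refine Finset.sum_congr rfl fun i _ => ?_
        rw [RingHom.id_apply, ← TensorProduct.tmul_smul]
        congr 1
        ext l
        simp }
  have hTS : ∀ F, T (S F) = F := fun F => by
    change T (∑ i, b i ⊗ₜ[k] (fun l => b.repr (F l) i)) = F
    rw [map_sum]
    ext l
    rw [Finset.sum_apply]
    simp only [hT]
    exact b.sum_repr (F l)
  have hST : ∀ z, S (T z) = z := fun z => by
    induction z using TensorProduct.induction_on with
    | zero => simp
    | add x y hx hy => rw [map_add, map_add, hx, hy]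
    | tmul a w =>
      rw [hT]
      change ∑ i, b i ⊗ₜ[k] (fun l => b.repr (w l • a) i) = _
      have : ∀ i, b i ⊗ₜ[k] (fun l => b.repr (w l • a) i) = (b.repr a i • b i) ⊗ₜ[k] w := by
        intro i
        rw [TensorProduct.smul_tmul]
        congr 1
        ext l
        simp [mul_comm]
      rw [Finset.sum_congr rfl fun i _ => this i, ← TensorProduct.sum_tmul, b.sum_repr]
  let e : TensorProduct k A (Λ → k) ≃ₗ[A] (Λ → A) :=
    LinearEquiv.ofBijective T ⟨Function.LeftInverse.injective (g := S) hST,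
      Function.RightInverse.surjective (g := S) hTS⟩
  exact Module.Projective.of_equiv e

/-- Every module over a finite-dimensional self-injective algebra embeds into a projective one. -/
theorem exists_embedding_projective (k : Type u) [Field k] {A : Type u} [Ring A] [Algebra k A]
    [FiniteDimensional k A] (hA : Module.Injective A A) (X : Type u) [AddCommGroup X]
    [Module A X] : ∃ (J : Type u) (_ : AddCommGroup J) (_ : Module A J) (α : X →ₗ[A] J),
      Module.Projective A J ∧ Function.Injective α := by
  classical
  have := hA
  have sep : ∀ x : X, x ≠ 0 → ∃ φ : X →ₗ[A] A, φ x ≠ 0 := by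
    intro x hx
    have hne : LinearMap.ker (LinearMap.toSpanSingleton A X x) ≠ ⊤ := by
      intro h
      have h1 : (1 : A) ∈ LinearMap.ker (LinearMap.toSpanSingleton A X x) := h ▸ trivial
      rw [LinearMap.mem_ker] at h1
      exact hx (by simpa using h1)
    obtain ⟨L, hL, hle⟩ := Ideal.exists_le_maximal _ hne
    obtain ⟨c, hc, hLc⟩ := simple_embeds k hA L hL
    obtain ⟨g, hg⟩ := ext_through hA (LinearMap.toSpanSingleton A X x)
      (LinearMap.toSpanSingleton A A c) (fun a ha => by
        rw [LinearMap.mem_ker]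
        simpa using hLc a (hle ha))
    refine ⟨g, ?_⟩
    have := LinearMap.congr_fun hg 1
    have h2 : g x = c := by simpa using this
    rw [h2]
    exact hc
  have hproj := projective_pi k (A := A) (X →ₗ[A] A)
  refine ⟨(X →ₗ[A] A) → A, inferInstance, inferInstance, LinearMap.pi fun φ => φ, hproj, ?_⟩
  rw [injective_iff_map_eq_zero]
  intro x hx
  by_contra h
  obtain ⟨φ, hφ⟩ := sep x h
  exact hφ (congrFun hx φ)

end Helpers

/-- Module structure on a hom group through a representation by endomorphisms. -/
@[reducible] def homModule {D : Type*} [Category D] [Preadditive D] {R : Type*} [Ring R]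
    {P : D} (π : R →+ (P ⟶ P)) (h1 : π 1 = 𝟙 P) (hm : ∀ r s, π (r * s) = π r ≫ π s) (Q : D) :
    Module R (P ⟶ Q) where
  smul r n := π r ≫ n
  one_smul n := by show π 1 ≫ n = n; rw [h1, Category.id_comp]
  mul_smul r s n := by
    show π (r * s) ≫ n = π r ≫ π s ≫ n
    rw [hm, Category.assoc]
  smul_zero r := by show π r ≫ 0 = 0; simp
  smul_add r x y := by show π r ≫ (x + y) = π r ≫ x + π r ≫ y; simp
  add_smul r s x := by show π (r + s) ≫ x = π r ≫ x + π s ≫ x; simp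
  zero_smul x := by show π 0 ≫ x = 0; simp

/-- The abstract core argument. -/
theorem core_abstract {D : Type*} [Category D] [Preadditive D] {ι : Type*} (o : ι) (Z : ι → D)
    {R : Type*} [Ring R] (row : ∀ j, R →+ (Z o ⟶ Z j)) (E : (Z o ⟶ Z o) →+ R)
    (hE1 : ∀ r u, r * E u = E (row o r ≫ u))
    (hE2 : ∀ u t j, row j (E u * t) = u ≫ row j t)
    (hE3 : ∀ u t, (∀ j, u ≫ row j t = 0) → E u * t = 0)
    (hE4 : ∀ u, row o (E u) = u)
    (hmul : ∀ r s, row o (r * s) = row o r ≫ row o s) (hone : row o 1 = 𝟙 _)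
    (r0 : R) (hr0 : r0 ≠ 0) (hr1 : E (𝟙 _) * r0 = r0) (hr2 : row o r0 = 0)
    (J : D) (α : Z o ⟶ J) (H : Set (Z o ⟶ Z o))
    (H1 : ∀ ψ : Z o ⟶ Z o, (∀ c ∈ H, c ≫ ψ = 0) → ψ = 0)
    (H2 : ∀ c ∈ H, ∀ j, j ≠ o → ∀ ψ : Z o ⟶ Z j, c ≫ ψ = 0)
    (H4 : ∀ u : Z o ⟶ Z o, u ≫ α = 0 → u = 0)
    (H6 : ∀ G : (Z o ⟶ J) →+ (Z o ⟶ Z o), (∀ u q, G (u ≫ q) = u ≫ G q) →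
      ∀ j, j ≠ o → ∀ ψ : Z o ⟶ Z j, G α ≫ ψ = 0)
    {I : Type v} [AddCommGroup I] [Module R I] [Small.{v} R] (hP : Module.Projective R I)
    (hI : Module.Injective R I)
    (f : R →ₗ[R] I) (hf : Function.Injective f) : False := by
  letI mm : ∀ Q : D, Module R (Z o ⟶ Q) := homModule (row o) hone hmul
  have smul_def : ∀ {Q : D} (r : R) (n : Z o ⟶ Q), r • n = row o r ≫ n := fun r n => rfl
  obtain ⟨s, hs⟩ := Module.projective_def.1 hP
  have hEE : ∀ u v, E u * E v = E (u ≫ v) := fun u v => by rw [hE1, hE4]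
  let f0 : (Z o ⟶ Z o) →ₗ[R] I :=
    { toFun := fun u => f (E u)
      map_add' := fun u v => by simp
      map_smul' := fun r u => by
        simp only [smul_def, RingHom.id_apply]
        rw [← hE1, ← smul_eq_mul, map_smul] }
  let pα : (Z o ⟶ Z o) →ₗ[R] (Z o ⟶ J) :=
    { toFun := fun u => u ≫ α
      map_add' := fun u v => by simp
      map_smul' := fun r u => by simp [smul_def] }
  have hpα : Function.Injective pα := by
    rw [injective_iff_map_eq_zero]
    exact fun u hu => H4 u hu
  obtain ⟨g, hg⟩ := hI.extension_property R _ _ _ pα hpα f0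
  have hg' : ∀ u, g (u ≫ α) = f (E u) := fun u => LinearMap.congr_fun hg u
  set z : I := f (E (𝟙 _)) with hz
  have hgα : g α = z := by rw [hz, ← hg', Category.id_comp]
  have hEz : ∀ u, E u • z = f (E u) := fun u => by
    rw [hz, ← map_smul, smul_eq_mul, hEE, Category.comp_id]
  let ζ : I → (Z o ⟶ Z o) := fun b => row o (s z b)
  have hζ : ∀ b j, j ≠ o → ∀ ψ : Z o ⟶ Z j, ζ b ≫ ψ = 0 := by
    intro b
    let G : (Z o ⟶ J) →+ (Z o ⟶ Z o) :=
      { toFun := fun q => row o (s (g q) b)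
        map_zero' := by simp
        map_add' := fun p q => by simp }
    have hG : ∀ u q, G (u ≫ q) = u ≫ G q := by
      intro u q
      have : u ≫ q = E u • q := by rw [smul_def, hE4]
      show row o (s (g (u ≫ q)) b) = u ≫ row o (s (g q) b)
      rw [this, map_smul, map_smul, Finsupp.smul_apply, smul_eq_mul, hE2]
    have := H6 G hG
    have e : G α = ζ b := by
      show row o (s (g α) b) = row o (s z b)
      rw [hgα]
    rwa [e] at this
  have hsum : ∀ y : I, (s y).sum (fun b r => r • b) = y := fun y => by
    have := hs y
    rwa [Finsupp.linearCombination_apply] at this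
  let z' : I := ∑ b ∈ (s z).support, E (ζ b) • b
  have hz' : ∀ t, row o (s z' t) = ζ t := by
    intro t
    have e1 : s z' t = ∑ b ∈ (s z).support, E (ζ b) * s b t := by
      simp only [z', map_sum, map_smul, Finsupp.finset_sum_apply, Finsupp.smul_apply, smul_eq_mul]
    have e2 : s z t = ∑ b ∈ (s z).support, s z b * s b t := by
      conv_lhs => rw [← hsum z]
      simp only [Finsupp.sum, map_sum, map_smul, Finsupp.finset_sum_apply, Finsupp.smul_apply,
        smul_eq_mul]
    show row o (s z' t) = row o (s z t)
    rw [e1, e2, map_sum, map_sum]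
    refine Finset.sum_congr rfl fun b _ => ?_
    rw [hE2, hmul]
  let mk1 : I → ((Z o ⟶ Z o) →ₗ[R] I) := fun y =>
    { toFun := fun u => E u • y
      map_add' := fun u v => by simp [add_smul]
      map_smul' := fun r u => by
        simp only [smul_def, RingHom.id_apply]
        rw [← hE1, mul_smul] }
  have hinj : Function.Injective (mk1 z') := by
    rw [injective_iff_map_eq_zero]
    intro u hu
    have hu : E u • z' = 0 := hu
    have h1 : ∀ t, u ≫ ζ t = 0 := fun t => by
      rw [← hz', ← hE2, ← smul_eq_mul, ← Finsupp.smul_apply, ← map_smul, hu]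
      simp
    refine H1 u fun c hc => ?_
    have h2 : ∀ t, E (c ≫ u) * s z t = 0 := by
      intro t
      refine hE3 _ _ fun j => ?_
      by_cases hj : j = o
      · subst hj
        rw [Category.assoc]
        have : u ≫ row j (s z t) = 0 := h1 t
        rw [this, Limits.comp_zero]
      · rw [Category.assoc]
        exact H2 c hc j hj _
    have h3 : E (c ≫ u) • z = 0 := by
      rw [← hsum z, Finsupp.sum, Finset.smul_sum]
      refine Finset.sum_eq_zero fun b _ => ?_
      rw [← mul_smul, h2, zero_smul]
    rw [hEz] at h3
    have h4 : E (c ≫ u) = 0 := hf (by rw [h3, map_zero])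
    rw [← hE4 (c ≫ u), h4, map_zero]
  set y : I := f r0 with hy
  obtain ⟨h, hh⟩ := hI.extension_property R _ _ _ (mk1 z') hinj (mk1 y)
  have hh' : ∀ u, h (E u • z') = E u • y := fun u => LinearMap.congr_fun hh u
  have h1z' : E (𝟙 _) • z' = z' := by
    simp only [z', Finset.smul_sum, ← mul_smul, hEE, Category.id_comp]
  have h1y : E (𝟙 _) • y = y := by rw [hy, ← map_smul, smul_eq_mul, hr1]
  have hhz : h z' = y := by rw [← h1y, ← hh', h1z']
  have hsy : ∀ t, E (𝟙 _) * s y t = 0 := by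
    intro t
    refine hE3 _ _ fun j => ?_
    rw [Category.id_comp]
    by_cases hj : j = o
    · subst hj
      refine H1 _ fun c hc => ?_
      have : E c * r0 = 0 := hE3 _ _ fun l => by
        by_cases hl : l = j
        · subst hl
          rw [hr2, Limits.comp_zero]
        · exact H2 c hc l hl _
      rw [← hE2, ← smul_eq_mul, ← Finsupp.smul_apply, ← map_smul, hy, ← map_smul, smul_eq_mul,
        this]
      simp
    · rw [← hhz]
      have : s (h z') t = ∑ b ∈ (s z).support, E (ζ b) * s (h b) t := by
        simp only [z', map_sum, map_smul, Finsupp.finset_sum_apply, Finsupp.smul_apply,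
          smul_eq_mul]
      rw [this, map_sum]
      refine Finset.sum_eq_zero fun b _ => ?_
      rw [hE2, hζ b j hj]
  have hy0 : y = 0 := by
    rw [← h1y, ← hsum y, Finsupp.sum, Finset.smul_sum]
    refine Finset.sum_eq_zero fun b _ => ?_
    rw [← mul_smul, hsy, zero_smul]
  exact hr0 (hf (by rw [← hy, hy0, map_zero]))

/-- The matrix with a single entry in row `0`. -/
def rowSingle {D : Type*} [Category D] [Preadditive D] (Φ : Finset ℕ) (h0 : 0 ∈ Φ) (Xs : ℕ → D)
    (j : Φ) : ((Xs ((⟨0, h0⟩ : Φ) : ℕ)) ⟶ Xs j) →+ bgPairCarrier Φ Xs Xs where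
  toFun u := ⟨Pi.single (⟨0, h0⟩ : Φ) (Pi.single j u), by
    intro a b hab
    by_cases ha : a = ⟨0, h0⟩
    · subst ha
      rw [Pi.single_eq_same]
      by_cases hb : b = j
      · subst hb
        exact absurd ⟨Nat.zero_le _, by simp⟩ hab
      · rw [Pi.single_eq_of_ne hb]
    · rw [Pi.single_eq_of_ne ha]
      rfl⟩
  map_zero' := by
    apply Subtype.ext
    simp
  map_add' u v := by
    apply Subtype.ext
    simp [Pi.single_add]

theorem core_matrix {D : Type*} [Category D] [Preadditive D] (Φ : Finset ℕ) (h0 : 0 ∈ Φ)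
    (Xs : ℕ → D) (R : Type v) [Ring R] (ρ : R ≃+ bgPairCarrier Φ Xs Xs)
    (hρ : ∀ r s : R, ρ (r * s) = bgComp (ρ r) (ρ s))
    (i : ℕ) (hi : i ∈ Φ) (hi0 : i ≠ 0) (φ : Xs 0 ⟶ Xs i) (hφ : φ ≠ 0)
    (J : D) (α : Xs 0 ⟶ J) (H : Set (Xs 0 ⟶ Xs 0))
    (H1 : ∀ ψ : Xs 0 ⟶ Xs 0, (∀ c ∈ H, c ≫ ψ = 0) → ψ = 0)
    (H2 : ∀ c ∈ H, ∀ j : ℕ, j ≠ 0 → ∀ ψ : Xs 0 ⟶ Xs j, c ≫ ψ = 0)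
    (H4 : ∀ u : Xs 0 ⟶ Xs 0, u ≫ α = 0 → u = 0)
    (H6 : ∀ G : (Xs 0 ⟶ J) →+ (Xs 0 ⟶ Xs 0), (∀ u q, G (u ≫ q) = u ≫ G q) →
      ∀ j : ℕ, j ≠ 0 → ∀ ψ : Xs 0 ⟶ Xs j, G α ≫ ψ = 0) :
    ¬ ∃ I : ModuleCat.{v} R, Projective I ∧ Injective I ∧
          ∃ f : ModuleCat.of R R ⟶ I, Mono f := by
  rintro ⟨I, hP, hI, f, hf⟩
  let o : Φ := ⟨0, h0⟩
  let Z : Φ → D := fun j => Xs j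
  let row : ∀ j : Φ, R →+ (Z o ⟶ Z j) := fun j =>
    { toFun := fun r => (ρ r).1 o j
      map_zero' := by simp
      map_add' := fun r s => by simp }
  let S : ∀ j : Φ, (Z o ⟶ Z j) → R := fun j u => ρ.symm (rowSingle Φ h0 Xs j u)
  let E : (Z o ⟶ Z o) →+ R := (ρ.symm : _ →+ R).comp (rowSingle Φ h0 Xs o)
  have hS1 : ∀ j u, (ρ (S j u)).1 o j = u := fun j u => by
    simp only [S, AddEquiv.apply_symm_apply, rowSingle]
    simp [o]
  have hS2 : ∀ j u l, l ≠ j → (ρ (S j u)).1 o l = 0 := fun j u l hl => by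
    simp only [S, AddEquiv.apply_symm_apply, rowSingle]
    simp [o, Pi.single_eq_of_ne hl]
  have hS3 : ∀ j u a l, a ≠ o → (ρ (S j u)).1 a l = 0 := fun j u a l ha => by
    simp only [S, AddEquiv.apply_symm_apply, rowSingle]
    show (Pi.single (⟨0, h0⟩ : Φ) (Pi.single j u) : ∀ a b : Φ, (Xs a ⟶ Xs b)) a l = 0
    rw [Pi.single_eq_of_ne ha]
    rfl
  have hES : ∀ u, E u = S o u := fun u => rfl
  have hext : ∀ r s : R, (∀ a b, (ρ r).1 a b = (ρ s).1 a b) → r = s := fun r s h =>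
    ρ.injective (Subtype.ext (funext fun a => funext fun b => h a b))
  have hmul : ∀ r s a b, (ρ (r * s)).1 a b =
      if (a : ℕ) ≤ (b : ℕ) ∧ ((b : ℕ) - (a : ℕ)) ∈ Φ then
        ∑ l : Φ, (ρ r).1 a l ≫ (ρ s).1 l b else 0 := fun r s a b => by
    rw [hρ]; rfl
  have hrow : ∀ r j, row j r = (ρ r).1 o j := fun r j => rfl
  have hE2 : ∀ u t j, row j (E u * t) = u ≫ row j t := by
    intro u t j
    rw [hrow, hmul, if_pos ⟨Nat.zero_le _, by simp [o]⟩, Finset.sum_eq_single o]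
    · rw [hES, hS1]; rfl
    · intro l _ hl
      rw [hES, hS2 _ _ _ hl, Limits.zero_comp]
    · simp
  have hE2' : ∀ u t a b, a ≠ o → (ρ (E u * t)).1 a b = 0 := by
    intro u t a b ha
    rw [hmul]
    split_ifs
    · refine Finset.sum_eq_zero fun l _ => ?_
      rw [hES, hS3 _ _ _ _ ha, Limits.zero_comp]
    · rfl
  have hE3 : ∀ u t, (∀ j, u ≫ row j t = 0) → E u * t = 0 := by
    intro u t h
    apply hext
    intro a b
    rw [map_zero]
    by_cases ha : a = o
    · subst ha
      exact (hE2 u t b).trans (h b)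
    · exact hE2' u t a b ha
  have hE1 : ∀ r u, r * E u = E (row o r ≫ u) := by
    intro r u
    apply hext
    intro a b
    rw [hmul]
    by_cases ha : a = o
    · subst ha
      rw [if_pos ⟨Nat.zero_le _, by simp [o]⟩, Finset.sum_eq_single o]
      · by_cases hb : b = o
        · subst hb
          rw [hES, hES, hS1, hS1]; rfl
        · rw [hES, hES, hS2 _ _ _ hb, hS2 _ _ _ hb, Limits.comp_zero]
      · intro l _ hl
        rw [hES, hS3 _ _ _ _ hl, Limits.comp_zero]
      · simp
    · rw [hES (_ ≫ _), hS3 _ _ _ _ ha]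
      split_ifs
      · refine Finset.sum_eq_zero fun l _ => ?_
        by_cases hl : l = o
        · subst hl
          have : (ρ r).1 a o = 0 := by
            apply (ρ r).2
            rintro ⟨h, -⟩
            apply ha
            apply Subtype.ext
            exact Nat.le_zero.1 h
          rw [this, Limits.zero_comp]
        · rw [hES, hS3 _ _ _ _ hl, Limits.comp_zero]
      · rfl
  have hE4 : ∀ u, row o (E u) = u := fun u => by rw [hrow, hES, hS1]
  have hone : row o 1 = 𝟙 _ := by
    have := hE1 1 (𝟙 _)
    rw [one_mul, Category.comp_id] at this
    rw [← hE4 (row o 1), ← this, hE4]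
  have hmul' : ∀ r s, row o (r * s) = row o r ≫ row o s := by
    intro r s
    have h := hE1 (r * s) (𝟙 _)
    rw [mul_assoc, hE1, hE1, Category.comp_id, Category.comp_id] at h
    rw [← hE4 (row o (r * s)), ← h, hE4]
  let i' : Φ := ⟨i, hi⟩
  have hio : o ≠ i' := fun h => hi0 (congrArg Subtype.val h).symm
  have hP' : Module.Projective R I := (IsProjective.iff_projective (R := R) I).2 hP
  have hI' : Module.Injective R I := Module.injective_module_of_injective_object R I
  have hne : ∀ j : Φ, j ≠ o → (j : ℕ) ≠ 0 := fun j hj h => hj (Subtype.ext h)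
  refine core_abstract o Z row E hE1 hE2 hE3 hE4 hmul' hone (S i' φ) ?_ ?_ ?_ J α H H1
    (fun c hc j hj ψ => H2 c hc j (hne j hj) ψ) H4 (fun G hG j hj ψ => H6 G hG j (hne j hj) ψ)
    hP' hI' f.hom ((ModuleCat.mono_iff_injective f).1 hf)
  · intro h
    apply hφ
    have := hS1 i' φ
    rw [h, map_zero] at this
    exact this.symm
  · apply hext
    intro a b
    by_cases ha : a = o
    · subst ha
      exact (hE2 _ _ b).trans (Category.id_comp _)
    · rw [hE2' _ _ _ _ ha, hS3 _ _ _ _ ha]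
  · exact hS2 i' φ o hio

theorem gen_rep {A : Type*} [Ring A] {M J : Type*} [AddCommGroup M] [Module A M]
    [AddCommGroup J] [Module A J] (n : ℕ) (f : Fin n → (M →ₗ[A] A)) (m : Fin n → M)
    (hfm : ∑ i, f i (m i) = 1)
    (G : (M →ₗ[A] J) →+ (M →ₗ[A] M)) (hG : ∀ q u, G (q ∘ₗ u) = G q ∘ₗ u) :
    ∃ p : J →ₗ[A] M, ∀ q, G q = p ∘ₗ q := by
  have key : ∀ (q : M →ₗ[A] J) (x : M),
      ∑ i, G (LinearMap.toSpanSingleton A J (q x) ∘ₗ f i) (m i) = G q x := by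
    intro q x
    have h1 : ∀ i, LinearMap.toSpanSingleton A J (q x) ∘ₗ f i
        = q ∘ₗ (LinearMap.toSpanSingleton A M x ∘ₗ f i) := by
      intro i; ext y; simp
    have h2 : ∀ i, G (LinearMap.toSpanSingleton A J (q x) ∘ₗ f i) (m i)
        = G q (f i (m i) • x) := by
      intro i
      rw [h1, hG]; simp
    simp_rw [h2]
    rw [← map_sum, ← Finset.sum_smul, hfm, one_smul]
  have hadd : ∀ j j' : J, ∀ i, G (LinearMap.toSpanSingleton A J (j + j') ∘ₗ f i) =
      G (LinearMap.toSpanSingleton A J j ∘ₗ f i) + G (LinearMap.toSpanSingleton A J j' ∘ₗ f i) := by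
    intro j j' i
    rw [← map_add]
    congr 1
    ext y; simp
  refine ⟨
    { toFun := fun j => ∑ i, G (LinearMap.toSpanSingleton A J j ∘ₗ f i) (m i)
      map_add' := fun j j' => by simp [hadd, Finset.sum_add_distrib]
      map_smul' := ?_ }, fun q => ?_⟩
  · intro a j
    simp only [RingHom.id_apply]
    have hj : j = ∑ i, (LinearMap.toSpanSingleton A J j ∘ₗ f i) (m i) := by
      simp only [LinearMap.comp_apply, LinearMap.toSpanSingleton_apply]
      rw [← Finset.sum_smul, hfm, one_smul]
    let P : J →+ M :=
      { toFun := fun j => ∑ i, G (LinearMap.toSpanSingleton A J j ∘ₗ f i) (m i)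
        map_zero' := by simp
        map_add' := fun j j' => by simp [hadd, Finset.sum_add_distrib] }
    have hP : ∀ q x, P (q x) = G q x := key
    show P (a • j) = a • P j
    rw [hj, Finset.smul_sum, map_sum, map_sum, Finset.smul_sum]
    refine Finset.sum_congr rfl fun i _ => ?_
    rw [← map_smul, hP, hP, map_smul]
  · ext x
    exact (key q x).symm

theorem core_functor (k : Type u) [Field k] (A : Type u) [Ring A] [Algebra k A]
    [FiniteDimensional k A] (hA : Module.Injective A A)
    (X : Type u) [AddCommGroup X] [Module A X]
    (hXgen : ∃ (n : ℕ) (f : (Fin n → X) →ₗ[A] A) (g : A →ₗ[A] (Fin n → X)),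
      f ∘ₗ g = LinearMap.id)
    (Φ : Finset ℕ) (h0 : 0 ∈ Φ)
    {D : Type*} [Category D] [Preadditive D] (T : ModuleCat.{u} A ⥤ D) [T.Additive]
    [T.Full] [T.Faithful] (Xs : ℕ → D) (e : Xs 0 ≅ T.obj (ModuleCat.of A X))
    (hvan : ∀ (P : ModuleCat.{u} A) [Projective P] (j : ℕ), j ≠ 0 →
      ∀ ψ : T.obj P ⟶ Xs j, ψ = 0)
    (R : Type v) [Ring R] (ρ : R ≃+ bgPairCarrier Φ Xs Xs)
    (hρ : ∀ r s : R, ρ (r * s) = bgComp (ρ r) (ρ s))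
    (i : ℕ) (hi : i ∈ Φ) (hi0 : i ≠ 0) (φ : Xs 0 ⟶ Xs i) (hφ : φ ≠ 0) :
    ¬ ∃ I : ModuleCat.{v} R, Projective I ∧ Injective I ∧
          ∃ f : ModuleCat.of R R ⟶ I, Mono f := by
  obtain ⟨n, f, g, hfg⟩ := hXgen
  let fi : Fin n → (X →ₗ[A] A) := fun i => f ∘ₗ LinearMap.single A (fun _ => X) i
  let m : Fin n → X := fun i => g 1 i
  have hfm : ∑ i, fi i (m i) = 1 := by
    have h1 : f (g 1) = 1 := LinearMap.congr_fun hfg 1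
    have h2 : g 1 = ∑ i, Pi.single i (g 1 i) := (Finset.univ_sum_single (g 1)).symm
    rw [h2, map_sum] at h1
    exact h1
  obtain ⟨J, _, _, α, hJ, hα⟩ := exists_embedding_projective k hA X
  have hJ' : Projective (ModuleCat.of A J) := (IsProjective.iff_projective (R := A) J).1 hJ
  have hA' : Projective (ModuleCat.of A A) :=
    (IsProjective.iff_projective (R := A) A).1 inferInstance
  have hfull : ∀ {Y Y' : Type u} [AddCommGroup Y] [Module A Y] [AddCommGroup Y'] [Module A Y']
      (w : T.obj (ModuleCat.of A Y) ⟶ T.obj (ModuleCat.of A Y')),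
      ∃ w' : Y →ₗ[A] Y', T.map (ModuleCat.ofHom w') = w := by
    intro Y Y' _ _ _ _ w
    exact ⟨(T.preimage w).hom, by simp⟩
  have hfaith : ∀ {Y Y' : Type u} [AddCommGroup Y] [Module A Y] [AddCommGroup Y'] [Module A Y']
      (w w' : Y →ₗ[A] Y'), T.map (ModuleCat.ofHom w) = T.map (ModuleCat.ofHom w') → w = w' := by
    intro Y Y' _ _ _ _ w w' h
    exact congrArg ModuleCat.Hom.hom (T.map_injective h)
  refine core_matrix Φ h0 Xs R ρ hρ i hi hi0 φ hφ (T.obj (ModuleCat.of A J))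
    (e.hom ≫ T.map (ModuleCat.ofHom α))
    {c | ∃ (a : Xs 0 ⟶ T.obj (ModuleCat.of A A)) (b : T.obj (ModuleCat.of A A) ⟶ Xs 0),
      c = a ≫ b} ?_ ?_ ?_ ?_
  · intro ψ hψ
    obtain ⟨ψ', hψ'⟩ := hfull (e.inv ≫ ψ ≫ e.hom)
    have hz : ∀ i x, ψ' ∘ₗ (LinearMap.toSpanSingleton A X x ∘ₗ fi i) = 0 := by
      intro i x
      apply hfaith
      have h := hψ (((e.hom ≫ T.map (ModuleCat.ofHom (fi i)))) ≫
        (T.map (ModuleCat.ofHom (LinearMap.toSpanSingleton A X x)) ≫ e.inv)) ⟨_, _, rfl⟩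
      rw [ModuleCat.ofHom_comp, ModuleCat.ofHom_comp, T.map_comp, T.map_comp, hψ']
      have h3 := congrArg (fun w => e.inv ≫ w ≫ e.hom) h
      simp only [Category.assoc, Iso.inv_hom_id_assoc, Limits.zero_comp, Limits.comp_zero] at h3
      rw [Category.assoc, h3]
      exact (T.map_zero _ _).symm
    have hψ0 : ψ' = 0 := by
      ext x
      have h1 : x = ∑ i, (fi i (m i)) • x := by rw [← Finset.sum_smul, hfm, one_smul]
      rw [h1, map_sum]
      refine Finset.sum_eq_zero fun i _ => ?_
      exact LinearMap.congr_fun (hz i x) (m i)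
    rw [hψ0] at hψ'
    have h4 : e.inv ≫ ψ ≫ e.hom = 0 := by rw [← hψ']; exact T.map_zero _ _
    have h5 := congrArg (fun w => e.hom ≫ w ≫ e.inv) h4
    simpa using h5
  · rintro c ⟨a, b, rfl⟩ j hj ψ
    rw [Category.assoc, hvan (ModuleCat.of A A) j hj (b ≫ ψ), Limits.comp_zero]
  · intro w hw
    have : Mono (ModuleCat.ofHom α) := (ModuleCat.mono_iff_injective _).2 hα
    obtain ⟨w', hw'⟩ := hfull (e.inv ≫ w ≫ e.hom)
    have h1 : α ∘ₗ w' = 0 := by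
      apply hfaith
      rw [ModuleCat.ofHom_comp, T.map_comp, hw']
      simp only [Category.assoc]
      rw [hw, Limits.comp_zero]
      exact (T.map_zero _ _).symm
    have h2 : w' = 0 := by
      ext x
      apply hα
      rw [LinearMap.zero_apply, map_zero]
      exact LinearMap.congr_fun h1 x
    rw [h2] at hw'
    have h4 : e.inv ≫ w ≫ e.hom = 0 := by rw [← hw']; exact T.map_zero _ _
    have h5 := congrArg (fun w => e.hom ≫ w ≫ e.inv) h4
    simpa using h5
  · intro G hG j hj ψ
    choose G' hG' using fun q : X →ₗ[A] J =>
      hfull (e.inv ≫ G (e.hom ≫ T.map (ModuleCat.ofHom q)) ≫ e.hom)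
    have hGadd : ∀ q q', G' (q + q') = G' q + G' q' := by
      intro q q'
      apply hfaith
      rw [hG', ModuleCat.ofHom_add, ModuleCat.ofHom_add, T.map_add, T.map_add, hG', hG']
      simp
    let G1 : (X →ₗ[A] J) →+ (X →ₗ[A] X) := AddMonoidHom.mk' G' hGadd
    obtain ⟨p, hp⟩ := gen_rep n fi m hfm G1 (by
      intro q w
      show G' (q ∘ₗ w) = G' q ∘ₗ w
      apply hfaith
      rw [hG', ModuleCat.ofHom_comp, ModuleCat.ofHom_comp, T.map_comp, T.map_comp, hG']
      have : e.hom ≫ T.map (ModuleCat.ofHom w) ≫ T.map (ModuleCat.ofHom q) =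
          (e.hom ≫ T.map (ModuleCat.ofHom w) ≫ e.inv) ≫ e.hom ≫ T.map (ModuleCat.ofHom q) := by
        simp
      rw [this, hG]
      simp)
    have h1 := hG' α
    have h2 : G' α = p ∘ₗ α := hp α
    rw [h2, ModuleCat.ofHom_comp, T.map_comp] at h1
    have h3 : G (e.hom ≫ T.map (ModuleCat.ofHom α)) =
        (e.hom ≫ T.map (ModuleCat.ofHom α)) ≫ (T.map (ModuleCat.ofHom p) ≫ e.inv) := by
      have h5 := congrArg (fun w => e.hom ≫ w ≫ e.inv) h1
      simp only [Category.assoc, Iso.hom_inv_id, Category.comp_id, Iso.hom_inv_id_assoc] at h5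
      rw [← h5]
      simp
    rw [h3, Category.assoc,
      hvan (ModuleCat.of A J) j hj ((T.map (ModuleCat.ofHom p) ≫ e.inv) ≫ ψ), Limits.comp_zero]


theorem single_vanish {B : Type*} [Category B] [Abelian B] [HasDerivedCategory B]
    (P Y : B) [Projective P] (j : ℕ) (hj : j ≠ 0)
    (ψ : (DerivedCategory.singleFunctor B 0).obj P ⟶
      ((DerivedCategory.singleFunctor B 0).obj Y)⟦(j : ℤ)⟧) : ψ = 0 := by
  have := hasExt_of_hasDerivedCategory B
  obtain ⟨n, rfl⟩ := Nat.exists_eq_succ_of_ne_zero hj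
  have h : (Abelian.Ext.homEquiv (X := P) (Y := Y) (n := n + 1)).symm ψ =
      (Abelian.Ext.homEquiv (X := P) (Y := Y) (n := n + 1)).symm 0 := by
    rw [Abelian.Ext.eq_zero_of_projective (Abelian.Ext.homEquiv.symm ψ),
      Abelian.Ext.eq_zero_of_projective (Abelian.Ext.homEquiv.symm 0)]
  exact Abelian.Ext.homEquiv.symm.injective h


/-- Let `A` be a finite-dimensional self-injective `k`-algebra, `X` a generator of
`A`-mod, and `Φ` a finite admissible subset of `ℕ` with `Φ ≠ {0}` such that
`Ext^i_A(X,X) ≠ 0` for some `0 ≠ i ∈ Φ` (equivalently, the Beilinson-Green algebra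
`G^Φ_A(X)` is not the diagonal product of copies of `End_A(X)`).  Then the dominant
dimension of `G^Φ_A(X)` is `0`: there is no monomorphism from `G^Φ_A(X)` into a
projective-injective module. -/
theorem beilinsonGreen_dominant_dimension_zero
    (k : Type u) [Field k] (A : Type u) [Ring A] [Algebra k A] [FiniteDimensional k A]
    -- `A` is self-injective
    (hA : Module.Injective A A)
    (X : Type u) [AddCommGroup X] [Module A X]
    -- `X` is a generator of `A`-mod: `A ∈ add(X)`
    (hXgen : ∃ (n : ℕ) (f : (Fin n → X) →ₗ[A] A) (g : A →ₗ[A] (Fin n → X)),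
      f ∘ₗ g = LinearMap.id)
    (Φ : Finset ℕ) (hΦ : AdmissibleSet (↑Φ : Set ℕ)) (hΦ0 : Φ ≠ {0}) :
    letI : HasDerivedCategory (ModuleCat.{u} A) := HasDerivedCategory.standard _
    let Xobj : DerivedCategory (ModuleCat.{u} A) :=
      (DerivedCategory.singleFunctor (ModuleCat.{u} A) 0).obj (ModuleCat.of A X)
    let Xs : ℕ → DerivedCategory (ModuleCat.{u} A) := fun i => Xobj⟦(i : ℤ)⟧
    -- `Ext^i_A(X, X) ≠ 0` for some `0 ≠ i ∈ Φ`
    (∃ i : ℕ, i ∈ Φ ∧ i ≠ 0 ∧ ∃ φ : Xobj ⟶ (Xobj⟦(i : ℤ)⟧), φ ≠ 0) →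
    -- for any ring `R` realizing the Beilinson-Green algebra `G^Φ_A(X)`
    ∀ (R : Type (u + 1)) [Ring R] (ρ : R ≃+ bgPairCarrier Φ Xs Xs),
      (∀ r s : R, ρ (r * s) = bgComp (ρ r) (ρ s)) →
      -- the dominant dimension of `R = G^Φ_A(X)` is zero: `R` does not embed into a
      -- projective-injective `R`-module
      ¬ ∃ I : ModuleCat.{u + 1} R, Projective I ∧ Injective I ∧
          ∃ f : ModuleCat.of R R ⟶ I, Mono f := by
  intro Xobj Xs hφ R _ ρ hρ
  obtain ⟨i, hi, hi0, φ, hφ⟩ := hφ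
  letI : HasDerivedCategory (ModuleCat.{u} A) := HasDerivedCategory.standard _
  let e : Xs 0 ≅ Xobj := (shiftFunctorZero (DerivedCategory (ModuleCat.{u} A)) ℤ).app Xobj
  refine core_functor k A hA X hXgen Φ hΦ.1
    (DerivedCategory.singleFunctor (ModuleCat.{u} A) 0) Xs e ?_ R ρ hρ i hi hi0 (e.hom ≫ φ) ?_
  · intro P _ j hj ψ
    exact single_vanish P (ModuleCat.of A X) j hj ψ
  · intro h
    apply hφ
    rw [← cancel_epi e.hom, h, Limits.comp_zero]
end

section
/- Let A be the Liu-Schulz algebra over k with parameter q (not a root of unity), and for j ∈ ℤ set u_j = x₂ + q^j x₁ and I_j = A·u_j. Then Ω_A(I_j) ≅ I_{j+1} for every j ∈ ℤ, and the modules I_j, j ∈ ℤ, are pairwise non-isomorphic 4-dimensional indecomposable A-modules. -/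
universe u

/-- The defining relations of the Liu-Schulz algebra: `xᵢ² = 0` and
`x_{i+1} xᵢ + q · xᵢ x_{i+1} = 0` for `i = 0, 1, 2` (indices mod 3). -/
inductive LiuSchulzRel (k : Type u) [Field k] (q : k) :
    FreeAlgebra k (Fin 3) → FreeAlgebra k (Fin 3) → Prop
  | sq (i : Fin 3) : LiuSchulzRel k q (FreeAlgebra.ι k i * FreeAlgebra.ι k i) 0
  | comm (i : Fin 3) : LiuSchulzRel k q
      (FreeAlgebra.ι k (i + 1) * FreeAlgebra.ι k i
        + q • (FreeAlgebra.ι k i * FreeAlgebra.ι k (i + 1))) 0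

/-- The Liu-Schulz algebra over `k` with parameter `q`. -/
abbrev LiuSchulzAlgebra (k : Type u) [Field k] (q : k) : Type u :=
  RingQuot (LiuSchulzRel k q)

/-- The images of the generators `x₀, x₁, x₂` in the Liu-Schulz algebra. -/
noncomputable def LiuSchulzX (k : Type u) [Field k] (q : k) (i : Fin 3) :
    LiuSchulzAlgebra k q :=
  RingQuot.mkAlgHom k (LiuSchulzRel k q) (FreeAlgebra.ι k i)

/-- The element `u_j = x₂ + q^j x₁` of the Liu-Schulz algebra, for `j : ℤ`. -/
noncomputable def LiuSchulzU (k : Type u) [Field k] (q : k) (j : ℤ) :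
    LiuSchulzAlgebra k q :=
  LiuSchulzX k q 2 + q ^ j • LiuSchulzX k q 1

namespace LSAux

def mon {k R : Type*} [Field k] [Ring R] [Algebra k R] (x y z : R) (c : Fin 8 → k) : R :=
  c 0 • 1 + c 1 • x + c 2 • y + c 3 • z + c 4 • (x * y) + c 5 • (x * z) + c 6 • (y * z)
    + c 7 • (x * y * z)

section gen
variable {k R : Type*} [Field k] [Ring R] [Algebra k R] (q : k) (x y z : R)

theorem x_mul_mon (hx : x * x = 0) (c : Fin 8 → k) :
    x * mon x y z c = mon x y z ![0, c 0, 0, 0, c 2, c 3, 0, c 6] := by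
  have hx' : ∀ a, x * (x * a) = 0 := fun a => by rw [← mul_assoc, hx, zero_mul]
  simp [mon, mul_add, mul_assoc, hx, hx']

theorem y_mul_mon (hy : y * y = 0) (hyx : y * x = -(q • (x * y))) (c : Fin 8 → k) :
    y * mon x y z c = mon x y z ![0, 0, c 0, 0, -q * c 1, 0, c 3, -q * c 5] := by
  have hy' : ∀ a, y * (y * a) = 0 := fun a => by rw [← mul_assoc, hy, zero_mul]
  have hyx' : ∀ a, y * (x * a) = -(q • (x * (y * a))) := fun a => by
    rw [← mul_assoc, hyx, neg_mul, smul_mul_assoc, mul_assoc]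
  simp [mon, mul_add, mul_assoc, hy, hy', hyx, hyx', smul_smul, mul_comm]
  try module

theorem z_mul_mon (hq : q ≠ 0) (hz : z * z = 0) (hzx : z * x = -(q⁻¹ • (x * z)))
    (hzy : z * y = -(q • (y * z))) (c : Fin 8 → k) :
    z * mon x y z c = mon x y z ![0, 0, 0, c 0, 0, -q⁻¹ * c 1, -q * c 2, c 4] := by
  have hzx' : ∀ a, z * (x * a) = -(q⁻¹ • (x * (z * a))) := fun a => by
    rw [← mul_assoc, hzx, neg_mul, smul_mul_assoc, mul_assoc]
  have hzy' : ∀ a, z * (y * a) = -(q • (y * (z * a))) := fun a => by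
    rw [← mul_assoc, hzy, neg_mul, smul_mul_assoc, mul_assoc]
  simp [mon, mul_add, mul_assoc, hz, hzx, hzx', hzy, hzy', smul_smul, hq, mul_comm]
  try module

theorem mon_mul (hy : y * y = 0) (hz : z * z = 0)
    (hzy : z * y = -(q • (y * z))) (d : k) (c : Fin 8 → k) :
    mon x y z c * (z + d • y) = mon x y z ![0, 0, d * c 0, c 0, d * c 1, c 1,
      c 2 - q * d * c 3, c 4 - q * d * c 5] := by
  have hy' : ∀ a, y * (y * a) = 0 := fun a => by rw [← mul_assoc, hy, zero_mul]
  simp [mon, mul_add, add_mul, mul_assoc, hy, hy', hz, hzy]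
  module

end gen

section rep
variable {k : Type*} [Field k] (q : k)

def X0 : Module.End k (Fin 8 → k) where
  toFun v := ![0, v 0, 0, 0, v 2, v 3, 0, v 6]
  map_add' v w := by ext i; fin_cases i <;> simp
  map_smul' v w := by ext i; fin_cases i <;> simp
def X1 : Module.End k (Fin 8 → k) where
  toFun v := ![0, 0, v 0, 0, -q * v 1, 0, v 3, -q * v 5]
  map_add' v w := by ext i; fin_cases i <;> simp <;> ring
  map_smul' v w := by ext i; fin_cases i <;> simp <;> ring
def X2 : Module.End k (Fin 8 → k) where
  toFun v := ![0, 0, 0, v 0, 0, -q⁻¹ * v 1, -q * v 2, v 4]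
  map_add' v w := by ext i; fin_cases i <;> simp <;> ring
  map_smul' v w := by ext i; fin_cases i <;> simp <;> ring

def XX : Fin 3 → Module.End k (Fin 8 → k) := ![X0, X1 q, X2 q]

theorem rel0 : X1 q * X0 + q • (X0 * X1 q) = 0 := by
  refine LinearMap.ext fun v => ?_
  ext i
  fin_cases i <;> simp [X0, X1]

theorem rel1 (hq : q ≠ 0) : X2 q * X1 q + q • (X1 q * X2 q) = 0 := by
  refine LinearMap.ext fun v => ?_
  ext i
  fin_cases i <;> simp [X1, X2, hq]

theorem rel2 (hq : q ≠ 0) : X0 * X2 q + q • (X2 q * X0) = 0 := by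
  refine LinearMap.ext fun v => ?_
  ext i
  fin_cases i <;> simp [X0, X2, hq]

theorem XX_rel (hq : q ≠ 0) ⦃a b : FreeAlgebra k (Fin 3)⦄ (h : LiuSchulzRel k q a b) :
    FreeAlgebra.lift k (XX q) a = FreeAlgebra.lift k (XX q) b := by
  cases h with
  | sq i =>
    rw [map_mul, FreeAlgebra.lift_ι_apply, map_zero]
    refine LinearMap.ext fun v => ?_
    fin_cases i <;> ext i <;> fin_cases i <;> simp [XX, X0, X1, X2]
  | comm i =>
    rw [map_add, map_smul, map_mul, map_mul, FreeAlgebra.lift_ι_apply,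
      FreeAlgebra.lift_ι_apply, map_zero]
    fin_cases i
    · exact rel0 q
    · exact rel1 q hq
    · exact rel2 q hq

noncomputable def rho (hq : q ≠ 0) : LiuSchulzAlgebra k q →ₐ[k] Module.End k (Fin 8 → k) :=
  RingQuot.liftAlgHom k ⟨FreeAlgebra.lift k (XX q), XX_rel q hq⟩

theorem rho_X (hq : q ≠ 0) (i : Fin 3) : rho q hq (LiuSchulzX k q i) = XX q i := by
  simp [rho, LiuSchulzX]

local notation "x₀" => LiuSchulzX k q 0
local notation "x₁" => LiuSchulzX k q 1
local notation "x₂" => LiuSchulzX k q 2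

theorem rho_mon (hq : q ≠ 0) (c : Fin 8 → k) :
    rho q hq (mon x₀ x₁ x₂ c) ![1, 0, 0, 0, 0, 0, 0, 0] = c := by
  simp only [mon, map_add, map_smul, map_mul, rho_X, map_one]
  ext i
  fin_cases i <;> simp [XX, X0, X1, X2]

theorem mon_inj (hq : q ≠ 0) {c d : Fin 8 → k} (h : mon x₀ x₁ x₂ c = mon x₀ x₁ x₂ d) :
    c = d := by
  rw [← rho_mon q hq c, h, rho_mon]

theorem X_sq (i : Fin 3) : LiuSchulzX k q i * LiuSchulzX k q i = 0 := by
  have := RingQuot.mkAlgHom_rel k (LiuSchulzRel.sq (k := k) (q := q) i)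
  simpa [LiuSchulzX] using this

theorem X_comm (i : Fin 3) : LiuSchulzX k q (i + 1) * LiuSchulzX k q i =
    -(q • (LiuSchulzX k q i * LiuSchulzX k q (i + 1))) := by
  have := RingQuot.mkAlgHom_rel k (LiuSchulzRel.comm (k := k) (q := q) i)
  rw [map_add, map_smul, map_mul, map_mul, map_zero] at this
  exact eq_neg_of_add_eq_zero_left this

theorem X10 : x₁ * x₀ = -(q • (x₀ * x₁)) := X_comm q 0
theorem X21 : x₂ * x₁ = -(q • (x₁ * x₂)) := X_comm q 1
theorem X20 (hq : q ≠ 0) : x₂ * x₀ = -(q⁻¹ • (x₀ * x₂)) := by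
  have h : x₀ * x₂ = -(q • (x₂ * x₀)) := X_comm q 2
  rw [h, smul_neg, smul_smul, inv_mul_cancel₀ hq, one_smul, neg_neg]

theorem X_mul_mon (hq : q ≠ 0) (i : Fin 3) (c : Fin 8 → k) :
    LiuSchulzX k q i * mon x₀ x₁ x₂ c = mon x₀ x₁ x₂ (XX q i c) := by
  fin_cases i
  · exact x_mul_mon _ _ _ (X_sq q 0) c
  · exact y_mul_mon q _ _ _ (X_sq q 1) (X10 q) c
  · exact z_mul_mon q _ _ _ hq (X_sq q 2) (X20 q hq) (X21 q) c

theorem mon_add {R : Type*} [Ring R] [Algebra k R] (x y z : R) (c d : Fin 8 → k) :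
    mon x y z (c + d) = mon x y z c + mon x y z d := by
  simp only [mon, Pi.add_apply]; module

theorem mon_sub {R : Type*} [Ring R] [Algebra k R] (x y z : R) (c d : Fin 8 → k) :
    mon x y z (c - d) = mon x y z c - mon x y z d := by
  simp only [mon, Pi.sub_apply]; module

theorem mon_smul {R : Type*} [Ring R] [Algebra k R] (x y z : R) (r : k) (d : Fin 8 → k) :
    mon x y z (r • d) = r • mon x y z d := by
  simp only [mon, Pi.smul_apply, smul_eq_mul]; module

theorem mon_surj_aux (hq : q ≠ 0) (f : FreeAlgebra k (Fin 3)) : ∀ c,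
    RingQuot.mkAlgHom k (LiuSchulzRel k q) f * mon x₀ x₁ x₂ c =
      mon x₀ x₁ x₂ (FreeAlgebra.lift k (XX q) f c) := by
  induction f using FreeAlgebra.induction with
  | grade0 r =>
    intro c
    rw [AlgHom.commutes, AlgHom.commutes, ← Algebra.smul_def, Module.algebraMap_end_apply,
      mon_smul]
  | grade1 i => intro c; rw [FreeAlgebra.lift_ι_apply]; exact X_mul_mon q hq i c
  | mul a b ha hb => intro c; rw [map_mul, map_mul, mul_assoc, hb, ha]; rfl
  | add a b ha hb => intro c; rw [map_add, map_add, add_mul, hb, ha, ← mon_add]; rfl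

theorem mon_surj (hq : q ≠ 0) (a : LiuSchulzAlgebra k q) : ∃ c : Fin 8 → k, a = mon x₀ x₁ x₂ c := by
  obtain ⟨f, rfl⟩ := RingQuot.mkAlgHom_surjective k (LiuSchulzRel k q) a
  have h := mon_surj_aux q hq f ![1, 0, 0, 0, 0, 0, 0, 0]
  have h1 : mon x₀ x₁ x₂ (![1, 0, 0, 0, 0, 0, 0, 0] : Fin 8 → k) = 1 := by simp [mon]
  rw [h1, mul_one] at h
  exact ⟨_, h⟩

theorem mon_mul_u (j : ℤ) (c : Fin 8 → k) :
    mon x₀ x₁ x₂ c * LiuSchulzU k q j = mon x₀ x₁ x₂ ![0, 0, q ^ j * c 0, c 0, q ^ j * c 1, c 1,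
      c 2 - q * q ^ j * c 3, c 4 - q * q ^ j * c 5] :=
  mon_mul q _ _ _ (X_sq q 1) (X_sq q 2) (X21 q) _ _

theorem u_mon (j : ℤ) : LiuSchulzU k q j = mon x₀ x₁ x₂ ![0, 0, q ^ j, 1, 0, 0, 0, 0] := by
  simp [mon, LiuSchulzU, add_comm]

theorem mon_zero : mon x₀ x₁ x₂ (0 : Fin 8 → k) = 0 := by simp [mon]

theorem ker_eq (hq : q ≠ 0) (j : ℤ) :
    LinearMap.ker (LinearMap.toSpanSingleton (LiuSchulzAlgebra k q) _ (LiuSchulzU k q j)) =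
      Submodule.span (LiuSchulzAlgebra k q) {LiuSchulzU k q (j + 1)} := by
  ext a
  rw [LinearMap.mem_ker, LinearMap.toSpanSingleton_apply, Submodule.mem_span_singleton,
    smul_eq_mul]
  simp only [smul_eq_mul]
  constructor
  · intro h
    obtain ⟨c, rfl⟩ := mon_surj q hq a
    rw [mon_mul_u, ← mon_zero q] at h
    have h := mon_inj q hq h
    have h3 := congrFun h 3
    have h5 := congrFun h 5
    have h6 := congrFun h 6
    have h7 := congrFun h 7
    simp at h3 h5 h6 h7
    refine ⟨mon x₀ x₁ x₂ ![c 3, c 5, c 6, 0, c 7, 0, 0, 0], ?_⟩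
    rw [mon_mul_u]
    congr 1
    ext i
    fin_cases i <;> simp [zpow_add₀ hq, h3, h5] <;> first | linear_combination -h6 | linear_combination -h7
  · rintro ⟨b, rfl⟩
    obtain ⟨c, rfl⟩ := mon_surj q hq b
    rw [mon_mul_u, mon_mul_u, ← mon_zero q]
    congr 1
    ext i
    fin_cases i <;> simp [zpow_add₀ hq] <;> ring

theorem mon_mul_mon (hq : q ≠ 0) (c d : Fin 8 → k) :
    mon x₀ x₁ x₂ c * mon x₀ x₁ x₂ d = mon x₀ x₁ x₂ (c 0 • d + c 1 • XX q 0 d + c 2 • XX q 1 d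
      + c 3 • XX q 2 d + c 4 • XX q 0 (XX q 1 d) + c 5 • XX q 0 (XX q 2 d)
      + c 6 • XX q 1 (XX q 2 d) + c 7 • XX q 0 (XX q 1 (XX q 2 d))) := by
  simp only [mon_add, mon_smul, ← X_mul_mon q hq]
  rw [mon]
  simp only [add_mul, smul_mul_assoc, mul_assoc, one_mul]

theorem idem_aux (hq : q ≠ 0) (j : ℤ) (c : Fin 8 → k) (h0 : c 0 = 0)
    (h : mon x₀ x₁ x₂ c * (mon x₀ x₁ x₂ c * LiuSchulzU k q j) =
      mon x₀ x₁ x₂ c * LiuSchulzU k q j) : mon x₀ x₁ x₂ c * LiuSchulzU k q j = 0 := by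
  rw [mon_mul_u, mon_mul_mon q hq] at h
  have h := mon_inj q hq h
  have h5 := congrFun h 5
  have h6 := congrFun h 6
  have h7 := congrFun h 7
  simp [XX, X0, X1, X2, h0] at h5 h6 h7
  simp [← h5] at h6 h7
  rw [mon_mul_u, ← mon_zero q]
  congr 1
  ext i
  fin_cases i <;> simp [h0, ← h5, ← h6]
  simpa using h7.symm

theorem idem (hq : q ≠ 0) (j : ℤ) (a : LiuSchulzAlgebra k q)
    (h : a * (a * LiuSchulzU k q j) = a * LiuSchulzU k q j) :
    a * LiuSchulzU k q j = 0 ∨ a * LiuSchulzU k q j = LiuSchulzU k q j := by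
  have hb : (1 - a) * ((1 - a) * LiuSchulzU k q j) = (1 - a) * LiuSchulzU k q j := by
    simp only [sub_mul, mul_sub, one_mul, h]; abel
  have key : (1 - a) * LiuSchulzU k q j = 0 → a * LiuSchulzU k q j = LiuSchulzU k q j := by
    intro h; rw [sub_mul, one_mul, sub_eq_zero] at h; exact h.symm
  obtain ⟨c, rfl⟩ := mon_surj q hq a
  have h' := h
  rw [mon_mul_u, mon_mul_mon q hq] at h'
  have h3 := congrFun (mon_inj q hq h') 3
  simp [XX, X0, X1, X2] at h3
  by_cases h0 : c 0 = 0
  · exact Or.inl (idem_aux q hq j c h0 h)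
  · right
    apply key
    have h1 : mon x₀ x₁ x₂ (![1, 0, 0, 0, 0, 0, 0, 0] : Fin 8 → k) = 1 := by simp [mon]
    have h2 : 1 - mon x₀ x₁ x₂ c =
        mon x₀ x₁ x₂ (![1, 0, 0, 0, 0, 0, 0, 0] - c) := by
      rw [mon_sub, h1]
    rw [h2] at hb ⊢
    refine idem_aux q hq j _ ?_ hb
    have : c 0 = 1 := by simpa [h0] using h3
    simp [this]

theorem qinj (hq : q ≠ 0) (hq' : ∀ m : ℕ, 0 < m → q ^ m ≠ 1) {i j : ℤ} (h : q ^ i = q ^ j) :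
    i = j := by
  by_contra hne
  have h1 : q ^ (i - j) = 1 := by
    rw [zpow_sub₀ hq, h, div_self (zpow_ne_zero _ hq)]
  have h2 : q ^ (i - j).natAbs = 1 := by
    rcases Int.natAbs_eq (i - j) with h3 | h3
    · rw [h3, zpow_natCast] at h1; exact h1
    · rw [h3, zpow_neg, inv_eq_one, zpow_natCast] at h1; exact h1
  exact hq' _ (by omega) h2

/-- the parametrization of the ideal -/
noncomputable def g (j : ℤ) : (Fin 4 → k) →ₗ[k] LiuSchulzAlgebra k q where
  toFun d := mon x₀ x₁ x₂ ![0, 0, q ^ j * d 0, d 0, q ^ j * d 1, d 1, d 2, d 3]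
  map_add' c d := by
    rw [← mon_add]; congr 1; ext i; fin_cases i <;> simp <;> ring
  map_smul' c d := by
    rw [← mon_smul]; congr 1; ext i; fin_cases i <;> simp <;> ring

theorem g_inj (hq : q ≠ 0) (j : ℤ) : Function.Injective (g q j) := by
  intro c d h
  have h := mon_inj q hq h
  have h3 := congrFun h 3
  have h5 := congrFun h 5
  have h6 := congrFun h 6
  have h7 := congrFun h 7
  simp at h3 h5 h6 h7
  ext i
  fin_cases i <;> simp [*]

theorem range_g (hq : q ≠ 0) (j : ℤ) :
    (Submodule.span (LiuSchulzAlgebra k q) {LiuSchulzU k q j}).restrictScalars k =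
      LinearMap.range (g q j) := by
  ext a
  rw [Submodule.restrictScalars_mem, Submodule.mem_span_singleton, LinearMap.mem_range]
  simp only [smul_eq_mul]
  constructor
  · rintro ⟨b, rfl⟩
    obtain ⟨c, rfl⟩ := mon_surj q hq b
    rw [mon_mul_u]
    exact ⟨![c 0, c 1, c 2 - q * q ^ j * c 3, c 4 - q * q ^ j * c 5], rfl⟩
  · rintro ⟨d, rfl⟩
    refine ⟨mon x₀ x₁ x₂ ![d 0, d 1, d 2, 0, d 3, 0, 0, 0], ?_⟩
    rw [mon_mul_u]
    simp [g]

theorem finrank_I (hq : q ≠ 0) (j : ℤ) :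
    Module.finrank k (Submodule.span (LiuSchulzAlgebra k q) {LiuSchulzU k q j}) = 4 := by
  have h : Module.finrank k
      ((Submodule.span (LiuSchulzAlgebra k q) {LiuSchulzU k q j}).restrictScalars k) = 4 := by
    rw [range_g q hq, LinearMap.finrank_range_of_inj (g_inj q hq j)]
    simp
  exact h

theorem noniso (hq : q ≠ 0) (hq' : ∀ m : ℕ, 0 < m → q ^ m ≠ 1) (i j : ℤ) (hij : i ≠ j)
    (f : Submodule.span (LiuSchulzAlgebra k q) {LiuSchulzU k q i} ≃ₗ[LiuSchulzAlgebra k q]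
      Submodule.span (LiuSchulzAlgebra k q) {LiuSchulzU k q j}) : False := by
  have hu := Submodule.mem_span_singleton_self (R := LiuSchulzAlgebra k q) (LiuSchulzU k q i)
  have hf : ∀ a : LiuSchulzAlgebra k q, a * LiuSchulzU k q i = 0 ↔
      a * (f ⟨_, hu⟩ : LiuSchulzAlgebra k q) = 0 := by
    intro a
    have h1 : a * LiuSchulzU k q i = 0 ↔ a • (⟨_, hu⟩ :
        Submodule.span (LiuSchulzAlgebra k q) {LiuSchulzU k q i}) = 0 := by
      rw [← Subtype.coe_inj]; rfl
    have h2 : a * (f ⟨_, hu⟩ : LiuSchulzAlgebra k q) = 0 ↔ a • f ⟨_, hu⟩ = 0 := by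
      rw [← Subtype.coe_inj]; rfl
    rw [h1, h2, ← map_smul, map_eq_zero_iff f f.injective]
  obtain ⟨b, hb⟩ := Submodule.mem_span_singleton.1 (f ⟨_, hu⟩).2
  rw [← hb] at hf
  obtain ⟨c, rfl⟩ := mon_surj q hq b
  simp only [smul_eq_mul, mon_mul_u] at hf
  have hz : LiuSchulzU k q (i + 1) * LiuSchulzU k q i = 0 := by
    have := ker_eq q hq i ▸ Submodule.mem_span_singleton_self (R := LiuSchulzAlgebra k q)
      (LiuSchulzU k q (i + 1))
    simpa using this
  rw [hf, u_mon, mon_mul_mon q hq, ← mon_zero q] at hz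
  have h6 := congrFun (mon_inj q hq hz) 6
  simp [XX, X0, X1, X2, zpow_add₀ hq] at h6
  have h0 : c 0 = 0 := by
    have h : (q * c 0) * (q ^ i - q ^ j) = 0 := by linear_combination h6
    rcases mul_eq_zero.1 h with h | h
    · simpa [hq] using h
    · exact absurd (qinj q hq hq' (sub_eq_zero.1 h)) hij
  have h7 := (hf (mon x₀ x₁ x₂ (![0, 0, 0, 0, 1, 0, 0, 0] : Fin 8 → k))).2 (by
    rw [mon_mul_mon q hq, ← mon_zero q]
    congr 1
    ext i
    fin_cases i <;> simp [XX, X0, X1, h0])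
  rw [mon_mul_u, ← mon_zero q] at h7
  have := congrFun (mon_inj q hq h7) 7
  simp at this

theorem u_ne (hq : q ≠ 0) (j : ℤ) : LiuSchulzU k q j ≠ 0 := by
  intro h
  rw [u_mon, ← mon_zero q] at h
  have := congrFun (mon_inj q hq h) 3
  simp at this

end rep
end LSAux

/-- For the Liu-Schulz algebra `A` (with `q` not a root of unity) and the left ideals
`I_j = A u_j` with `u_j = x₂ + q^j x₁`, one has `Ω_A(I_j) ≅ I_{j+1}` for all `j : ℤ`
(the syzygy being the kernel of the projective cover `A → I_j`, `a ↦ a u_j`),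
and the `I_j`, `j ∈ ℤ`, are pairwise non-isomorphic 4-dimensional indecomposable
`A`-modules. -/
theorem liuSchulz_syzygy (k : Type u) [Field k] (q : k) (hq : q ≠ 0)
    (hq' : ∀ m : ℕ, 0 < m → q ^ m ≠ 1) :
    letI A := LiuSchulzAlgebra k q
    letI u : ℤ → A := LiuSchulzU k q
    letI I : ℤ → Submodule A A := fun j => Submodule.span A {u j}
    -- `Ω_A(I_j) ≅ I_{j+1}`
    (∀ j : ℤ, Nonempty
      ((LinearMap.ker (LinearMap.toSpanSingleton A A (u j))) ≃ₗ[A] I (j + 1))) ∧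
    -- the `I_j` are pairwise non-isomorphic
    (∀ i j : ℤ, i ≠ j → IsEmpty (I i ≃ₗ[A] I j)) ∧
    -- each `I_j` is 4-dimensional
    (∀ j : ℤ, Module.finrank k (I j) = 4) ∧
    -- each `I_j` is indecomposable
    (∀ j : ℤ, Nontrivial (I j) ∧
      ∀ e : I j →ₗ[A] I j, e ∘ₗ e = e → e = 0 ∨ e = LinearMap.id) := by
  refine ⟨fun j => ⟨LinearEquiv.ofEq _ _ (LSAux.ker_eq q hq j)⟩,
    fun i j hij => ⟨LSAux.noniso q hq hq' i j hij⟩, LSAux.finrank_I q hq, fun j => ⟨?_, ?_⟩⟩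
  · have hu := Submodule.mem_span_singleton_self (R := LiuSchulzAlgebra k q) (LiuSchulzU k q j)
    exact ⟨⟨⟨_, hu⟩, 0, fun h => LSAux.u_ne q hq j (congrArg Subtype.val h)⟩⟩
  · intro e he
    have hu := Submodule.mem_span_singleton_self (R := LiuSchulzAlgebra k q) (LiuSchulzU k q j)
    obtain ⟨a, ha⟩ := Submodule.mem_span_singleton.1 (e ⟨_, hu⟩).2
    have ha' : e ⟨_, hu⟩ = a • ⟨_, hu⟩ := Subtype.ext ha.symm
    have hext : ∀ f : Submodule.span (LiuSchulzAlgebra k q) {LiuSchulzU k q j}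
        →ₗ[LiuSchulzAlgebra k q] Submodule.span (LiuSchulzAlgebra k q) {LiuSchulzU k q j},
        e ⟨_, hu⟩ = f ⟨_, hu⟩ → e = f := by
      intro f h
      refine LinearMap.ext fun y => ?_
      obtain ⟨b, hb⟩ := Submodule.mem_span_singleton.1 y.2
      have hy : y = b • ⟨_, hu⟩ := Subtype.ext hb.symm
      rw [hy, map_smul, map_smul, h]
    have h2 : e (e ⟨_, hu⟩) = e ⟨_, hu⟩ := LinearMap.congr_fun he _
    rw [ha', map_smul, ha'] at h2
    rcases LSAux.idem q hq j a (congrArg Subtype.val h2) with h | h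
    · left
      apply hext
      rw [ha']
      exact Subtype.ext h
    · right
      apply hext
      rw [ha']
      exact Subtype.ext h
end

section
/- Let G be a finite group, A and B be G-graded k-algebras, and suppose a G-graded A-B-bimodule M and G-graded B-A-bimodule N define a G-graded stable equivalence of Morita type: M and N are graded projective as one-sided modules, M ⊗_B N ≅ A ⊕ P as graded A-A-bimodules with P a graded projective bimodule, and N ⊗_A M ≅ B ⊕ Q as graded B-B-bimodules with Q a graded projective bimodule. Define the Beilinson-Green algebras Ā = (A_{gh^{−1}})_{g,h∈G} and B̄ = (B_{gh^{−1}})_{g,h∈G} as G×G matrix algebras, and M̄ = (M_{gh^{−1}})_{g,h∈G}, N̄ = (N_{gh^{−1}})_{g,h∈G}. Then M̄ ⊗_{B̄} N̄ ≅ Ā ⊕ P̄ as Ā-Ā-bimodules, where P̄ = (P_{gh^{−1}})_{g,h∈G}. -/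
open TensorProduct MulOpposite

universe u

section NCTensor

variable (k : Type u) [CommRing k]
variable (B : Type u) [Ring B] [Algebra k B]
variable (A : Type u) [Ring A] [Algebra k A]
variable (M : Type u) [AddCommGroup M] [Module k M] [Module A M] [Module Bᵐᵒᵖ M]
  [SMulCommClass k A M]
variable (X : Type u) [AddCommGroup X] [Module k X] [Module B X]

/-- The submodule of relations defining the tensor product `M ⊗_B X` of a right
`B`-module `M` and a left `B`-module `X` over the (possibly noncommutative) `k`-algebra
`B`; `M` moreover carries a commuting left `A`-action, which survives on the quotient. -/
def ncRel : Submodule A (M ⊗[k] X) :=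
  Submodule.span A
    {z | ∃ (b : B) (m : M) (x : X), z = (op b • m) ⊗ₜ[k] x - m ⊗ₜ[k] (b • x)}

/-- The tensor product `M ⊗_B X` over the (possibly noncommutative) `k`-algebra `B` of a
right `B`-module `M` and a left `B`-module `X`; when `M` is an `A`-`B`-bimodule it is a
left `A`-module. -/
def NCTensor : Type u := (M ⊗[k] X) ⧸ ncRel k B A M X

noncomputable instance : AddCommGroup (NCTensor k B A M X) :=
  inferInstanceAs (AddCommGroup ((M ⊗[k] X) ⧸ ncRel k B A M X))

noncomputable instance : Module A (NCTensor k B A M X) :=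
  inferInstanceAs (Module A ((M ⊗[k] X) ⧸ ncRel k B A M X))

/-- The canonical image of `m ⊗ x` in `M ⊗_B X`. -/
noncomputable def NCTensor.tmul (m : M) (x : X) : NCTensor k B A M X :=
  Submodule.Quotient.mk (m ⊗ₜ[k] x)

variable {X}
variable {Y : Type u} [AddCommGroup Y] [Module k Y] [Module B Y]

/-- Auxiliary map: `id_M ⊗ f` on the ambient tensor product, as an `A`-linear map. -/
noncomputable def ncLift (f : X →ₗ[k] Y) : (M ⊗[k] X) →ₗ[A] (M ⊗[k] Y) where
  toFun := LinearMap.lTensor M f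
  map_add' := map_add _
  map_smul' := fun a t => by
    show LinearMap.lTensor M f (a • t) = a • LinearMap.lTensor M f t
    induction t using TensorProduct.induction_on with
    | zero => simp
    | tmul m x =>
        rw [TensorProduct.smul_tmul', LinearMap.lTensor_tmul, LinearMap.lTensor_tmul,
          TensorProduct.smul_tmul']
    | add s t hs ht => rw [smul_add, map_add, map_add, hs, ht, smul_add]

/-- The functorial map `M ⊗_B X → M ⊗_B Y` induced by a `B`-equivariant `k`-linear map
`f : X → Y`. -/
noncomputable def NCTensor.map (f : X →ₗ[k] Y)
    (hf : ∀ (b : B) (x : X), f (b • x) = b • f x) :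
    NCTensor k B A M X →ₗ[A] NCTensor k B A M Y :=
  Submodule.mapQ (ncRel k B A M X) (ncRel k B A M Y) (ncLift (k := k) (A := A) (M := M) (Y := Y) f) (by
    rw [ncRel, Submodule.span_le]
    rintro z ⟨b, m, x, rfl⟩
    have : ncLift (k := k) (A := A) (M := M) (Y := Y) f ((op b • m) ⊗ₜ[k] x - m ⊗ₜ[k] (b • x))
        = (op b • m) ⊗ₜ[k] (f x) - m ⊗ₜ[k] (b • f x) := by
      show LinearMap.lTensor M f _ = _
      rw [map_sub, LinearMap.lTensor_tmul, LinearMap.lTensor_tmul, hf]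
    rw [SetLike.mem_coe, Submodule.mem_comap, this]
    exact Submodule.subset_span ⟨b, m, f x, rfl⟩)


variable {C : Type u} [Ring C]

/-- The right action of `c : C` on `M ⊗_B X` induced by a right `C`-module structure on
`X` commuting with the `B`-action. -/
noncomputable def NCTensor.rAct [Module Cᵐᵒᵖ X] [SMulCommClass k Cᵐᵒᵖ X]
    [SMulCommClass B Cᵐᵒᵖ X] (c : C) :
    NCTensor k B A M X →ₗ[A] NCTensor k B A M X :=
  NCTensor.map (k := k) (B := B) (A := A) (M := M)
    ⟨⟨fun x => op c • x, fun x y => smul_add _ x y⟩,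
      fun s x => (smul_comm s (op c) x).symm⟩
    (fun b x => (smul_comm b (op c) x).symm)

end NCTensor

section Bimodule

variable (k : Type u) [CommRing k]
variable (A : Type u) [Ring A] [Algebra k A]
variable (B : Type u) [Ring B] [Algebra k B]

/-- A `k`-central `A`-`B`-bimodule `P` is projective as a bimodule if it is projective as
a module over the enveloping algebra `A ⊗_k Bᵐᵒᵖ`. -/
def IsProjectiveBimodule (P : Type u) [AddCommGroup P] [Module k P]
    [Module A P] [Module Bᵐᵒᵖ P] [IsScalarTower k A P] [IsScalarTower k Bᵐᵒᵖ P]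
    [SMulCommClass A Bᵐᵒᵖ P] : Prop :=
  letI : Module (A ⊗[k] Bᵐᵒᵖ) P := TensorProduct.Algebra.module
  Module.Projective (A ⊗[k] Bᵐᵒᵖ) P

end Bimodule

section Bar

variable (k : Type u) [Field k]
variable (G : Type u) [Group G] [Fintype G] [DecidableEq G]
variable (A : Type u) [Ring A] [Algebra k A]

/-- The Beilinson-Green algebra `Ā` of a `G`-graded algebra `A = ⊕_g A_g`: the
`G × G`-matrix algebra with `(g,h)` entry `A_{gh⁻¹}`, as a subalgebra of `Matrix G G A`. -/
def barAlgebra (𝒜 : G → Submodule k A) (hone : (1 : A) ∈ 𝒜 1)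
    (hmul : ∀ (g h : G) (a b : A), a ∈ 𝒜 g → b ∈ 𝒜 h → a * b ∈ 𝒜 (g * h)) :
    Subalgebra k (Matrix G G A) where
  carrier := {f | ∀ g h : G, f g h ∈ 𝒜 (g * h⁻¹)}
  add_mem' := fun hf hg g h => (𝒜 _).add_mem (hf g h) (hg g h)
  mul_mem' := by
    intro f f' hf hf' g h
    rw [Matrix.mul_apply]
    refine Submodule.sum_mem _ fun c _ => ?_
    have e : (g * c⁻¹) * (c * h⁻¹) = g * h⁻¹ := by group
    exact e ▸ hmul _ _ _ _ (hf g c) (hf' c h)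
  algebraMap_mem' := by
    intro r g h
    by_cases hgh : g = h
    · subst hgh
      have : (algebraMap k (Matrix G G A)) r g g = algebraMap k A r := by
        simp [Matrix.algebraMap_eq_diagonal]
      rw [this]
      have e : g * g⁻¹ = (1 : G) := mul_inv_cancel g
      rw [e]
      have : (algebraMap k A) r = r • (1 : A) := by
        rw [Algebra.smul_def, mul_one]
      rw [this]
      exact (𝒜 1).smul_mem r hone
    · have : (algebraMap k (Matrix G G A)) r g h = 0 := by
        simp [Matrix.algebraMap_eq_diagonal, Matrix.diagonal_apply_ne _ hgh]
      rw [this]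
      exact (𝒜 _).zero_mem

/-- The Beilinson-Green "bar" construction for a `G`-graded module `M = ⊕_g M_g`:
the space of `G × G`-matrices over `M` with `(g,h)` entry in `M_{gh⁻¹}`. -/
def barModule (M : Type u) [AddCommGroup M] [Module k M] (ℳ : G → Submodule k M) :
    Submodule k (G → G → M) where
  carrier := {f | ∀ g h : G, f g h ∈ ℳ (g * h⁻¹)}
  add_mem' := fun hf hg g h => (ℳ _).add_mem (hf g h) (hg g h)
  zero_mem' := fun g h => (ℳ _).zero_mem
  smul_mem' := fun r f hf g h => (ℳ _).smul_mem r (hf g h)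

end Bar

section Helpers

variable {k : Type u} [CommRing k]
variable {B : Type u} [Ring B] [Algebra k B]
variable {A : Type u} [Ring A] [Algebra k A]
variable {M : Type u} [AddCommGroup M] [Module k M] [Module A M] [Module Bᵐᵒᵖ M]
  [SMulCommClass k A M]
variable {X : Type u} [AddCommGroup X] [Module k X] [Module B X]

variable (k B A M X) in
/-- The canonical biadditive map. -/
noncomputable def ncTmulHom : M →+ X →+ NCTensor k B A M X :=
  AddMonoidHom.mk' (fun m => AddMonoidHom.mk' (fun x => NCTensor.tmul k B A M X m x)
    (fun x y => by
      unfold NCTensor.tmul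
      rw [TensorProduct.tmul_add]; rfl))
    (fun m m' => by
      ext x
      show NCTensor.tmul k B A M X (m + m') x =
        NCTensor.tmul k B A M X m x + NCTensor.tmul k B A M X m' x
      unfold NCTensor.tmul
      rw [TensorProduct.add_tmul]; rfl)

theorem nc_smul_k (r : k) (m : M) (x : X) :
    ncTmulHom k B A M X (r • m) x = ncTmulHom k B A M X m (r • x) := by
  show NCTensor.tmul k B A M X _ _ = NCTensor.tmul k B A M X _ _
  unfold NCTensor.tmul
  rw [TensorProduct.smul_tmul]

theorem nc_smul_B (b : B) (m : M) (x : X) :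
    ncTmulHom k B A M X (op b • m) x = ncTmulHom k B A M X m (b • x) := by
  show NCTensor.tmul k B A M X _ _ = NCTensor.tmul k B A M X _ _
  unfold NCTensor.tmul
  exact (Submodule.Quotient.eq _).2 (Submodule.subset_span ⟨b, m, x, rfl⟩)

theorem nc_smul_A (a : A) (m : M) (x : X) :
    a • ncTmulHom k B A M X m x = ncTmulHom k B A M X (a • m) x := rfl

theorem nc_rAct {C : Type u} [Ring C] [Module Cᵐᵒᵖ X] [SMulCommClass k Cᵐᵒᵖ X]
    [SMulCommClass B Cᵐᵒᵖ X] (c : C) (m : M) (x : X) :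
    NCTensor.rAct (k := k) (B := B) (A := A) (M := M) (X := X) c (ncTmulHom k B A M X m x)
      = ncTmulHom k B A M X m (op c • x) := rfl

theorem nc_induction {p : NCTensor k B A M X → Prop} (t : NCTensor k B A M X)
    (h0 : p 0) (ht : ∀ m x, p (ncTmulHom k B A M X m x))
    (ha : ∀ s t, p s → p t → p (s + t)) : p t := by
  obtain ⟨z, rfl⟩ := Submodule.Quotient.mk_surjective (ncRel k B A M X) t
  induction z using TensorProduct.induction_on with
  | zero => exact h0
  | tmul m x => exact ht m x
  | add s t hs ht' => exact ha _ _ hs ht'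

theorem nc_lift [SMulCommClass A Bᵐᵒᵖ M] {Z : Type*} [AddCommGroup Z] (f : M →+ X →+ Z)
    (hk : ∀ (r : k) m x, f (r • m) x = f m (r • x))
    (hb : ∀ (b : B) m x, f (op b • m) x = f m (b • x)) :
    ∃ F : NCTensor k B A M X →+ Z, ∀ m x, F (ncTmulHom k B A M X m x) = f m x := by
  let L : (M ⊗[k] X) →+ Z := TensorProduct.liftAddHom f hk
  have hA : ∀ (a : A) (z : M ⊗[k] X), z ∈ ncRel k B A M X → L z = 0 := by
    intro _ z hz
    unfold ncRel at hz
    induction hz using Submodule.closure_induction with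
    | zero => exact map_zero L
    | add x y _ _ hx hy => rw [map_add, hx, hy, add_zero]
    | smul_mem a z hz =>
      obtain ⟨b, m, x, rfl⟩ := hz
      rw [smul_sub, TensorProduct.smul_tmul', TensorProduct.smul_tmul', map_sub]
      show f _ _ - f _ _ = 0
      rw [smul_comm a (op b) m, hb, sub_self]
  refine ⟨QuotientAddGroup.lift (ncRel k B A M X).toAddSubgroup L (fun z hz => hA 1 z hz), ?_⟩
  intro m x
  rfl

/-- Existence of homogeneous projections. -/
theorem exists_gproj {G : Type u} [Fintype G] [DecidableEq G]
    {V : Type u} [AddCommGroup V] [Module k V] (𝒱 : G → Submodule k V)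
    (h : DirectSum.IsInternal 𝒱) :
    ∃ π : G → V →ₗ[k] V, (∀ x v, π x v ∈ 𝒱 x) ∧
      (∀ x y v, v ∈ 𝒱 y → π x v = if x = y then v else 0) ∧ (∀ v, ∑ x, π x v = v) := by
  classical
  let := h.chooseDecomposition
  refine ⟨fun x => (𝒱 x).subtype ∘ₗ DirectSum.component k G (fun i => 𝒱 i) x ∘ₗ
    (DirectSum.decomposeLinearEquiv 𝒱).toLinearMap, ?_, ?_, ?_⟩
  · intro x v
    exact ((DirectSum.decompose 𝒱 v) x).2
  · intro x y v hv
    show ((DirectSum.decompose 𝒱 v x : 𝒱 x) : V) = _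
    split_ifs with hxy
    · subst hxy
      exact DirectSum.decompose_of_mem_same 𝒱 hv
    · exact DirectSum.decompose_of_mem_ne 𝒱 hv (fun h => hxy h.symm)
  · intro v
    show ∑ x, ((DirectSum.decompose 𝒱 v x : 𝒱 x) : V) = v
    conv_rhs => rw [← DirectSum.sum_support_decompose 𝒱 v]
    symm
    apply Finset.sum_subset (Finset.subset_univ _)
    intro x _ hx
    simpa using hx

/-- Graded convolution. -/
theorem gproj_conv {G : Type u} [Group G] [Fintype G] [DecidableEq G]
    {U V W : Type u} [AddCommGroup U] [AddCommGroup V] [AddCommGroup W]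
    [Module k U] [Module k V] [Module k W]
    (𝒰 : G → Submodule k U) (𝒱 : G → Submodule k V) (𝒲 : G → Submodule k W)
    (πU : G → U →ₗ[k] U) (πV : G → V →ₗ[k] V) (πW : G → W →ₗ[k] W)
    (hU : ∀ x v, πU x v ∈ 𝒰 x) (hU' : ∀ v, ∑ x, πU x v = v)
    (hV : ∀ x v, πV x v ∈ 𝒱 x) (hV' : ∀ v, ∑ x, πV x v = v)
    (hW : ∀ x y v, v ∈ 𝒲 y → πW x v = if x = y then v else 0)
    (β : U →+ V →+ W) (hβ : ∀ x y u v, u ∈ 𝒰 x → v ∈ 𝒱 y → β u v ∈ 𝒲 (x * y))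
    (g h : G) (u : U) (v : V) :
    πW (g * h⁻¹) (β u v) = ∑ c, β (πU (g * c⁻¹) u) (πV (c * h⁻¹) v) := by
  have e1 : β u v = ∑ x, ∑ y, β (πU x u) (πV y v) := by
    conv_lhs => rw [← hU' u, ← hV' v]
    simp only [map_sum, AddMonoidHom.finsetSum_apply]
    rw [Finset.sum_comm]
  rw [e1, map_sum]
  have e2 : ∀ x, πW (g * h⁻¹) (∑ y, β (πU x u) (πV y v))
      = β (πU x u) (πV (x⁻¹ * (g * h⁻¹)) v) := by
    intro x
    rw [map_sum, Finset.sum_eq_single (x⁻¹ * (g * h⁻¹))]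
    · rw [hW _ _ _ (hβ _ _ _ _ (hU x u) (hV _ v)), if_pos (by group)]
    · intro y _ hy
      rw [hW _ _ _ (hβ _ _ _ _ (hU x u) (hV _ v)), if_neg]
      intro h'
      apply hy
      rw [h']; group
    · intro h'; exact absurd (Finset.mem_univ _) h'
  simp only [e2]
  symm
  refine Fintype.sum_equiv ((Equiv.inv G).trans (Equiv.mulLeft g)) _ _ ?_
  intro c
  have : (g * c⁻¹)⁻¹ * (g * h⁻¹) = c * h⁻¹ := by group
  simp [this]

end Helpers

section Single

variable {k : Type u} [Field k]
variable {G : Type u} [Group G] [Fintype G] [DecidableEq G]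
variable {M : Type u} [AddCommGroup M] [Module k M]

/-- Matrix unit times homogeneous component. -/
def barSingle (ℳ : G → Submodule k M) (π : G → M →ₗ[k] M) (hπ : ∀ x v, π x v ∈ ℳ x)
    (g h : G) : M →ₗ[k] ↥(barModule k G M ℳ) where
  toFun m := ⟨fun g' h' => if g' = g ∧ h' = h then π (g * h⁻¹) m else 0, by
    intro g' h'
    dsimp only
    split_ifs with H
    · rw [H.1, H.2]; exact hπ _ _
    · exact Submodule.zero_mem _⟩
  map_add' m m' := by
    apply Subtype.ext; funext g' h'
    by_cases H : g' = g ∧ h' = h <;> simp [H]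
  map_smul' r m := by
    apply Subtype.ext; funext g' h'
    by_cases H : g' = g ∧ h' = h <;> simp [H]

theorem barSingle_apply (ℳ : G → Submodule k M) (π : G → M →ₗ[k] M)
    (hπ : ∀ x v, π x v ∈ ℳ x) (g h : G) (m : M) (g' h' : G) :
    (barSingle ℳ π hπ g h m : G → G → M) g' h' =
      if g' = g ∧ h' = h then π (g * h⁻¹) m else 0 := rfl

theorem bar_sum_coe (ℳ : G → Submodule k M) {ι : Type*} (s : Finset ι)
    (f : ι → ↥(barModule k G M ℳ)) (g h : G) :
    ((∑ i ∈ s, f i : ↥(barModule k G M ℳ)) : G → G → M) g h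
      = ∑ i ∈ s, (f i : G → G → M) g h := by
  rw [AddSubmonoidClass.coe_finsetSum, Finset.sum_apply, Finset.sum_apply]

theorem bar_eq_sum (ℳ : G → Submodule k M) (π : G → M →ₗ[k] M) (hπ : ∀ x v, π x v ∈ ℳ x)
    (hπ' : ∀ x y v, v ∈ ℳ y → π x v = if x = y then v else 0)
    (m : ↥(barModule k G M ℳ)) :
    ∑ g, ∑ h, barSingle ℳ π hπ g h ((m : G → G → M) g h) = m := by
  apply Subtype.ext; funext g' h'
  simp only [bar_sum_coe, barSingle_apply, ite_and, Finset.sum_ite_eq, Finset.mem_univ, if_true]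
  simp [Finset.sum_ite_eq, hπ' _ _ _ (m.2 _ _)]

variable {A : Type u} [Ring A] [Algebra k A]

/-- Matrix unit times homogeneous component, in the algebra. -/
def barASingle (𝒜 : G → Submodule k A) (hone : (1 : A) ∈ 𝒜 1)
    (hmul : ∀ (g h : G) (a b : A), a ∈ 𝒜 g → b ∈ 𝒜 h → a * b ∈ 𝒜 (g * h))
    (π : G → A →ₗ[k] A) (hπ : ∀ x v, π x v ∈ 𝒜 x)
    (g h : G) (a : A) : ↥(barAlgebra k G A 𝒜 hone hmul) :=
  ⟨fun g' h' => if g' = g ∧ h' = h then π (g * h⁻¹) a else 0, by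
    intro g' h'
    dsimp only
    split_ifs with H
    · rw [H.1, H.2]; exact hπ _ _
    · exact Submodule.zero_mem _⟩

theorem barASingle_apply (𝒜 : G → Submodule k A) (hone : (1 : A) ∈ 𝒜 1)
    (hmul : ∀ (g h : G) (a b : A), a ∈ 𝒜 g → b ∈ 𝒜 h → a * b ∈ 𝒜 (g * h))
    (π : G → A →ₗ[k] A) (hπ : ∀ x v, π x v ∈ 𝒜 x)
    (g h : G) (a : A) (g' h' : G) :
    (barASingle 𝒜 hone hmul π hπ g h a : Matrix G G A) g' h' =
      if g' = g ∧ h' = h then π (g * h⁻¹) a else 0 := rfl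

end Single

set_option synthInstance.maxHeartbeats 2000000
set_option maxHeartbeats 2000000

/-- Let `G` be a finite group and let the `G`-graded bimodules `M` and `N` define a
`G`-graded stable equivalence of Morita type between the `G`-graded `k`-algebras `A` and
`B`: `M`, `N` are (graded) projective as one-sided modules, `M ⊗_B N ≅ A ⊕ P` as graded
`A`-`A`-bimodules with `P` a graded projective bimodule, and `N ⊗_A M ≅ B ⊕ Q` likewise.
Let `Ā = (A_{gh⁻¹})_{g,h}`, `B̄ = (B_{gh⁻¹})_{g,h}` be the Beilinson-Green algebras and
`M̄ = (M_{gh⁻¹})`, `N̄ = (N_{gh⁻¹})`, `P̄ = (P_{gh⁻¹})` the corresponding matrix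
bimodules.  Then `M̄ ⊗_{B̄} N̄ ≅ Ā ⊕ P̄` as `Ā`-`Ā`-bimodules. -/
theorem barConstruction_tensor_iso
    (k : Type u) [Field k]
    (G : Type u) [Group G] [Fintype G] [DecidableEq G]
    (A : Type u) [Ring A] [Algebra k A] [FiniteDimensional k A]
    (𝒜 : G → Submodule k A) (hAint : DirectSum.IsInternal 𝒜)
    (honeA : (1 : A) ∈ 𝒜 1)
    (hmulA : ∀ (g h : G) (a b : A), a ∈ 𝒜 g → b ∈ 𝒜 h → a * b ∈ 𝒜 (g * h))
    (B : Type u) [Ring B] [Algebra k B] [FiniteDimensional k B]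
    (ℬ : G → Submodule k B) (hBint : DirectSum.IsInternal ℬ)
    (honeB : (1 : B) ∈ ℬ 1)
    (hmulB : ∀ (g h : G) (a b : B), a ∈ ℬ g → b ∈ ℬ h → a * b ∈ ℬ (g * h))
    -- the graded `A`-`B`-bimodule `M` and the graded `B`-`A`-bimodule `N`
    (M : Type u) [AddCommGroup M] [Module k M] [Module A M] [Module Bᵐᵒᵖ M]
    [SMulCommClass k A M] [SMulCommClass k Bᵐᵒᵖ M] [SMulCommClass A Bᵐᵒᵖ M]
    (ℳ : G → Submodule k M) (hMint : DirectSum.IsInternal ℳ)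
    (hMl : ∀ (g h : G) (a : A) (m : M), a ∈ 𝒜 g → m ∈ ℳ h → a • m ∈ ℳ (g * h))
    (hMr : ∀ (g h : G) (b : B) (m : M), b ∈ ℬ g → m ∈ ℳ h → op b • m ∈ ℳ (h * g))
    (N : Type u) [AddCommGroup N] [Module k N] [Module B N] [Module Aᵐᵒᵖ N]
    [SMulCommClass k B N] [SMulCommClass k Aᵐᵒᵖ N] [SMulCommClass B Aᵐᵒᵖ N]
    (𝒩 : G → Submodule k N) (hNint : DirectSum.IsInternal 𝒩)
    (hNl : ∀ (g h : G) (b : B) (n : N), b ∈ ℬ g → n ∈ 𝒩 h → b • n ∈ 𝒩 (g * h))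
    (hNr : ∀ (g h : G) (a : A) (n : N), a ∈ 𝒜 g → n ∈ 𝒩 h → op a • n ∈ 𝒩 (h * g))
    -- `M`, `N` are (graded) projective as one-sided modules
    (hM₁ : Module.Projective A M) (hM₂ : Module.Projective Bᵐᵒᵖ M)
    (hN₁ : Module.Projective B N) (hN₂ : Module.Projective Aᵐᵒᵖ N)
    -- `M ⊗_B N ≅ A ⊕ P` as graded `A`-`A`-bimodules, `P` a graded projective bimodule
    (P : Type u) [AddCommGroup P] [Module k P] [Module A P] [Module Aᵐᵒᵖ P]
    [IsScalarTower k A P] [IsScalarTower k Aᵐᵒᵖ P] [SMulCommClass A Aᵐᵒᵖ P]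
    (𝒬 : G → Submodule k P) (hPint : DirectSum.IsInternal 𝒬)
    (hPproj : IsProjectiveBimodule k A A P)
    (e₀ : NCTensor k B A M N ≃ₗ[A] (A × P))
    (he₀ : ∀ (a : A) (t : NCTensor k B A M N),
      e₀ (NCTensor.rAct (k := k) (B := B) (A := A) (M := M) (X := N) a t)
        = ((e₀ t).1 * a, op a • (e₀ t).2))
    (hgr₀ : ∀ (g h : G) (m : M) (n : N), m ∈ ℳ g → n ∈ 𝒩 h →
      (e₀ (NCTensor.tmul k B A M N m n)).1 ∈ 𝒜 (g * h) ∧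
      (e₀ (NCTensor.tmul k B A M N m n)).2 ∈ 𝒬 (g * h))
    -- `N ⊗_A M ≅ B ⊕ Q` as graded `B`-`B`-bimodules, `Q` a graded projective bimodule
    (Q : Type u) [AddCommGroup Q] [Module k Q] [Module B Q] [Module Bᵐᵒᵖ Q]
    [IsScalarTower k B Q] [IsScalarTower k Bᵐᵒᵖ Q] [SMulCommClass B Bᵐᵒᵖ Q]
    (𝒬' : G → Submodule k Q) (hQint : DirectSum.IsInternal 𝒬')
    (hQproj : IsProjectiveBimodule k B B Q)
    (f₀ : NCTensor k A B N M ≃ₗ[B] (B × Q))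
    (hf₀ : ∀ (b : B) (t : NCTensor k A B N M),
      f₀ (NCTensor.rAct (k := k) (B := A) (A := B) (M := N) (X := M) b t)
        = ((f₀ t).1 * b, op b • (f₀ t).2))
    (hgr₀' : ∀ (g h : G) (n : N) (m : M), n ∈ 𝒩 g → m ∈ ℳ h →
      (f₀ (NCTensor.tmul k A B N M n m)).1 ∈ ℬ (g * h) ∧
      (f₀ (NCTensor.tmul k A B N M n m)).2 ∈ 𝒬' (g * h)) :
    -- the bar (Beilinson-Green matrix) construction:
    -- `Ā`, `B̄`, and the `Ā`-`B̄`-bimodule `M̄`, `B̄`-`Ā`-bimodule `N̄`, `Ā`-`Ā`-bimodule `P̄`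
    ∀ [instMl : Module ↥(barAlgebra k G A 𝒜 honeA hmulA) ↥(barModule k G M ℳ)]
      [instMr : Module (↥(barAlgebra k G B ℬ honeB hmulB))ᵐᵒᵖ ↥(barModule k G M ℳ)]
      [instMc1 : SMulCommClass k ↥(barAlgebra k G A 𝒜 honeA hmulA) ↥(barModule k G M ℳ)]
      [instMc2 : SMulCommClass k (↥(barAlgebra k G B ℬ honeB hmulB))ᵐᵒᵖ
        ↥(barModule k G M ℳ)]
      [instMc3 : SMulCommClass ↥(barAlgebra k G A 𝒜 honeA hmulA)
        (↥(barAlgebra k G B ℬ honeB hmulB))ᵐᵒᵖ ↥(barModule k G M ℳ)]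
      [instNl : Module ↥(barAlgebra k G B ℬ honeB hmulB) ↥(barModule k G N 𝒩)]
      [instNr : Module (↥(barAlgebra k G A 𝒜 honeA hmulA))ᵐᵒᵖ ↥(barModule k G N 𝒩)]
      [instNc1 : SMulCommClass k ↥(barAlgebra k G B ℬ honeB hmulB) ↥(barModule k G N 𝒩)]
      [instNc2 : SMulCommClass k (↥(barAlgebra k G A 𝒜 honeA hmulA))ᵐᵒᵖ
        ↥(barModule k G N 𝒩)]
      [instNc3 : SMulCommClass ↥(barAlgebra k G B ℬ honeB hmulB)
        (↥(barAlgebra k G A 𝒜 honeA hmulA))ᵐᵒᵖ ↥(barModule k G N 𝒩)]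
      [instPl : Module ↥(barAlgebra k G A 𝒜 honeA hmulA) ↥(barModule k G P 𝒬)]
      [instPr : Module (↥(barAlgebra k G A 𝒜 honeA hmulA))ᵐᵒᵖ ↥(barModule k G P 𝒬)],
      -- the actions on `M̄`, `N̄`, `P̄` are by matrix multiplication
      (∀ (a : ↥(barAlgebra k G A 𝒜 honeA hmulA)) (m : ↥(barModule k G M ℳ)) (g h : G),
        ((a • m : ↥(barModule k G M ℳ)) : G → G → M) g h
          = ∑ c : G, ((a : Matrix G G A) g c) • ((m : G → G → M) c h)) →
      (∀ (b : ↥(barAlgebra k G B ℬ honeB hmulB)) (m : ↥(barModule k G M ℳ)) (g h : G),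
        ((op b • m : ↥(barModule k G M ℳ)) : G → G → M) g h
          = ∑ c : G, op ((b : Matrix G G B) c h) • ((m : G → G → M) g c)) →
      (∀ (b : ↥(barAlgebra k G B ℬ honeB hmulB)) (n : ↥(barModule k G N 𝒩)) (g h : G),
        ((b • n : ↥(barModule k G N 𝒩)) : G → G → N) g h
          = ∑ c : G, ((b : Matrix G G B) g c) • ((n : G → G → N) c h)) →
      (∀ (a : ↥(barAlgebra k G A 𝒜 honeA hmulA)) (n : ↥(barModule k G N 𝒩)) (g h : G),
        ((op a • n : ↥(barModule k G N 𝒩)) : G → G → N) g h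
          = ∑ c : G, op ((a : Matrix G G A) c h) • ((n : G → G → N) g c)) →
      (∀ (a : ↥(barAlgebra k G A 𝒜 honeA hmulA)) (p : ↥(barModule k G P 𝒬)) (g h : G),
        ((a • p : ↥(barModule k G P 𝒬)) : G → G → P) g h
          = ∑ c : G, ((a : Matrix G G A) g c) • ((p : G → G → P) c h)) →
      (∀ (a : ↥(barAlgebra k G A 𝒜 honeA hmulA)) (p : ↥(barModule k G P 𝒬)) (g h : G),
        ((op a • p : ↥(barModule k G P 𝒬)) : G → G → P) g h
          = ∑ c : G, op ((a : Matrix G G A) c h) • ((p : G → G → P) g c)) →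
      -- conclusion: `M̄ ⊗_{B̄} N̄ ≅ Ā ⊕ P̄` as `Ā`-`Ā`-bimodules
      ∃ e : NCTensor k ↥(barAlgebra k G B ℬ honeB hmulB)
          ↥(barAlgebra k G A 𝒜 honeA hmulA) ↥(barModule k G M ℳ) ↥(barModule k G N 𝒩)
          ≃ₗ[↥(barAlgebra k G A 𝒜 honeA hmulA)]
          (↥(barAlgebra k G A 𝒜 honeA hmulA) × ↥(barModule k G P 𝒬)),
        ∀ (a : ↥(barAlgebra k G A 𝒜 honeA hmulA))
          (t : NCTensor k ↥(barAlgebra k G B ℬ honeB hmulB)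
            ↥(barAlgebra k G A 𝒜 honeA hmulA) ↥(barModule k G M ℳ)
            ↥(barModule k G N 𝒩)),
          e (NCTensor.rAct (k := k) (B := ↥(barAlgebra k G B ℬ honeB hmulB))
              (A := ↥(barAlgebra k G A 𝒜 honeA hmulA)) (M := ↥(barModule k G M ℳ))
              (X := ↥(barModule k G N 𝒩)) a t)
            = ((e t).1 * a, op a • (e t).2) := by
  intro instMl instMr instMc1 instMc2 instMc3 instNl instNr instNc1 instNc2 instNc3 instPl instPr
    hAM hMB hBN hNA hAP hPA
  obtain ⟨πA, hA1, hA2, hA3⟩ := exists_gproj 𝒜 hAint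
  obtain ⟨πB, hB1, hB2, hB3⟩ := exists_gproj ℬ hBint
  obtain ⟨πM, hM1, hM2, hM3⟩ := exists_gproj ℳ hMint
  obtain ⟨πN, hN1, hN2, hN3⟩ := exists_gproj 𝒩 hNint
  obtain ⟨πP, hP1, hP2, hP3⟩ := exists_gproj 𝒬 hPint
  -- abbreviations
  let τ := ncTmulHom k B A M N
  let τ' := ncTmulHom k ↥(barAlgebra k G B ℬ honeB hmulB)
    ↥(barAlgebra k G A 𝒜 honeA hmulA) ↥(barModule k G M ℳ) ↥(barModule k G N 𝒩)
  let EM := barSingle ℳ πM hM1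
  let EN := barSingle 𝒩 πN hN1
  let EB := barASingle ℬ honeB hmulB πB hB1
  -- convolution identities
  have convM : ∀ (g h : G) (m : M) (b : B), πM (g * h⁻¹) (op b • m)
      = ∑ c, op (πB (c * h⁻¹) b) • πM (g * c⁻¹) m := fun g h m b =>
    gproj_conv ℳ ℬ ℳ πM πB πM hM1 hM3 hB1 hB3 hM2
      (AddMonoidHom.mk' (fun m => AddMonoidHom.mk' (fun b : B => op b • m)
        (fun b b' => by rw [op_add, add_smul])) (fun m m' => by ext b; exact smul_add _ _ _))
      (fun x y u v hu hv => hMr y x v u hv hu) g h m b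
  have convN : ∀ (g h : G) (b : B) (n : N), πN (g * h⁻¹) (b • n)
      = ∑ c, πB (g * c⁻¹) b • πN (c * h⁻¹) n := fun g h b n =>
    gproj_conv ℬ 𝒩 𝒩 πB πN πN hB1 hB3 hN1 hN3 hN2
      (AddMonoidHom.mk' (fun b => AddMonoidHom.mk' (fun n => b • n)
        (fun n n' => smul_add _ _ _)) (fun b b' => by ext n; exact add_smul _ _ _))
      (fun x y u v hu hv => hNl x y u v hu hv) g h b n
  have convA : ∀ (g h : G) (m : M) (n : N), πA (g * h⁻¹) (e₀ (τ m n)).1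
      = ∑ c, (e₀ (τ (πM (g * c⁻¹) m) (πN (c * h⁻¹) n))).1 := fun g h m n =>
    gproj_conv ℳ 𝒩 𝒜 πM πN πA hM1 hM3 hN1 hN3 hA2
      (AddMonoidHom.mk' (fun m => AddMonoidHom.mk' (fun n => (e₀ (τ m n)).1)
        (fun n n' => by simp)) (fun b b' => by ext n; simp))
      (fun x y u v hu hv => (hgr₀ x y u v hu hv).1) g h m n
  have convP : ∀ (g h : G) (m : M) (n : N), πP (g * h⁻¹) (e₀ (τ m n)).2
      = ∑ c, (e₀ (τ (πM (g * c⁻¹) m) (πN (c * h⁻¹) n))).2 := fun g h m n =>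
    gproj_conv ℳ 𝒩 𝒬 πM πN πP hM1 hM3 hN1 hN3 hP2
      (AddMonoidHom.mk' (fun m => AddMonoidHom.mk' (fun n => (e₀ (τ m n)).2)
        (fun n n' => by simp)) (fun b b' => by ext n; simp))
      (fun x y u v hu hv => (hgr₀ x y u v hu hv).2) g h m n
  -- matrix unit identities
  have EMB : ∀ (g c : G) (m : M) (b : B), EM g c (op b • m) = ∑ d, op (EB d c b) • EM g d m := by
    intro g c m b
    apply Subtype.ext; funext g' c'
    rw [bar_sum_coe]
    simp only [hMB, EM, EB, barSingle_apply, barASingle_apply]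
    by_cases h1 : g' = g <;> by_cases h2 : c' = c <;> simp [h1, h2, convM, ite_smul, smul_ite]
  have ENB : ∀ (d h : G) (n : N) (b : B), EN d h (b • n) = ∑ c, EB d c b • EN c h n := by
    intro g c n b
    apply Subtype.ext; funext g' c'
    rw [bar_sum_coe]
    simp only [hBN, EN, EB, barSingle_apply, barASingle_apply]
    by_cases h1 : g' = g <;> by_cases h2 : c' = c <;> simp [h1, h2, convN, ite_smul, smul_ite]
  have EE0 : ∀ (g c c' h : G) (m : M) (n : N), c ≠ c' → τ' (EM g c m) (EN c' h n) = 0 := by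
    intro g c c' h m n hc
    have e1 : EM g c m = op (EB c c 1) • EM g c m := by
      apply Subtype.ext; funext x y
      simp only [hMB, EM, EB, barSingle_apply, barASingle_apply]
      have : πB (c * c⁻¹) 1 = 1 := by rw [hB2 _ 1 _ honeB, if_pos (by group)]
      rw [this]
      by_cases h1 : x = g <;> by_cases h2 : y = c <;> simp [h1, h2]
    have e2 : EB c c 1 • EN c' h n = 0 := by
      apply Subtype.ext; funext x y
      simp only [hBN, EN, EB, barSingle_apply, barASingle_apply]
      apply Finset.sum_eq_zero
      intro z _
      by_cases h1 : z = c
      · subst h1; simp [hc]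
      · simp [h1]
    show ncTmulHom _ _ _ _ _ _ _ = 0
    rw [e1, nc_smul_B, e2, map_zero]
  -- the maps back
  have hψ : ∀ g h : G, ∃ F : NCTensor k B A M N →+ NCTensor k ↥(barAlgebra k G B ℬ honeB hmulB)
      ↥(barAlgebra k G A 𝒜 honeA hmulA) ↥(barModule k G M ℳ) ↥(barModule k G N 𝒩),
      ∀ m n, F (τ m n) = ∑ c, τ' (EM g c m) (EN c h n) := by
    intro g h
    refine nc_lift (AddMonoidHom.mk' (fun m => AddMonoidHom.mk'
      (fun n => ∑ c, τ' (EM g c m) (EN c h n)) ?_) ?_) ?_ ?_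
    · intro n n'; simp [Finset.sum_add_distrib]
    · intro m m'; ext n; simp [Finset.sum_add_distrib]
    · intro r m n
      show ∑ c, τ' (EM g c (r • m)) (EN c h n) = ∑ c, τ' (EM g c m) (EN c h (r • n))
      refine Finset.sum_congr rfl fun c _ => ?_
      rw [(EM g c).map_smul, (EN c h).map_smul]
      exact nc_smul_k _ _ _
    · intro b m n
      show ∑ c, τ' (EM g c (op b • m)) (EN c h n) = ∑ c, τ' (EM g c m) (EN c h (b • n))
      simp only [EMB, ENB, map_sum, AddMonoidHom.finsetSum_apply]
      rw [Finset.sum_comm]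
      refine Finset.sum_congr rfl fun c _ => Finset.sum_congr rfl fun d _ => ?_
      exact nc_smul_B _ _ _
  choose ψ hψ using hψ
  -- the map forward
  have hΦ : ∃ F : NCTensor k ↥(barAlgebra k G B ℬ honeB hmulB)
      ↥(barAlgebra k G A 𝒜 honeA hmulA) ↥(barModule k G M ℳ) ↥(barModule k G N 𝒩) →+
      (G → G → NCTensor k B A M N),
      ∀ m n, F (τ' m n) = fun g h => ∑ c, τ ((m : G → G → M) g c) ((n : G → G → N) c h) := by
    refine nc_lift (AddMonoidHom.mk' (fun m : ↥(barModule k G M ℳ) => AddMonoidHom.mk'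
      (fun n : ↥(barModule k G N 𝒩) => fun g h => ∑ c, τ ((m : G → G → M) g c) ((n : G → G → N) c h)) ?_) ?_) ?_ ?_
    · intro n n'; funext g h; simp [Finset.sum_add_distrib]
    · intro m m'; ext n; simp [Finset.sum_add_distrib]
    · intro r m n
      funext g h
      refine Finset.sum_congr rfl fun c _ => ?_
      exact nc_smul_k _ _ _
    · intro b m n
      funext g h
      show ∑ c, τ ((op b • m : ↥(barModule k G M ℳ)) |>.1 g c) (n.1 c h)
        = ∑ c, τ (m.1 g c) ((b • n : ↥(barModule k G N 𝒩)) |>.1 c h)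
      simp only [hMB, hBN, map_sum, AddMonoidHom.finsetSum_apply]
      rw [Finset.sum_comm]
      refine Finset.sum_congr rfl fun c _ => Finset.sum_congr rfl fun d _ => ?_
      exact nc_smul_B _ _ _
  obtain ⟨Φ, hΦ⟩ := hΦ
  have Φmem : ∀ t g h, (e₀ (Φ t g h)).1 ∈ 𝒜 (g * h⁻¹) ∧ (e₀ (Φ t g h)).2 ∈ 𝒬 (g * h⁻¹) := by
    intro t g h
    induction t using nc_induction with
    | h0 => simp
    | ha s t hs ht =>
      simp only [map_add, Pi.add_apply, Prod.fst_add, Prod.snd_add]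
      exact ⟨Submodule.add_mem _ hs.1 ht.1, Submodule.add_mem _ hs.2 ht.2⟩
    | ht m n =>
      have := hΦ m n
      simp only [τ'] at this
      rw [this]
      simp only [map_sum, Prod.fst_sum, Prod.snd_sum]
      have key : ∀ c, _ := fun c => hgr₀ _ _ _ _ (m.2 g c) (n.2 c h)
      have e : ∀ c, (g * c⁻¹) * (c * h⁻¹) = g * h⁻¹ := fun c => by group
      simp only [e] at key
      exact ⟨Submodule.sum_mem _ fun c _ => (key c).1, Submodule.sum_mem _ fun c _ => (key c).2⟩
  have Φsmul : ∀ (a : ↥(barAlgebra k G A 𝒜 honeA hmulA)) t g h,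
      Φ (a • t) g h = ∑ c, (a : Matrix G G A) g c • Φ t c h := by
    intro a t g h
    induction t using nc_induction with
    | h0 => simp
    | ha s t hs ht => simp only [smul_add, map_add, Pi.add_apply, hs, ht, Finset.sum_add_distrib]
    | ht m n =>
      rw [nc_smul_A]
      have h1 := hΦ m n
      have h2 := hΦ (a • m) n
      simp only [τ'] at h1 h2
      rw [h1, h2]
      simp only [hAM, map_sum, AddMonoidHom.finsetSum_apply, Finset.smul_sum]
      rw [Finset.sum_comm]
      rfl
  have Φr : ∀ (a : ↥(barAlgebra k G A 𝒜 honeA hmulA)) t g h,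
      Φ (NCTensor.rAct (k := k) (B := ↥(barAlgebra k G B ℬ honeB hmulB))
              (A := ↥(barAlgebra k G A 𝒜 honeA hmulA)) (M := ↥(barModule k G M ℳ))
              (X := ↥(barModule k G N 𝒩)) a t) g h
        = ∑ c, NCTensor.rAct (k := k) (B := B) (A := A) (M := M) (X := N)
            ((a : Matrix G G A) c h) (Φ t g c) := by
    intro a t g h
    induction t using nc_induction with
    | h0 => simp
    | ha s t hs ht => simp only [map_add, Pi.add_apply, hs, ht, Finset.sum_add_distrib]
    | ht m n =>
      rw [nc_rAct]
      have h1 := hΦ m n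
      have h2 := hΦ m (op a • n)
      simp only [τ'] at h1 h2
      rw [h1, h2]
      simp only [hNA, map_sum]
      rw [Finset.sum_comm]
      rfl
  -- `Ψ ∘ Φ = id`
  have ΨΦ : ∀ t, ∑ g, ∑ h, ψ g h (Φ t g h) = t := by
    intro t
    induction t using nc_induction with
    | h0 => simp
    | ha s t hs ht =>
      simp only [map_add, Pi.add_apply, Finset.sum_add_distrib]
      rw [hs, ht]
    | ht m n =>
      have h1 := hΦ m n
      simp only [τ'] at h1
      rw [h1]
      simp only [map_sum, hψ]
      have EMs : ∀ g c c' : G, EM g c' (m.1 g c) = if c' = c then EM g c (m.1 g c) else 0 := by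
        intro g c c'
        split_ifs with hc
        · rw [hc]
        · apply Subtype.ext; funext x y
          simp only [EM, barSingle_apply]
          have hne : g * c'⁻¹ ≠ g * c⁻¹ := fun h' => hc (by simpa using h')
          rw [hM2 _ _ _ (m.2 g c), if_neg hne]
          simp
      have inner : ∀ g h c : G, ∑ c', τ' (EM g c' (m.1 g c)) (EN c' h (n.1 c h))
          = τ' (EM g c (m.1 g c)) (EN c h (n.1 c h)) := by
        intro g h c
        rw [Finset.sum_eq_single c]
        · intro c' _ hc'
          rw [EMs, if_neg hc', map_zero, AddMonoidHom.zero_apply]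
        · intro h'; exact absurd (Finset.mem_univ _) h'
      simp only [inner]
      have hm := bar_eq_sum ℳ πM hM1 hM2 m
      have hn := bar_eq_sum 𝒩 πN hN1 hN2 n
      have : τ' m n = ∑ g, ∑ c, ∑ c', ∑ h, τ' (EM g c (m.1 g c)) (EN c' h (n.1 c' h)) := by
        conv_lhs => rw [← hm, ← hn]
        simp only [map_sum, AddMonoidHom.finsetSum_apply]
        simp only [EM, EN]
        rw [Finset.sum_congr rfl fun c' _ => Finset.sum_comm]
        rw [Finset.sum_comm]
        refine Finset.sum_congr rfl fun g _ => ?_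
        rw [Finset.sum_congr rfl fun c' _ => Finset.sum_comm]
        rw [Finset.sum_comm]
      show _ = τ' m n
      rw [this]
      refine Finset.sum_congr rfl fun g _ => ?_
      rw [Finset.sum_comm]
      refine Finset.sum_congr rfl fun c _ => ?_
      symm
      apply Finset.sum_eq_single c
      · intro c' _ hc'
        exact Finset.sum_eq_zero fun h _ => EE0 _ _ _ _ _ _ (Ne.symm hc')
      · intro h'; exact absurd (Finset.mem_univ _) h'
  -- `Φ ∘ ψ`
  have Φψ : ∀ (g h : G) s (g' h' : G), e₀ (Φ (ψ g h s) g' h')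
      = if g' = g ∧ h' = h then (πA (g * h⁻¹) (e₀ s).1, πP (g * h⁻¹) (e₀ s).2) else 0 := by
    intro g h s g' h'
    induction s using nc_induction with
    | h0 =>
      simp only [map_zero, Pi.zero_apply, Prod.fst_zero, Prod.snd_zero]
      split_ifs <;> rfl
    | ha s t hs ht =>
      simp only [map_add, Pi.add_apply, hs, ht, Prod.fst_add, Prod.snd_add]
      split_ifs <;> simp
    | ht m n =>
      have h1 := hψ g h m n
      simp only [τ] at h1
      rw [h1]
      simp only [map_sum, Finset.sum_apply, hΦ]
      simp only [EM, EN, barSingle_apply]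
      have cA := convA g h m n
      have cP := convP g h m n
      simp only [τ] at cA cP
      by_cases hg : g' = g
      · by_cases hh : h' = h
        · simp only [hg, hh, true_and, and_true, if_true]
          have pr : ∀ f : G → A × P, (∑ c, (f c).1, ∑ c, (f c).2) = ∑ c, f c := fun f =>
            Prod.ext Prod.fst_sum.symm Prod.snd_sum.symm
          rw [cA, cP, pr (fun c => e₀ (ncTmulHom k B A M N (πM (g * c⁻¹) m) (πN (c * h⁻¹) n)))]
          refine Finset.sum_congr rfl fun c _ => ?_
          rw [Finset.sum_eq_single c]
          · simp [τ]
          · intro d _ hd; simp [hd]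
          · intro h'; exact absurd (Finset.mem_univ _) h'
        · simp [hh]
      · simp [hg]
  let F : NCTensor k ↥(barAlgebra k G B ℬ honeB hmulB)
          ↥(barAlgebra k G A 𝒜 honeA hmulA) ↥(barModule k G M ℳ) ↥(barModule k G N 𝒩)
          →ₗ[↥(barAlgebra k G A 𝒜 honeA hmulA)]
          (↥(barAlgebra k G A 𝒜 honeA hmulA) × ↥(barModule k G P 𝒬)) :=
    { toFun := fun t => (⟨fun g h => (e₀ (Φ t g h)).1, fun g h => (Φmem t g h).1⟩,
        ⟨fun g h => (e₀ (Φ t g h)).2, fun g h => (Φmem t g h).2⟩)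
      map_add' := by
        intro s t
        refine Prod.ext (Subtype.ext ?_) (Subtype.ext ?_)
        · funext g h
          show (e₀ (Φ (s + t) g h)).1 = (e₀ (Φ s g h)).1 + (e₀ (Φ t g h)).1
          simp
        · funext g h
          show (e₀ (Φ (s + t) g h)).2 = (e₀ (Φ s g h)).2 + (e₀ (Φ t g h)).2
          simp
      map_smul' := by
        intro a t
        refine Prod.ext (Subtype.ext ?_) (Subtype.ext ?_)
        · funext g h
          show (e₀ (Φ (a • t) g h)).1 = ∑ c, a.1 g c * (e₀ (Φ t c h)).1
          simp [Φsmul, Prod.fst_sum]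
        · funext g h
          refine Eq.trans ?_ (hAP _ _ _ _).symm
          show (e₀ (Φ (a • t) g h)).2 = ∑ c, a.1 g c • (e₀ (Φ t c h)).2
          simp [Φsmul, Prod.snd_sum] }
  have F1 : ∀ t g h, (F t).1.1 g h = (e₀ (Φ t g h)).1 := fun _ _ _ => rfl
  have F2 : ∀ t g h, (F t).2.1 g h = (e₀ (Φ t g h)).2 := fun _ _ _ => rfl
  have Finj : Function.Injective F := by
    intro s t hst
    have : Φ s = Φ t := by
      funext g h
      apply e₀.injective
      refine Prod.ext ?_ ?_
      · rw [← F1, ← F1, hst]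
      · rw [← F2, ← F2, hst]
    rw [← ΨΦ s, ← ΨΦ t, this]
  have Fsurj : Function.Surjective F := by
    rintro ⟨a, p⟩
    have key : ∀ g' h', e₀ (Φ (∑ g, ∑ h, ψ g h (e₀.symm (a.1 g h, p.1 g h))) g' h')
        = (a.1 g' h', p.1 g' h') := by
      intro g' h'
      simp only [map_sum, Finset.sum_apply, Φψ, LinearEquiv.apply_symm_apply, ite_and,
        Finset.sum_ite_eq, Finset.mem_univ, if_true]
      simp [hA2 _ _ _ (a.2 g' h'), hP2 _ _ _ (p.2 g' h')]
    refine ⟨∑ g, ∑ h, ψ g h (e₀.symm (a.1 g h, p.1 g h)), ?_⟩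
    refine Prod.ext (Subtype.ext ?_) (Subtype.ext ?_)
    · funext g h
      rw [F1, key]
    · funext g h
      rw [F2, key]
  refine ⟨LinearEquiv.ofBijective F ⟨Finj, Fsurj⟩, ?_⟩
  intro a t
  show F _ = ((F t).1 * a, op a • (F t).2)
  refine Prod.ext (Subtype.ext ?_) (Subtype.ext ?_)
  · funext g h
    rw [F1, Φr]
    show _ = ∑ c, (e₀ (Φ t g c)).1 * a.1 c h
    simp [he₀, Prod.fst_sum]
  · funext g h
    rw [F2, Φr]
    refine Eq.trans ?_ (hPA _ _ _ _).symm
    simp [he₀, Prod.snd_sum, F2]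
end

section
/- Let G be a finite group and A a G-graded k-algebra. If P is a graded projective A-A-bimodule, i.e., P ∈ add(A ⊗_k A) in the category of graded bimodules, then P̄ = (P_{gh^{−1}})_{g,h∈G} is a projective Ā-Ā-bimodule, i.e., P̄ ∈ add(Ā ⊗_k Ā^{op}), where Ā = (A_{gh^{−1}})_{g,h∈G} is the Beilinson-Green algebra of A. -/
open TensorProduct MulOpposite

universe u

set_option synthInstance.maxHeartbeats 2000000
set_option maxHeartbeats 2000000

section GradedTensor

variable (k : Type u) [Field k]
variable (G : Type u) [Group G] [Fintype G] [DecidableEq G]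
variable (A : Type u) [Ring A] [Algebra k A]

/-- The degree-`g` part of the graded algebra `A ⊗_k A`. -/
def gradedTensorDeg (𝒜 : G → Submodule k A) (g : G) : Submodule k (A ⊗[k] A) :=
  Submodule.span k
    {z | ∃ (u v : G) (a b : A), a ∈ 𝒜 u ∧ b ∈ 𝒜 v ∧ u * v = g ∧ z = a ⊗ₜ[k] b}

end GradedTensor

section Helpers

theorem exists_proj {k : Type u} [Field k] {G : Type u} [Fintype G] [DecidableEq G]
    {M : Type u} [AddCommGroup M] [Module k M] (ℳ : G → Submodule k M)
    (h : DirectSum.IsInternal ℳ) :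
    ∃ p : G → M →ₗ[k] M, (∀ g m, p g m ∈ ℳ g) ∧ (∀ g m, m ∈ ℳ g → p g m = m) ∧
      (∀ g g' m, m ∈ ℳ g → g' ≠ g → p g' m = 0) ∧ (∀ m, ∑ g, p g m = m) := by
  let e : DirectSum G (fun g => ℳ g) ≃ₗ[k] M :=
    LinearEquiv.ofBijective (DirectSum.coeLinearMap ℳ) h
  have he : ∀ g (m : M) (hm : m ∈ ℳ g),
      e.symm m = DirectSum.lof k G (fun g => ℳ g) g ⟨m, hm⟩ := by
    intro g m hm
    rw [LinearEquiv.symm_apply_eq]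
    exact (DirectSum.coeLinearMap_lof ℳ g ⟨m, hm⟩).symm
  refine ⟨fun g => (ℳ g).subtype ∘ₗ DirectSum.component k G (fun g => ℳ g) g ∘ₗ
    e.symm.toLinearMap, ?_, ?_, ?_, ?_⟩
  · intro g m
    simp
  · intro g m hm
    simp [he g m hm, DirectSum.component.lof_self]
  · intro g g' m hm hne
    simp only [LinearMap.comp_apply, LinearEquiv.coe_coe, he g m hm]
    rw [DirectSum.component.of, dif_neg (Ne.symm hne)]
    simp
  · intro m
    obtain ⟨x, rfl⟩ := e.surjective m
    simp only [LinearMap.comp_apply, LinearEquiv.coe_coe, LinearEquiv.symm_apply_apply]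
    induction x using DirectSum.induction_on with
    | zero => simp
    | of i x =>
      rw [Finset.sum_eq_single i]
      · have : e (DirectSum.of (fun g => ℳ g) i x) = x := by
          exact DirectSum.coeLinearMap_lof ℳ i x
        rw [this]
        exact congrArg _ (DirectSum.component.lof_self k (M := fun g => ℳ g) i x)
      · intro j _ hj
        have : DirectSum.component k G (fun g => ℳ g) j (DirectSum.of (fun g => ℳ g) i x) = 0 := by
          have := DirectSum.component.of k (M := fun g => ℳ g) j i x
          rw [dif_neg (Ne.symm hj)] at this
          exact this
        rw [this]; simp
      · simp
    | add x y hx hy =>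
      simp only [map_add, Finset.sum_add_distrib, hx, hy]

variable {k : Type u} [Field k]
variable {G : Type u} [Group G] [Fintype G] [DecidableEq G]
variable {A : Type u} [Ring A] [Algebra k A]

theorem proj_mul_left {𝒜 : G → Submodule k A}
    (hmul : ∀ (g h : G) (a b : A), a ∈ 𝒜 g → b ∈ 𝒜 h → a * b ∈ 𝒜 (g * h))
    {p : G → A →ₗ[k] A} (p1 : ∀ g m, p g m ∈ 𝒜 g) (p2 : ∀ g m, m ∈ 𝒜 g → p g m = m)
    (p3 : ∀ g g' m, m ∈ 𝒜 g → g' ≠ g → p g' m = 0) (p4 : ∀ m, ∑ g, p g m = m)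
    (u x : G) (a b : A) (ha : a ∈ 𝒜 u) : p (u * x) (a * b) = a * p x b := by
  conv_lhs => rw [← p4 b]
  rw [Finset.mul_sum, map_sum, Finset.sum_eq_single x]
  · exact p2 _ _ (hmul _ _ _ _ ha (p1 _ _))
  · intro y _ hy
    exact p3 _ _ _ (hmul _ _ _ _ ha (p1 y b)) (fun h => hy (mul_left_cancel h).symm)
  · simp

theorem proj_mul_right {𝒜 : G → Submodule k A}
    (hmul : ∀ (g h : G) (a b : A), a ∈ 𝒜 g → b ∈ 𝒜 h → a * b ∈ 𝒜 (g * h))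
    {p : G → A →ₗ[k] A} (p1 : ∀ g m, p g m ∈ 𝒜 g) (p2 : ∀ g m, m ∈ 𝒜 g → p g m = m)
    (p3 : ∀ g g' m, m ∈ 𝒜 g → g' ≠ g → p g' m = 0) (p4 : ∀ m, ∑ g, p g m = m)
    (u x : G) (a b : A) (ha : a ∈ 𝒜 u) : p (x * u) (b * a) = p x b * a := by
  conv_lhs => rw [← p4 b]
  rw [Finset.sum_mul, map_sum, Finset.sum_eq_single x]
  · exact p2 _ _ (hmul _ _ _ _ (p1 _ _) ha)
  · intro y _ hy
    exact p3 _ _ _ (hmul _ _ _ _ (p1 y b) ha) (fun h => hy (mul_right_cancel h).symm)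
  · simp

/-- projection of `A ⊗ A` to degree `g`. -/
noncomputable def tproj (p : G → A →ₗ[k] A) (g : G) : A ⊗[k] A →ₗ[k] A ⊗[k] A :=
  ∑ c : G, TensorProduct.map (p c) (p (c⁻¹ * g))

theorem tproj_tmul (p : G → A →ₗ[k] A) (g : G) (s t : A) :
    tproj p g (s ⊗ₜ t) = ∑ c : G, p c s ⊗ₜ[k] p (c⁻¹ * g) t := by
  simp [tproj, LinearMap.sum_apply]

theorem tproj_of_mem {𝒜 : G → Submodule k A}
    {p : G → A →ₗ[k] A} (p2 : ∀ g m, m ∈ 𝒜 g → p g m = m)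
    (p3 : ∀ g g' m, m ∈ 𝒜 g → g' ≠ g → p g' m = 0)
    (g g' : G) (z : A ⊗[k] A) (hz : z ∈ gradedTensorDeg k G A 𝒜 g) :
    tproj p g' z = if g' = g then z else 0 := by
  induction hz using Submodule.span_induction with
  | mem z hz =>
    obtain ⟨u, v, a, b, ha, hb, huv, rfl⟩ := hz
    rw [tproj_tmul, Finset.sum_eq_single u]
    · split_ifs with h
      · rw [p2 u a ha, p2 (u⁻¹ * g') b]
        rwa [h, ← huv, inv_mul_cancel_left]
      · rw [p3 v (u⁻¹ * g') b hb, TensorProduct.tmul_zero]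
        intro h'
        apply h
        rw [← huv, ← h', mul_inv_cancel_left]
    · intro c _ hc
      rw [p3 u c a ha hc, TensorProduct.zero_tmul]
    · simp
  | zero => simp
  | add x y _ _ hx hy => rw [map_add, hx, hy]; split_ifs <;> simp
  | smul r x _ hx => rw [map_smul, hx]; split_ifs <;> simp

theorem tproj_smul {𝒜 : G → Submodule k A} {p : G → A →ₗ[k] A}
    (hl : ∀ (u x : G) (a b : A), a ∈ 𝒜 u → p (u * x) (a * b) = a * p x b)
    (u x : G) (a : A) (ha : a ∈ 𝒜 u) (z : A ⊗[k] A) :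
    tproj p (u * x) (a • z) = a • tproj p x z := by
  induction z with
  | zero => simp
  | add y z hy hz => simp only [smul_add, map_add, hy, hz]
  | tmul s t =>
    rw [TensorProduct.smul_tmul', tproj_tmul, tproj_tmul, Finset.smul_sum,
      ← Equiv.sum_comp (Equiv.mulLeft u)]
    refine Finset.sum_congr rfl fun c _ => ?_
    rw [TensorProduct.smul_tmul', Equiv.coe_mulLeft, smul_eq_mul, smul_eq_mul, hl _ _ _ _ ha]
    congr 2
    group

theorem tproj_rsmul {𝒜 : G → Submodule k A} {p : G → A →ₗ[k] A}
    (hr : ∀ (u x : G) (a b : A), a ∈ 𝒜 u → p (x * u) (b * a) = p x b * a)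
    (u x : G) (a : A) (ha : a ∈ 𝒜 u) (z : A ⊗[k] A) :
    tproj p (x * u) (LinearMap.lTensor A (LinearMap.mulRight k a) z)
      = LinearMap.lTensor A (LinearMap.mulRight k a) (tproj p x z) := by
  induction z with
  | zero => simp
  | add y z hy hz => simp only [map_add, hy, hz]
  | tmul s t =>
    rw [LinearMap.lTensor_tmul, tproj_tmul, tproj_tmul, map_sum]
    refine Finset.sum_congr rfl fun c _ => ?_
    rw [LinearMap.lTensor_tmul, LinearMap.mulRight_apply, LinearMap.mulRight_apply,
      ← mul_assoc, hr _ _ _ _ ha]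

variable {𝒜 : G → Submodule k A} {hone : (1 : A) ∈ 𝒜 1}
    {hmul : ∀ (g h : G) (a b : A), a ∈ 𝒜 g → b ∈ 𝒜 h → a * b ∈ 𝒜 (g * h)}

/-- `a ↦ E_{g,c} p_{gc⁻¹}(a)`. -/
def eps (hone : (1 : A) ∈ 𝒜 1)
    (hmul : ∀ (g h : G) (a b : A), a ∈ 𝒜 g → b ∈ 𝒜 h → a * b ∈ 𝒜 (g * h))
    (p : G → A →ₗ[k] A) (p1 : ∀ g m, p g m ∈ 𝒜 g) (g c : G) :
    A →ₗ[k] (barAlgebra k G A 𝒜 hone hmul) where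
  toFun a := ⟨Matrix.single g c (p (g * c⁻¹) a), by
    intro g' c'
    rw [Matrix.single_apply]
    split_ifs with h
    · rw [← h.1, ← h.2]; exact p1 _ _
    · exact Submodule.zero_mem _⟩
  map_add' a b := by
    apply Subtype.ext
    simp [Matrix.single_add]
  map_smul' r a := by
    apply Subtype.ext
    simp [Matrix.smul_single]

theorem eps_coe (p : G → A →ₗ[k] A) (p1 : ∀ g m, p g m ∈ 𝒜 g) (g c : G) (a : A) :
    ((eps hone hmul p p1 g c a : barAlgebra k G A 𝒜 hone hmul) : Matrix G G A)
      = Matrix.single g c (p (g * c⁻¹) a) := rfl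

theorem mul_eps (p : G → A →ₗ[k] A) (p1 : ∀ g m, p g m ∈ 𝒜 g)
    (hl : ∀ (u x : G) (a b : A), a ∈ 𝒜 u → p (u * x) (a * b) = a * p x b)
    (b : barAlgebra k G A 𝒜 hone hmul) (g c : G) (a : A) :
    b * eps hone hmul p p1 g c a
      = ∑ g' : G, eps hone hmul p p1 g' c ((b : Matrix G G A) g' g * a) := by
  apply Subtype.ext
  ext i j
  have hb : ∀ g', p (g' * c⁻¹) ((b : Matrix G G A) g' g * a)
      = (b : Matrix G G A) g' g * p (g * c⁻¹) a := by
    intro g'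
    rw [← hl (g' * g⁻¹) _ _ _ (b.2 g' g)]
    congr 2
    group
  rw [MulMemClass.coe_mul, AddSubmonoidClass.coe_finsetSum, Matrix.sum_apply, Matrix.mul_apply]
  simp only [eps_coe, hb, Matrix.single_apply]
  by_cases h : c = j
  · simp [h]
  · simp [h]

theorem eps_mul (p : G → A →ₗ[k] A) (p1 : ∀ g m, p g m ∈ 𝒜 g)
    (hr : ∀ (u x : G) (a b : A), a ∈ 𝒜 u → p (x * u) (b * a) = p x b * a)
    (b : barAlgebra k G A 𝒜 hone hmul) (c h : G) (a : A) :
    eps hone hmul p p1 c h a * b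
      = ∑ h' : G, eps hone hmul p p1 c h' (a * (b : Matrix G G A) h h') := by
  apply Subtype.ext
  ext i j
  have hb : ∀ h', p (c * h'⁻¹) (a * (b : Matrix G G A) h h')
      = p (c * h⁻¹) a * (b : Matrix G G A) h h' := by
    intro h'
    rw [← hr (h * h'⁻¹) _ _ _ (b.2 h h')]
    congr 2
    group
  rw [MulMemClass.coe_mul, AddSubmonoidClass.coe_finsetSum, Matrix.sum_apply, Matrix.mul_apply]
  simp only [eps_coe, hb, Matrix.single_apply]
  by_cases h : c = i
  · simp [h]
  · simp [h]

/-- The map from matrices over `A ⊗ A` to `Ā ⊗ Ā`. -/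
noncomputable def Phi (hone : (1 : A) ∈ 𝒜 1)
    (hmul : ∀ (g h : G) (a b : A), a ∈ 𝒜 g → b ∈ 𝒜 h → a * b ∈ 𝒜 (g * h))
    (p : G → A →ₗ[k] A) (p1 : ∀ g m, p g m ∈ 𝒜 g) :
    (G → G → A ⊗[k] A) →ₗ[k]
      (barAlgebra k G A 𝒜 hone hmul) ⊗[k] (barAlgebra k G A 𝒜 hone hmul) :=
  ∑ g : G, ∑ h : G, (∑ c : G, TensorProduct.map (eps hone hmul p p1 g c)
    (eps hone hmul p p1 c h)) ∘ₗ LinearMap.proj h ∘ₗ LinearMap.proj g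

theorem Phi_apply (p : G → A →ₗ[k] A) (p1 : ∀ g m, p g m ∈ 𝒜 g) (f : G → G → A ⊗[k] A) :
    Phi hone hmul p p1 f = ∑ g : G, ∑ h : G, ∑ c : G,
      TensorProduct.map (eps hone hmul p p1 g c) (eps hone hmul p p1 c h) (f g h) := by
  simp [Phi, LinearMap.sum_apply]

theorem smul_map_eps (p : G → A →ₗ[k] A) (p1 : ∀ g m, p g m ∈ 𝒜 g)
    (hl : ∀ (u x : G) (a b : A), a ∈ 𝒜 u → p (u * x) (a * b) = a * p x b)
    (b : barAlgebra k G A 𝒜 hone hmul) (g h c : G) (z : A ⊗[k] A) :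
    b • TensorProduct.map (eps hone hmul p p1 g c) (eps hone hmul p p1 c h) z
      = ∑ g' : G, TensorProduct.map (eps hone hmul p p1 g' c) (eps hone hmul p p1 c h)
          ((b : Matrix G G A) g' g • z) := by
  induction z with
  | zero => simp
  | add y z hy hz => simp only [smul_add, map_add, hy, hz, Finset.sum_add_distrib]
  | tmul s t =>
    rw [TensorProduct.map_tmul, TensorProduct.smul_tmul', smul_eq_mul, mul_eps p p1 hl,
      TensorProduct.sum_tmul]
    refine Finset.sum_congr rfl fun g' _ => ?_
    rw [TensorProduct.smul_tmul', TensorProduct.map_tmul, smul_eq_mul]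

theorem rsmul_map_eps (p : G → A →ₗ[k] A) (p1 : ∀ g m, p g m ∈ 𝒜 g)
    (hr : ∀ (u x : G) (a b : A), a ∈ 𝒜 u → p (x * u) (b * a) = p x b * a)
    (b : barAlgebra k G A 𝒜 hone hmul) (g h c : G) (z : A ⊗[k] A) :
    LinearMap.lTensor _ (LinearMap.mulRight k b)
      (TensorProduct.map (eps hone hmul p p1 g c) (eps hone hmul p p1 c h) z)
      = ∑ h' : G, TensorProduct.map (eps hone hmul p p1 g c) (eps hone hmul p p1 c h')
          (LinearMap.lTensor A (LinearMap.mulRight k ((b : Matrix G G A) h h')) z) := by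
  induction z with
  | zero => simp
  | add y z hy hz => simp only [map_add, hy, hz, Finset.sum_add_distrib]
  | tmul s t =>
    rw [TensorProduct.map_tmul, LinearMap.lTensor_tmul, LinearMap.mulRight_apply,
      eps_mul p p1 hr, TensorProduct.tmul_sum]
    refine Finset.sum_congr rfl fun g' _ => ?_
    rw [LinearMap.lTensor_tmul, TensorProduct.map_tmul, LinearMap.mulRight_apply]

theorem Phi_smul (p : G → A →ₗ[k] A) (p1 : ∀ g m, p g m ∈ 𝒜 g)
    (hl : ∀ (u x : G) (a b : A), a ∈ 𝒜 u → p (u * x) (a * b) = a * p x b)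
    (b : barAlgebra k G A 𝒜 hone hmul) (f : G → G → A ⊗[k] A) :
    Phi hone hmul p p1 (fun g h => ∑ c : G, (b : Matrix G G A) g c • f c h)
      = b • Phi hone hmul p p1 f := by
  simp only [Phi_apply, Finset.smul_sum, smul_map_eps p p1 hl, map_sum]
  -- LHS: g', h, c, g ; RHS: g, h, c, g'
  calc _ = ∑ g' : G, ∑ h : G, ∑ g : G, ∑ c : G,
        TensorProduct.map (eps hone hmul p p1 g' c) (eps hone hmul p p1 c h)
          ((b : Matrix G G A) g' g • f g h) := by
        refine Finset.sum_congr rfl fun _ _ => Finset.sum_congr rfl fun _ _ => ?_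
        exact Finset.sum_comm
    _ = ∑ g' : G, ∑ g : G, ∑ h : G, ∑ c : G,
        TensorProduct.map (eps hone hmul p p1 g' c) (eps hone hmul p p1 c h)
          ((b : Matrix G G A) g' g • f g h) := by
        refine Finset.sum_congr rfl fun _ _ => ?_
        exact Finset.sum_comm
    _ = _ := by
        rw [Finset.sum_comm]
        refine Finset.sum_congr rfl fun _ _ => ?_
        rw [Finset.sum_comm]
        refine Finset.sum_congr rfl fun _ _ => ?_
        rw [Finset.sum_comm]

theorem Phi_rsmul (p : G → A →ₗ[k] A) (p1 : ∀ g m, p g m ∈ 𝒜 g)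
    (hr : ∀ (u x : G) (a b : A), a ∈ 𝒜 u → p (x * u) (b * a) = p x b * a)
    (b : barAlgebra k G A 𝒜 hone hmul) (f : G → G → A ⊗[k] A) :
    Phi hone hmul p p1 (fun g h => ∑ c : G,
        LinearMap.lTensor A (LinearMap.mulRight k ((b : Matrix G G A) c h)) (f g c))
      = LinearMap.lTensor _ (LinearMap.mulRight k b) (Phi hone hmul p p1 f) := by
  simp only [Phi_apply, rsmul_map_eps p p1 hr, map_sum]
  refine Finset.sum_congr rfl fun g _ => ?_
  -- LHS: h', c, h ; RHS: h, c, h'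
  calc _ = ∑ h' : G, ∑ h : G, ∑ c : G,
        TensorProduct.map (eps hone hmul p p1 g c) (eps hone hmul p p1 c h')
          (LinearMap.lTensor A (LinearMap.mulRight k ((b : Matrix G G A) h h')) (f g h)) := by
        refine Finset.sum_congr rfl fun _ _ => ?_
        exact Finset.sum_comm
    _ = _ := by
        rw [Finset.sum_comm]
        refine Finset.sum_congr rfl fun _ _ => ?_
        rw [Finset.sum_comm]

/-- entry of a matrix in `Ā`. -/
def entry (hone : (1 : A) ∈ 𝒜 1)
    (hmul : ∀ (g h : G) (a b : A), a ∈ 𝒜 g → b ∈ 𝒜 h → a * b ∈ 𝒜 (g * h)) (g h : G) :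
    (barAlgebra k G A 𝒜 hone hmul) →ₗ[k] A where
  toFun b := (b : Matrix G G A) g h
  map_add' _ _ := rfl
  map_smul' _ _ := rfl

theorem entry_apply (g h : G) (b : barAlgebra k G A 𝒜 hone hmul) :
    entry hone hmul g h b = (b : Matrix G G A) g h := rfl

/-- The `(g,h)`-entry of the map from `Ā ⊗ Ā` to matrices over `A ⊗ A`. -/
noncomputable def Psi (hone : (1 : A) ∈ 𝒜 1)
    (hmul : ∀ (g h : G) (a b : A), a ∈ 𝒜 g → b ∈ 𝒜 h → a * b ∈ 𝒜 (g * h)) (g h : G) :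
    (barAlgebra k G A 𝒜 hone hmul) ⊗[k] (barAlgebra k G A 𝒜 hone hmul) →ₗ[k] A ⊗[k] A :=
  ∑ c : G, TensorProduct.map (entry hone hmul g c) (entry hone hmul c h)

theorem Psi_tmul (g h : G) (s t : barAlgebra k G A 𝒜 hone hmul) :
    Psi hone hmul g h (s ⊗ₜ t)
      = ∑ c : G, (s : Matrix G G A) g c ⊗ₜ[k] (t : Matrix G G A) c h := by
  simp [Psi, LinearMap.sum_apply, entry_apply]

theorem Psi_smul (b : barAlgebra k G A 𝒜 hone hmul) (g h : G)
    (z : (barAlgebra k G A 𝒜 hone hmul) ⊗[k] (barAlgebra k G A 𝒜 hone hmul)) :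
    Psi hone hmul g h (b • z) = ∑ c : G, (b : Matrix G G A) g c • Psi hone hmul c h z := by
  induction z with
  | zero => simp
  | add y z hy hz => simp only [smul_add, map_add, hy, hz, Finset.sum_add_distrib]
  | tmul s t =>
    simp only [TensorProduct.smul_tmul', Psi_tmul, smul_eq_mul, MulMemClass.coe_mul,
      Matrix.mul_apply, TensorProduct.sum_tmul, Finset.smul_sum]
    exact Finset.sum_comm

theorem Psi_rsmul (b : barAlgebra k G A 𝒜 hone hmul) (g h : G)
    (z : (barAlgebra k G A 𝒜 hone hmul) ⊗[k] (barAlgebra k G A 𝒜 hone hmul)) :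
    Psi hone hmul g h (LinearMap.lTensor _ (LinearMap.mulRight k b) z)
      = ∑ c : G, LinearMap.lTensor A (LinearMap.mulRight k ((b : Matrix G G A) c h))
          (Psi hone hmul g c z) := by
  induction z with
  | zero => simp
  | add y z hy hz => simp only [map_add, hy, hz, Finset.sum_add_distrib]
  | tmul s t =>
    simp only [LinearMap.lTensor_tmul, LinearMap.mulRight_apply, Psi_tmul, MulMemClass.coe_mul,
      Matrix.mul_apply, TensorProduct.tmul_sum, map_sum]
    exact Finset.sum_comm

theorem Psi_map_eps (p : G → A →ₗ[k] A) (p1 : ∀ g m, p g m ∈ 𝒜 g)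
    (g h g' h' c : G) (z : A ⊗[k] A) :
    Psi hone hmul g h
        (TensorProduct.map (eps hone hmul p p1 g' c) (eps hone hmul p p1 c h') z)
      = if g' = g then (if h' = h then
          TensorProduct.map (p (g * c⁻¹)) (p (c * h⁻¹)) z else 0) else 0 := by
  induction z with
  | zero => simp
  | add y z hy hz => simp only [map_add, hy, hz]; split_ifs <;> simp
  | tmul s t =>
    rw [TensorProduct.map_tmul, Psi_tmul, Finset.sum_eq_single c]
    · by_cases h1 : g' = g
      · by_cases h2 : h' = h
        · subst h1 h2
          simp [eps_coe]
        · simp [eps_coe, Matrix.single_apply, h2]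
      · simp [eps_coe, Matrix.single_apply, h1]
    · intro d _ hd
      simp [eps_coe, Matrix.single_apply, Ne.symm hd]
    · simp

theorem Psi_Phi (p : G → A →ₗ[k] A) (p1 : ∀ g m, p g m ∈ 𝒜 g)
    (f : G → G → A ⊗[k] A) (g h : G) :
    Psi hone hmul g h (Phi hone hmul p p1 f) = tproj p (g * h⁻¹) (f g h) := by
  simp only [Phi_apply, map_sum, Psi_map_eps]
  rw [Finset.sum_eq_single g (by intro b _ hb; simp [hb]) (by simp),
    Finset.sum_eq_single h (by intro b _ hb; simp [hb]) (by simp)]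
  simp only [if_true, tproj, LinearMap.sum_apply]
  rw [← Equiv.sum_comp ((Equiv.inv G).trans (Equiv.mulRight g))]
  refine Finset.sum_congr rfl fun c _ => ?_
  simp [mul_assoc]

end Helpers

/-- Let `G` be a finite group and `A` a `G`-graded `k`-algebra.  If `P` is a graded
projective `A`-`A`-bimodule, i.e. `P ∈ add(A ⊗_k A)` in the category of graded
bimodules, then `P̄ = (P_{gh⁻¹})_{g,h ∈ G}` is a projective `Ā`-`Ā`-bimodule, i.e.
`P̄ ∈ add(Ā ⊗_k Ā)`, where `Ā = (A_{gh⁻¹})_{g,h ∈ G}` is the Beilinson-Green algebra of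
`A`. -/
theorem barConstruction_projective_bimodule
    (k : Type u) [Field k]
    (G : Type u) [Group G] [Fintype G] [DecidableEq G]
    (A : Type u) [Ring A] [Algebra k A] [FiniteDimensional k A]
    (𝒜 : G → Submodule k A) (hA : DirectSum.IsInternal 𝒜)
    (hone : (1 : A) ∈ 𝒜 1)
    (hmul : ∀ (g h : G) (a b : A), a ∈ 𝒜 g → b ∈ 𝒜 h → a * b ∈ 𝒜 (g * h))
    (P : Type u) [AddCommGroup P] [Module k P] [Module A P] [Module Aᵐᵒᵖ P]
    [SMulCommClass A Aᵐᵒᵖ P] [SMulCommClass k A P] [SMulCommClass k Aᵐᵒᵖ P]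
    (ℙP : G → Submodule k P) (hP : DirectSum.IsInternal ℙP)
    -- `P ∈ add(A ⊗_k A)` in the category of graded bimodules
    (hPadd : ∃ (n : ℕ) (ι : P →ₗ[k] (Fin n → A ⊗[k] A))
        (π : (Fin n → A ⊗[k] A) →ₗ[k] P),
      π ∘ₗ ι = LinearMap.id ∧
      -- `ι` and `π` are maps of `A`-`A`-bimodules
      (∀ (a : A) (p : P) (i : Fin n), ι (a • p) i = a • ι p i) ∧
      (∀ (a : A) (p : P) (i : Fin n),
        ι (op a • p) i = LinearMap.lTensor A (LinearMap.mulRight k a) (ι p i)) ∧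
      (∀ (a : A) (z : Fin n → A ⊗[k] A), π (fun i => a • z i) = a • π z) ∧
      (∀ (a : A) (z : Fin n → A ⊗[k] A),
        π (fun i => LinearMap.lTensor A (LinearMap.mulRight k a) (z i)) = op a • π z) ∧
      -- `ι` is graded
      (∀ (g : G) (p : P), p ∈ ℙP g → ∀ i : Fin n, ι p i ∈ gradedTensorDeg k G A 𝒜 g)) :
    -- conclusion: `P̄ ∈ add(Ā ⊗_k Ā)` as `Ā`-`Ā`-bimodules
    ∀ [instL : Module (barAlgebra k G A 𝒜 hone hmul) (barModule k G P ℙP)]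
      [instR : Module (barAlgebra k G A 𝒜 hone hmul)ᵐᵒᵖ (barModule k G P ℙP)],
      -- the actions of `Ā` on `P̄` are by matrix multiplication
      (∀ (a : barAlgebra k G A 𝒜 hone hmul) (p : barModule k G P ℙP) (g h : G),
        ((a • p : barModule k G P ℙP) : G → G → P) g h
          = ∑ c : G, ((a : Matrix G G A) g c) • ((p : G → G → P) c h)) →
      (∀ (a : barAlgebra k G A 𝒜 hone hmul) (p : barModule k G P ℙP) (g h : G),
        ((op a • p : barModule k G P ℙP) : G → G → P) g h
          = ∑ c : G, op ((a : Matrix G G A) c h) • ((p : G → G → P) g c)) →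
      ∃ (n : ℕ)
        (ι : (barModule k G P ℙP : Type u) →ₗ[k]
          (Fin n → (barAlgebra k G A 𝒜 hone hmul : Type u) ⊗[k]
            (barAlgebra k G A 𝒜 hone hmul : Type u)))
        (π : (Fin n → (barAlgebra k G A 𝒜 hone hmul : Type u) ⊗[k]
            (barAlgebra k G A 𝒜 hone hmul : Type u)) →ₗ[k]
          (barModule k G P ℙP : Type u)),
        π ∘ₗ ι = LinearMap.id ∧
        (∀ (a : barAlgebra k G A 𝒜 hone hmul) (p : barModule k G P ℙP) (i : Fin n),
          ι (a • p) i = a • ι p i) ∧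
        (∀ (a : barAlgebra k G A 𝒜 hone hmul) (p : barModule k G P ℙP) (i : Fin n),
          ι (op a • p) i
            = LinearMap.lTensor _ (LinearMap.mulRight k a) (ι p i)) ∧
        (∀ (a : barAlgebra k G A 𝒜 hone hmul)
          (z : Fin n → (barAlgebra k G A 𝒜 hone hmul : Type u) ⊗[k]
            (barAlgebra k G A 𝒜 hone hmul : Type u)),
          π (fun i => a • z i) = a • π z) ∧
        (∀ (a : barAlgebra k G A 𝒜 hone hmul)
          (z : Fin n → (barAlgebra k G A 𝒜 hone hmul : Type u) ⊗[k]
            (barAlgebra k G A 𝒜 hone hmul : Type u)),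
          π (fun i => LinearMap.lTensor _ (LinearMap.mulRight k a) (z i))
            = op a • π z) := by
  intro instL instR hL hR
  obtain ⟨n, ι, π, hπι, ιl, ιr, πl, πr, ιg⟩ := hPadd
  obtain ⟨p, p1, p2, p3, p4⟩ := exists_proj 𝒜 hA
  obtain ⟨q, q1, q2, q3, q4⟩ := exists_proj ℙP hP
  have hl := proj_mul_left hmul p1 p2 p3 p4
  have hr := proj_mul_right hmul p1 p2 p3 p4
  have hinj : Function.Injective ι := by
    intro x y hxy
    have := congrArg π hxy
    rwa [← LinearMap.comp_apply, ← LinearMap.comp_apply, hπι] at this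
  have hιq : ∀ (x : G) (m : P) (i : Fin n), ι (q x m) i = tproj p x (ι m i) := by
    intro x m i
    conv_rhs => rw [← q4 m]
    rw [map_sum, Finset.sum_apply, map_sum, Finset.sum_eq_single x]
    · rw [tproj_of_mem p2 p3 x x _ (ιg x _ (q1 x m) i), if_pos rfl]
    · intro y _ hy
      rw [tproj_of_mem p2 p3 y x _ (ιg y _ (q1 y m) i), if_neg (Ne.symm hy)]
    · simp
  have ql : ∀ (u x : G) (a : A) (m : P), a ∈ 𝒜 u → q (u * x) (a • m) = a • q x m := by
    intro u x a m ha
    apply hinj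
    funext i
    rw [hιq, ιl, ιl, hιq, tproj_smul hl _ _ _ ha]
  have qr : ∀ (u x : G) (a : A) (m : P), a ∈ 𝒜 u → q (x * u) (op a • m) = op a • q x m := by
    intro u x a m ha
    apply hinj
    funext i
    rw [hιq, ιr, ιr, hιq, tproj_rsmul hr _ _ _ ha]
  let ι' : (barModule k G P ℙP : Type u) →ₗ[k]
      (Fin n → (barAlgebra k G A 𝒜 hone hmul : Type u) ⊗[k]
        (barAlgebra k G A 𝒜 hone hmul : Type u)) :=
    { toFun := fun f i => Phi hone hmul p p1 (fun g h => ι ((f : G → G → P) g h) i)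
      map_add' := by
        intro f f'
        funext i
        rw [Pi.add_apply, ← map_add]
        congr 1
        funext g h
        exact congrFun (map_add ι _ _) i
      map_smul' := by
        intro r f
        funext i
        rw [Pi.smul_apply, RingHom.id_apply, ← map_smul]
        congr 1
        funext g h
        exact congrFun (map_smul ι _ _) i }
  let π' : (Fin n → (barAlgebra k G A 𝒜 hone hmul : Type u) ⊗[k]
        (barAlgebra k G A 𝒜 hone hmul : Type u)) →ₗ[k] (barModule k G P ℙP : Type u) :=
    { toFun := fun z => ⟨fun g h => q (g * h⁻¹) (π (fun i => Psi hone hmul g h (z i))),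
        fun g h => q1 _ _⟩
      map_add' := by
        intro z z'
        apply Subtype.ext
        funext g h
        change _ = q (g * h⁻¹) _ + q (g * h⁻¹) _
        rw [← map_add, ← map_add]
        refine congrArg (fun w => q (g * h⁻¹) (π w)) ?_
        funext i
        exact map_add _ _ _
      map_smul' := by
        intro r z
        apply Subtype.ext
        funext g h
        change _ = r • q (g * h⁻¹) _
        rw [← map_smul, ← map_smul]
        refine congrArg (fun w => q (g * h⁻¹) (π w)) ?_
        funext i
        exact map_smul (Psi hone hmul g h) r (z i) }
  have hι' : ∀ f i, ι' f i = Phi hone hmul p p1 (fun g h => ι ((f : G → G → P) g h) i) :=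
    fun _ _ => rfl
  have hπ' : ∀ z g h, ((π' z : barModule k G P ℙP) : G → G → P) g h
      = q (g * h⁻¹) (π (fun i => Psi hone hmul g h (z i))) := fun _ _ _ => rfl
  refine ⟨n, ι', π', ?_, ?_, ?_, ?_, ?_⟩
  · apply LinearMap.ext
    intro f
    apply Subtype.ext
    funext g h
    have hf : (f : G → G → P) g h ∈ ℙP (g * h⁻¹) := f.2 g h
    rw [LinearMap.comp_apply, hπ', LinearMap.id_apply]
    have : (fun i => Psi hone hmul g h (ι' f i)) = ι ((f : G → G → P) g h) := by
      funext i
      rw [hι', Psi_Phi, ← hιq, q2 _ _ hf]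
    rw [this, show π (ι ((f : G → G → P) g h)) = _ from LinearMap.congr_fun hπι _, LinearMap.id_apply, q2 _ _ hf]
  · intro a f i
    rw [hι', hι', ← Phi_smul p p1 hl]
    congr 1
    funext g h
    rw [hL, map_sum, Finset.sum_apply]
    exact Finset.sum_congr rfl fun c _ => ιl _ _ _
  · intro a f i
    rw [hι', hι', ← Phi_rsmul p p1 hr]
    congr 1
    funext g h
    rw [hR, map_sum, Finset.sum_apply]
    exact Finset.sum_congr rfl fun c _ => ιr _ _ _
  · intro a z
    apply Subtype.ext
    funext g h
    rw [hπ', hL]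
    have : (fun i => Psi hone hmul g h (a • z i))
        = ∑ c : G, fun i => (a : Matrix G G A) g c • Psi hone hmul c h (z i) := by
      funext i
      rw [Psi_smul, Finset.sum_apply]
    rw [this, map_sum, map_sum]
    refine Finset.sum_congr rfl fun c _ => ?_
    rw [hπ', πl, ← ql (g * c⁻¹) _ _ _ (a.2 g c)]
    congr 2
    group
  · intro a z
    apply Subtype.ext
    funext g h
    rw [hπ', hR]
    have : (fun i => Psi hone hmul g h (LinearMap.lTensor _ (LinearMap.mulRight k a) (z i)))
        = ∑ c : G, fun i => LinearMap.lTensor A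
          (LinearMap.mulRight k ((a : Matrix G G A) c h)) (Psi hone hmul g c (z i)) := by
      funext i
      rw [Psi_rsmul, Finset.sum_apply]
    rw [this, map_sum, map_sum]
    refine Finset.sum_congr rfl fun c _ => ?_
    rw [hπ', πr, ← qr (c * h⁻¹) _ _ _ (a.2 c h)]
    congr 2
    group
end
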